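/- arXiv:1910.11719 — 5 statements merged into one kernel-verified Lean document; each statement's English description precedes it below -/
import Mathlib

section
/- Let B be a ball in ℝ^{d+1}, let λ > 1, 0 < q ≤ ∞ and n ∈ ℕ. Then for every algebraic polynomial P of total degree ≤ n on ℝ^{d+1}: ‖P‖_{L^q(λB)} ≤ C_{d,q} · (5λ)^{n + (d+1)/q} · ‖P‖_{L^q(B)}, where λB denotes the dilation of B about its center by factor λ, C_{d,q} depends only on d and q, and (d+1)/q is interpreted as 0 when q = ∞. -/
open MeasureTheory ENNReal NNReal

noncomputable section

open Polynomial in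
/-- Among polynomials of degree `≤ n` bounded by `M` on `[-1, 1]`, the derivatives on `[1, ∞)` are
dominated by those of `M * T n`. -/
theorem abs_eval_iterate_derivative_le_mul_T {n : ℕ} {p : ℝ[X]} (hp : p.natDegree ≤ n) {M : ℝ}
    (hM : ∀ x ∈ Set.Icc (-1 : ℝ) 1, |p.eval x| ≤ M) (k : ℕ) {x : ℝ} (hx : 1 ≤ x) :
    |(derivative^[k] p).eval x| ≤ M * (derivative^[k] (Chebyshev.T ℝ n)).eval x := by
  have hM0 : 0 ≤ M := (abs_nonneg _).trans (hM 0 (by norm_num))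
  rcases hM0.eq_or_lt with rfl | hM0
  · have : p = 0 := by
      refine eq_zero_of_infinite_isRoot p
        ((Set.Icc_infinite (by norm_num : (-1 : ℝ) < 1)).mono fun y hy => ?_)
      exact abs_nonpos_iff.1 (hM y hy)
    simp [this]
  · have key : ∀ a : ℝ, |a| = 1 →
        a * (derivative^[k] p).eval x ≤ M * (derivative^[k] (Chebyshev.T ℝ n)).eval x := by
      intro a ha
      have h := Chebyshev.eval_iterate_derivative_le_of_forall_abs_le_one (n := n)
        (P := C (a * M⁻¹) * p) (k := k) hx
        (degree_le_of_natDegree_le ((natDegree_C_mul_le _ _).trans hp)) (fun y hy => by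
          rw [eval_mul, eval_C, abs_mul, abs_mul, ha, one_mul, abs_inv, abs_of_pos hM0,
            inv_mul_le_iff₀ hM0, mul_one]
          exact hM y hy)
      rw [iterate_derivative_C_mul, eval_mul, eval_C] at h
      calc a * (derivative^[k] p).eval x = M * (a * M⁻¹ * (derivative^[k] p).eval x) := by
            field_simp
        _ ≤ _ := by gcongr
    refine abs_le'.2 ⟨?_, ?_⟩
    · simpa using key 1 (by simp)
    · simpa using key (-1) (by simp)

open Polynomial in
theorem eval_chebyshev_T_le_pow (n : ℕ) {x : ℝ} (hx : 1 ≤ x) :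
    (Chebyshev.T ℝ n).eval x ≤ (2 * x) ^ n := by
  induction n using Nat.twoStepInduction with
  | zero => simp
  | one => simp; linarith
  | more n _ ih =>
    have h := Chebyshev.one_le_eval_T_real (n : ℤ) hx
    push_cast at ih ⊢
    rw [Chebyshev.T_add_two, eval_sub, eval_mul, eval_mul, eval_X, eval_ofNat, pow_succ']
    have := mul_le_mul_of_nonneg_left ih (by linarith : 0 ≤ 2 * x)
    linarith

open Polynomial in
theorem abs_eval_le_two_mul_pow {n : ℕ} {p : ℝ[X]} (hp : p.natDegree ≤ n) {M : ℝ}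
    (hM : ∀ x ∈ Set.Icc (-1 : ℝ) 1, |p.eval x| ≤ M) {x : ℝ} (hx : 1 ≤ x) :
    |p.eval x| ≤ (2 * x) ^ n * M := by
  have hM0 : 0 ≤ M := (abs_nonneg _).trans (hM 0 (by norm_num))
  have h := abs_eval_iterate_derivative_le_mul_T hp hM 0 hx
  rw [mul_comm]
  exact h.trans (mul_le_mul_of_nonneg_left (eval_chebyshev_T_le_pow n hx) hM0)

open Polynomial in
/-- One-sided Markov inequality. -/
theorem abs_eval_derivative_le {n : ℕ} {p : ℝ[X]} (hp : p.natDegree ≤ n) {M : ℝ}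
    (hM : ∀ x ∈ Set.Icc (0 : ℝ) 1, |p.eval x| ≤ M) {t : ℝ} (ht0 : 0 ≤ t) (ht : t ≤ 1 / 2) :
    |p.derivative.eval t| ≤ 4 * n ^ 2 * M := by
  have hM0 : 0 ≤ M := (abs_nonneg _).trans (hM 0 (by norm_num))
  let l : ℝ[X] := C (-((1 - t) / 2)) * X + C ((1 + t) / 2)
  have hl : l.natDegree ≤ 1 := natDegree_linear_le
  have hpl : (p.comp l).natDegree ≤ n :=
    natDegree_comp_le.trans ((Nat.mul_le_mul hp hl).trans (by simp))
  have h := abs_eval_iterate_derivative_le_mul_T hpl (M := M) (fun u hu => by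
    rw [eval_comp]
    apply hM
    simp only [l, eval_add, eval_mul, eval_C, eval_X]
    obtain ⟨h1, h2⟩ := hu
    constructor <;> nlinarith) 1 le_rfl
  have hl1 : l.eval 1 = t := by simp [l]; ring
  have hl' : l.derivative = C (-((1 - t) / 2)) := by simp [l]
  rw [Function.iterate_one, derivative_comp, eval_mul, eval_comp, hl1, hl', eval_C,
    Chebyshev.derivative_T_eval_one, abs_mul, abs_neg,
    abs_of_nonneg (by linarith : 0 ≤ (1 - t) / 2)] at h
  push_cast at h
  nlinarith [abs_nonneg (p.derivative.eval t)]

open Polynomial in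
theorem half_le_abs_eval {n : ℕ} {p : ℝ[X]} (hp : p.natDegree ≤ n)
    (hM : ∀ x ∈ Set.Icc (0 : ℝ) 1, |p.eval x| ≤ |p.eval 0|) {t : ℝ} (ht0 : 0 ≤ t)
    (ht : t ≤ 1 / (8 * ((n : ℝ) + 1) ^ 2)) :
    |p.eval 0| / 2 ≤ |p.eval t| := by
  have hn : (0 : ℝ) ≤ n := n.cast_nonneg
  have ht' : t * (8 * ((n : ℝ) + 1) ^ 2) ≤ 1 := (le_div_iff₀ (by positivity)).1 ht
  have ht2 : t ≤ 1 / 2 := by nlinarith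
  have h := (convex_Icc (0 : ℝ) (1 / 2)).norm_image_sub_le_of_norm_deriv_le
    (f := fun x => p.eval x) (C := 4 * n ^ 2 * |p.eval 0|)
    (fun x _ => p.differentiableAt) (fun x hx => by
      rw [Polynomial.deriv, Real.norm_eq_abs]
      exact abs_eval_derivative_le hp hM hx.1 hx.2)
    (x := 0) (y := t) (by norm_num) ⟨ht0, ht2⟩
  rw [Real.norm_eq_abs, Real.norm_eq_abs, sub_zero, abs_of_nonneg ht0] at h
  have h1 : 4 * (n : ℝ) ^ 2 * t ≤ 1 / 2 := by nlinarith
  have h2 := mul_le_mul_of_nonneg_right h1 (abs_nonneg (p.eval 0))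
  have h3 := abs_sub_abs_le_abs_sub (p.eval 0) (p.eval t)
  rw [abs_sub_comm] at h3
  linarith

open Polynomial in
theorem exists_polynomial_eval_line {σ : Type*} (P : MvPolynomial σ ℝ)
    {n : ℕ} (hP : P.totalDegree ≤ n) (x v : σ → ℝ) :
    ∃ p : ℝ[X], p.natDegree ≤ n ∧
      ∀ t : ℝ, p.eval t = MvPolynomial.eval (fun i => x i + t * v i) P := by
  refine ⟨MvPolynomial.aeval (fun i => C (v i) * X + C (x i)) P, ?_, fun t => ?_⟩
  · have := MvPolynomial.aeval_natDegree_le P hP (fun i => C (v i) * X + C (x i))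
      (n := 1) (fun i => natDegree_linear_le)
    simpa using this
  · rw [← coe_evalRingHom, MvPolynomial.map_aeval]
    simp only [MvPolynomial.eval, MvPolynomial.coe_eval₂Hom]
    congr 1
    · ext; simp
    · funext i; simp; ring

section Ball

variable {ι : Type*} [Fintype ι] {P : MvPolynomial ι ℝ} {n : ℕ} {c : EuclideanSpace ℝ ι} {R M : ℝ}

theorem abs_eval_le_of_mem_dilated_closedBall (hP : P.totalDegree ≤ n) {lam : ℝ} (hlam : 1 ≤ lam)
    (hM : ∀ x ∈ Metric.closedBall c R, |MvPolynomial.eval (fun i => x i) P| ≤ M)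
    {x : EuclideanSpace ℝ ι} (hx : x ∈ Metric.closedBall c (lam * R)) :
    |MvPolynomial.eval (fun i => x i) P| ≤ (2 * lam) ^ n * M := by
  have hlam0 : 0 < lam := by linarith
  obtain ⟨p, hp, hpe⟩ := exists_polynomial_eval_line P hP (fun i => c i)
    (fun i => (lam⁻¹ • (x - c)) i)
  have hbd : ∀ t ∈ Set.Icc (-1 : ℝ) 1, |p.eval t| ≤ M := fun t ht => by
    rw [hpe]
    refine hM (c + t • lam⁻¹ • (x - c)) ?_
    rw [mem_closedBall_iff_norm] at hx ⊢
    rw [add_sub_cancel_left, norm_smul, norm_smul, norm_inv, Real.norm_of_nonneg hlam0.le]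
    have h1 : lam⁻¹ * ‖x - c‖ ≤ R := by rwa [inv_mul_le_iff₀ hlam0]
    calc ‖t‖ * (lam⁻¹ * ‖x - c‖) ≤ 1 * (lam⁻¹ * ‖x - c‖) := by
          gcongr; exact abs_le.2 ht
      _ ≤ R := by linarith
  have h := abs_eval_le_two_mul_pow hp hbd hlam
  rw [hpe] at h
  convert h using 4
  funext i
  simp
  field_simp
  ring

theorem half_le_abs_eval_of_mem_homothety (hP : P.totalDegree ≤ n) {x₀ : EuclideanSpace ℝ ι}
    (hx₀ : x₀ ∈ Metric.closedBall c R)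
    (hM : ∀ x ∈ Metric.closedBall c R,
      |MvPolynomial.eval (fun i => x i) P| ≤ |MvPolynomial.eval (fun i => x₀ i) P|)
    {x : EuclideanSpace ℝ ι}
    (hx : x ∈ AffineMap.homothety x₀ (1 / (8 * ((n : ℝ) + 1) ^ 2)) '' Metric.closedBall c R) :
    |MvPolynomial.eval (fun i => x₀ i) P| / 2 ≤ |MvPolynomial.eval (fun i => x i) P| := by
  obtain ⟨y, hy, rfl⟩ := hx
  obtain ⟨p, hp, hpe⟩ := exists_polynomial_eval_line P hP (fun i => x₀ i) (fun i => (y - x₀) i)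
  have h0 : p.eval 0 = MvPolynomial.eval (fun i => x₀ i) P := by simp [hpe]
  have hbd : ∀ t ∈ Set.Icc (0 : ℝ) 1, |p.eval t| ≤ |p.eval 0| := fun t ht => by
    rw [h0, hpe]
    exact hM (x₀ + t • (y - x₀)) ((convex_closedBall c R).add_smul_sub_mem hx₀ hy ht)
  have h := half_le_abs_eval hp hbd (t := 1 / (8 * ((n : ℝ) + 1) ^ 2)) (by positivity) le_rfl
  rw [h0, hpe] at h
  convert h using 4
  simp [AffineMap.homothety_apply, add_comm]

end Ball

theorem exists_rpow_le_mul_pow (b : ℝ) :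
    ∃ K : ℝ, 0 < K ∧ ∀ n : ℕ, (8 * ((n : ℝ) + 1) ^ 2) ^ b ≤ K * (5 / 2 : ℝ) ^ n := by
  obtain ⟨k, hk⟩ := exists_nat_ge b
  have h := (tendsto_pow_const_mul_const_pow_of_lt_one (2 * k) (r := 2 / 5)
    (by norm_num) (by norm_num)).bddAbove_range
  obtain ⟨K, hK⟩ := h
  have hK0 : ∀ n : ℕ, (n : ℝ) ^ (2 * k) * (2 / 5 : ℝ) ^ n ≤ K := fun n => hK ⟨n, rfl⟩
  have hKpos : 0 < K := lt_of_lt_of_le (by norm_num) (hK0 1)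
  refine ⟨8 ^ k * K * (5 / 2), by positivity, fun n => ?_⟩
  have h1 := hK0 (n + 1)
  have hb : (1 : ℝ) ≤ 8 * ((n : ℝ) + 1) ^ 2 := by nlinarith [n.cast_nonneg (α := ℝ)]
  have e : (2 / 5 : ℝ) ^ (n + 1) * (5 / 2) ^ (n + 1) = 1 := by
    rw [← mul_pow]; norm_num
  calc (8 * ((n : ℝ) + 1) ^ 2) ^ b ≤ (8 * ((n : ℝ) + 1) ^ 2) ^ (k : ℝ) :=
        Real.rpow_le_rpow_of_exponent_le hb hk
    _ = 8 ^ k * (((n + 1 : ℕ) : ℝ) ^ (2 * k) * (2 / 5 : ℝ) ^ (n + 1)) * (5 / 2) ^ (n + 1) := by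
        rw [Real.rpow_natCast, mul_assoc (8 ^ k), mul_assoc (_ ^ (2 * k)), e, mul_pow, pow_mul]
        push_cast; ring
    _ ≤ 8 ^ k * K * (5 / 2) ^ (n + 1) := by gcongr
    _ = 8 ^ k * K * (5 / 2) * (5 / 2) ^ n := by ring

/-- Lemma `lem-4-1`, Dai–Prymak.
For a ball `B ⊆ ℝ^{d+1}`, `λ > 1`, and a polynomial `P` of total degree `≤ n`,
`‖P‖_{L^q(λB)} ≤ C_{d,q} (5λ)^{n+(d+1)/q} ‖P‖_{L^q(B)}` (exponent `(d+1)/q` read as `0`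
when `q = ∞`). -/
theorem statement6 (d : ℕ) (q : ℝ≥0∞) (hq : 0 < q) :
    ∃ C : ℝ≥0, 0 < C ∧
      ∀ (c : EuclideanSpace ℝ (Fin (d + 1))) (R : ℝ), 0 < R →
      ∀ lam : ℝ, 1 < lam →
      ∀ (n : ℕ) (P : MvPolynomial (Fin (d + 1)) ℝ), P.totalDegree ≤ n →
        eLpNorm (fun x : EuclideanSpace ℝ (Fin (d + 1)) => MvPolynomial.eval (fun i => x i) P)
            q (volume.restrict (Metric.closedBall c (lam * R))) ≤
          C * ENNReal.ofReal ((5 * lam) ^ ((n : ℝ) + (d + 1) / q.toReal)) *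
            eLpNorm (fun x : EuclideanSpace ℝ (Fin (d + 1)) =>
              MvPolynomial.eval (fun i => x i) P) q (volume.restrict (Metric.closedBall c R)) := by
  set a : ℝ := q.toReal⁻¹ with ha
  have ha0 : 0 ≤ a := by positivity
  set b : ℝ := ((d : ℝ) + 1) * a with hb
  have hb0 : 0 ≤ b := by positivity
  obtain ⟨K, hK, hKn⟩ := exists_rpow_le_mul_pow b
  refine ⟨(2 * K).toNNReal, Real.toNNReal_pos.2 (by positivity), ?_⟩
  intro c R hR lam hlam n P hP
  have hlam0 : 0 < lam := by linarith
  set f : EuclideanSpace ℝ (Fin (d + 1)) → ℝ :=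
    fun x => MvPolynomial.eval (fun i => x i) P
  have hfc : Continuous f := P.continuous_eval.comp (by fun_prop)
  obtain ⟨x₀, hx₀, hmax⟩ := (isCompact_closedBall c R).exists_isMaxOn
    ⟨c, Metric.mem_closedBall_self hR.le⟩ hfc.abs.continuousOn
  have hmax' : ∀ x ∈ Metric.closedBall c R, |f x| ≤ |f x₀| := fun x hx => hmax hx
  set V : ℝ≥0∞ := volume (Metric.closedBall c R) with hV
  have hV0 : V ≠ 0 := (Metric.measure_closedBall_pos volume c hR).ne'
  set s : ℝ := 1 / (8 * ((n : ℝ) + 1) ^ 2) with hs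
  have hs0 : 0 < s := by positivity
  have hs1 : s ≤ 1 := by
    rw [hs, div_le_one (by positivity)]
    nlinarith [n.cast_nonneg (α := ℝ)]
  have hscale : ∀ r : ℝ, 0 ≤ r →
      (ENNReal.ofReal (r ^ (d + 1)) * V) ^ a = ENNReal.ofReal (r ^ b) * V ^ a := by
    intro r hr
    rw [ENNReal.mul_rpow_of_nonneg _ _ ha0, ENNReal.ofReal_rpow_of_nonneg (by positivity) ha0,
      ← Real.rpow_natCast, ← Real.rpow_mul hr]
    push_cast
    rfl
  have upper : eLpNorm f q (volume.restrict (Metric.closedBall c (lam * R))) ≤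
      ENNReal.ofReal (lam ^ b * ((2 * lam) ^ n * |f x₀|)) * V ^ a := by
    have h := eLpNorm_le_of_ae_bound (p := q)
      (μ := volume.restrict (Metric.closedBall c (lam * R))) (f := f)
      (C := (2 * lam) ^ n * |f x₀|)
      ((ae_restrict_iff' Metric.isClosed_closedBall.measurableSet).2 (.of_forall fun x hx =>
        abs_eval_le_of_mem_dilated_closedBall hP hlam.le hmax' hx))
    have hvol : volume (Metric.closedBall c (lam * R)) = ENNReal.ofReal (lam ^ (d + 1)) * V := by
      rw [hV, Measure.addHaar_closedBall_mul _ _ hlam0.le hR.le,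
        Measure.addHaar_closedBall_center volume c, finrank_euclideanSpace_fin]
    rw [Measure.restrict_apply_univ, hvol, ← ha, hscale _ hlam0.le] at h
    rw [ENNReal.ofReal_mul (by positivity)]
    exact h.trans_eq (by ring)
  have lower : ENNReal.ofReal (s ^ b * (|f x₀| / 2)) * V ^ a ≤
      eLpNorm f q (volume.restrict (Metric.closedBall c R)) := by
    set A := AffineMap.homothety x₀ s '' Metric.closedBall c R with hA
    have hAB : A ⊆ Metric.closedBall c R := by
      rintro _ ⟨y, hy, rfl⟩
      rw [AffineMap.homothety_apply, vsub_eq_sub, vadd_eq_add, add_comm (s • (y - x₀))]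
      exact (convex_closedBall c R).add_smul_sub_mem hx₀ hy ⟨hs0.le, hs1⟩
    have hAm : MeasurableSet A :=
      ((isCompact_closedBall c R).image
        (AffineMap.homothety_continuous x₀ s)).isClosed.measurableSet
    have hvol : volume A = ENNReal.ofReal (s ^ (d + 1)) * V := by
      rw [hA, Measure.addHaar_image_homothety, finrank_euclideanSpace_fin,
        abs_of_pos (by positivity)]
    have hA0 : volume A ≠ 0 := by
      rw [hvol]
      exact mul_ne_zero (by simpa using pow_pos hs0 _) hV0
    have h1 : eLpNorm (fun _ : EuclideanSpace ℝ (Fin (d + 1)) => |f x₀| / 2) q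
        (volume.restrict A) ≤ eLpNorm f q (volume.restrict A) :=
      eLpNorm_mono_ae ((ae_restrict_iff' hAm).2 (.of_forall fun x hx => by
        rw [Real.norm_of_nonneg (by positivity)]
        exact half_le_abs_eval_of_mem_homothety hP hx₀ hmax' hx))
    rw [eLpNorm_const _ hq.ne' (by simpa using hA0), Measure.restrict_apply_univ, hvol, one_div,
      ← ha, hscale _ hs0.le, Real.enorm_of_nonneg (by positivity)] at h1
    refine le_trans (le_of_eq ?_)
      (h1.trans (eLpNorm_mono_measure f (Measure.restrict_mono hAB le_rfl)))
    rw [ENNReal.ofReal_mul (by positivity)]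
    ring
  have hexp : ((d : ℝ) + 1) / q.toReal = b := by rw [hb, ha, div_eq_mul_inv]
  rw [hexp]
  change _ ≤ ENNReal.ofReal (2 * K) * _ * _
  refine upper.trans (le_trans ?_ (mul_le_mul_right lower _))
  rw [← ENNReal.ofReal_mul (by positivity), ← mul_assoc (ENNReal.ofReal _), ← ENNReal.ofReal_mul (by positivity)]
  refine mul_le_mul_left (ENNReal.ofReal_le_ofReal ?_) _
  have hsb : s ^ b * (8 * ((n : ℝ) + 1) ^ 2) ^ b = 1 := by
    rw [← Real.mul_rpow hs0.le (by positivity), hs, one_div_mul_cancel (by positivity),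
      Real.one_rpow]
  have h5 : (1 : ℝ) ≤ 5 ^ b := Real.one_le_rpow (by norm_num) hb0
  have hone : 1 ≤ 5 ^ b * (s ^ b * (K * (5 / 2) ^ n)) := by
    refine one_le_mul_of_one_le_of_one_le h5 (hsb.symm.le.trans ?_)
    gcongr
    exact hKn n
  rw [Real.rpow_add (by positivity), Real.rpow_natCast, Real.mul_rpow (by norm_num) hlam0.le]
  calc lam ^ b * ((2 * lam) ^ n * |f x₀|)
      ≤ lam ^ b * ((2 * lam) ^ n * |f x₀|) * (5 ^ b * (s ^ b * (K * (5 / 2) ^ n))) :=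
        le_mul_of_one_le_right (by positivity) hone
    _ = _ := by
        have e : (5 * lam) ^ n = (2 * lam) ^ n * (5 / 2) ^ n := by rw [← mul_pow]; ring
        rw [e]
        ring
end
end

section
/- Let b > 0 and n ∈ ℕ, and for 0 ≤ i ≤ n set t_i := −b + 2ib/n; for a multi-index j = (j₁,…,j_d) ∈ {0,…,n−1}^d let Δ_j := [t_{j₁}, t_{j₁+1}] × ⋯ × [t_{j_d}, t_{j_d+1}] and let x_j be an arbitrary point of Δ_j. Then for every ℓ > 1 there exists a family of algebraic polynomials {v_j}_{j ∈ {0,…,n−1}^d} on ℝ^d, each of total degree ≤ 2dn, such that Σ_j v_j(x) = 1 for all x ∈ [−b, b]^d, and |v_j(x)| ≤ C (1 + n‖x − x_j‖)^{−ℓ} for all x ∈ [−b, b]^d and all j, where the constant C depends only on ℓ, d and b. -/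
open MeasureTheory ENNReal NNReal

noncomputable section

/-- grid point `t_i = -b + 2ib/n` -/
def gridPt (b : ℝ) (n i : ℕ) : ℝ := -b + 2 * i * b / n

theorem exists_sin_odd_mul_eq (m : ℕ) : ∃ Q : Polynomial ℝ, Q.natDegree ≤ 2 * m ∧
    ∀ θ : ℝ, Real.sin ((2 * m + 1) * θ) = Real.sin θ * Q.eval (Real.sin θ) := by
  induction m using Nat.twoStepInduction with
  | zero => exact ⟨1, by simp, fun θ => by simp⟩
  | one =>
    refine ⟨3 - 4 * Polynomial.X ^ 2, by compute_degree, fun θ => ?_⟩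
    have h : (2 * ((1 : ℕ) : ℝ) + 1) * θ = 3 * θ := by push_cast; ring
    rw [h, Real.sin_three_mul]
    simp
    ring
  | more m ih₀ ih₁ =>
    obtain ⟨P, hP, hPs⟩ := ih₀
    obtain ⟨Q, hQ, hQs⟩ := ih₁
    refine ⟨(2 - 4 * Polynomial.X ^ 2) * Q - P, ?_, fun θ => ?_⟩
    · have h2 : (2 - 4 * Polynomial.X ^ 2 : Polynomial ℝ).natDegree ≤ 2 := by compute_degree
      refine (Polynomial.natDegree_sub_le _ _).trans (max_le ?_ (by omega))
      refine Polynomial.natDegree_mul_le.trans ?_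
      omega
    · have h0 := hPs θ
      have h1 := hQs θ
      have hsum : Real.sin ((2 * ((m + 2 : ℕ) : ℝ) + 1) * θ) + Real.sin ((2 * m + 1) * θ) =
          2 * Real.cos (2 * θ) * Real.sin ((2 * ((m + 1 : ℕ) : ℝ) + 1) * θ) := by
        have ha : (2 * ((m + 2 : ℕ) : ℝ) + 1) * θ =
            (2 * ((m + 1 : ℕ) : ℝ) + 1) * θ + 2 * θ := by push_cast; ring
        have hb : (2 * (m : ℝ) + 1) * θ =
            (2 * ((m + 1 : ℕ) : ℝ) + 1) * θ - 2 * θ := by push_cast; ring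
        rw [ha, hb, Real.sin_add, Real.sin_sub]
        ring
      have hc : Real.cos (2 * θ) = 1 - 2 * Real.sin θ ^ 2 := by
        rw [Real.cos_two_mul, Real.cos_sq']
        ring
      rw [h0, h1, hc] at hsum
      simp only [Polynomial.eval_sub, Polynomial.eval_mul, Polynomial.eval_pow,
        Polynomial.eval_X, Polynomial.eval_ofNat]
      linear_combination hsum

theorem exists_polynomial_peaked_at_zero (m : ℕ) :
    ∃ Q : Polynomial ℝ, Q.natDegree ≤ 2 * m ∧
      (∀ x ∈ Set.Icc (-1 : ℝ) 1, |x * Q.eval x| ≤ 1) ∧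
      ∀ x : ℝ, 0 < x → x * (2 * m + 1) ≤ 1 → (2 * m + 1) / 2 ≤ Q.eval x := by
  obtain ⟨Q, hQ, hs⟩ := exists_sin_odd_mul_eq m
  refine ⟨Q, hQ, fun x hx => ?_, fun x hx hx1 => ?_⟩
  · have h := hs (Real.arcsin x)
    rw [Real.sin_arcsin hx.1 hx.2] at h
    rw [← h]
    exact Real.abs_sin_le_one _
  · have hN : (1 : ℝ) ≤ 2 * m + 1 := by linarith [(Nat.cast_nonneg m : (0 : ℝ) ≤ m)]
    have hx2 : x ≤ 1 := by nlinarith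
    set N : ℝ := 2 * m + 1
    have h := hs (Real.arcsin x)
    have hsin : Real.sin (Real.arcsin x) = x := Real.sin_arcsin (by linarith) hx2
    have hθ0 : 0 < Real.arcsin x := Real.arcsin_pos.2 hx
    have hθ1 := Real.arcsin_le_pi_div_two x
    have hpi := Real.pi_pos
    have hle := Real.mul_le_sin hθ0.le hθ1
    have hge := Real.sin_le hθ0.le
    rw [hsin] at h hle hge
    have hNθ : N * Real.arcsin x ≤ Real.pi / 2 := by
      have h1 : 2 / Real.pi * Real.arcsin x * N ≤ 1 :=
        (mul_le_mul_of_nonneg_right hle (by linarith)).trans hx1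
      have h2 : N * Real.arcsin x = Real.pi / 2 * (2 / Real.pi * Real.arcsin x * N) := by
        field_simp
      rw [h2]
      nlinarith
    have hle2 := Real.mul_le_sin (by positivity) hNθ
    rw [h] at hle2
    have h4 : 1 / 2 ≤ 2 / Real.pi := by
      rw [div_le_div_iff₀ two_pos hpi]
      linarith [Real.pi_le_four]
    have h5 : x * (N / 2) ≤ x * Q.eval x := by
      calc x * (N / 2) = 1 / 2 * (N * x) := by ring
        _ ≤ 2 / Real.pi * (N * Real.arcsin x) := by gcongr
        _ ≤ _ := hle2
    exact le_of_mul_le_mul_left h5 hx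

theorem exists_polynomial_derivative_eq (p : Polynomial ℝ) :
    ∃ A : Polynomial ℝ, A.natDegree ≤ p.natDegree + 1 ∧ A.derivative = p := by
  refine ⟨p.sum fun k a => Polynomial.C (a / (k + 1)) * Polynomial.X ^ (k + 1), ?_, ?_⟩
  · refine Polynomial.natDegree_sum_le_of_forall_le _ _ fun k hk => ?_
    exact (Polynomial.natDegree_C_mul_X_pow_le _ _).trans
      (Nat.succ_le_succ (Polynomial.le_natDegree_of_mem_supp k hk))
  · conv_rhs => rw [p.as_sum_support_C_mul_X_pow]
    rw [Polynomial.sum, Polynomial.derivative_sum]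
    refine Finset.sum_congr rfl fun k _ => ?_
    rw [Polynomial.derivative_C_mul_X_pow]
    have : ((k : ℝ) + 1) ≠ 0 := by positivity
    simp [this]

theorem eval_one_sub_eval_mul_pow_le_one {F : Polynomial ℝ} {L : ℕ}
    (hF : ∀ y : ℝ, 0 < y → y ≤ 1 → F.derivative.eval y * y ^ (2 * L + 2) ≤ 1)
    {x : ℝ} (hx0 : 0 < x) (hx1 : x ≤ 1) :
    (F.eval 1 - F.eval x) * x ^ (2 * L + 1) ≤ 1 := by
  have hderiv : ∀ y : ℝ, 0 < y → HasDerivAt (fun y => F.eval y + (y ^ (2 * L + 1))⁻¹)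
      (F.derivative.eval y + -((2 * L + 1 : ℕ) * y ^ (2 * L)) / (y ^ (2 * L + 1)) ^ 2) y := by
    intro y hy
    have h := hasDerivAt_pow (2 * L + 1) y
    exact (F.hasDerivAt y).add (h.fun_inv (by positivity))
  have hanti : AntitoneOn (fun y => F.eval y + (y ^ (2 * L + 1))⁻¹) (Set.Icc x 1) := by
    refine antitoneOn_of_deriv_nonpos (convex_Icc x 1)
      (fun y hy => (hderiv y (hx0.trans_le hy.1)).continuousAt.continuousWithinAt)
      (fun y hy => ?_) (fun y hy => ?_)
    all_goals
      rw [interior_Icc] at hy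
      have hy0 := hx0.trans hy.1
    · exact (hderiv y hy0).differentiableAt.differentiableWithinAt
    · rw [(hderiv y hy0).deriv]
      have h1 := hF y hy0 hy.2.le
      have h2 : F.derivative.eval y ≤ 1 / y ^ (2 * L + 2) := by
        rw [le_div_iff₀ (by positivity)]
        exact h1
      have h3 : -((2 * L + 1 : ℕ) * y ^ (2 * L)) / (y ^ (2 * L + 1)) ^ 2 =
          -((2 * L + 1) * (1 / y ^ (2 * L + 2))) := by
        push_cast
        field_simp
        ring
      rw [h3]
      have h4 : 0 ≤ 2 * (L : ℝ) * (1 / y ^ (2 * L + 2)) := by positivity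
      linarith
  have h := hanti (Set.left_mem_Icc.2 hx1) (Set.right_mem_Icc.2 hx1) hx1
  simp only [one_pow, inv_one] at h
  have h1 : F.eval 1 - F.eval x ≤ (x ^ (2 * L + 1))⁻¹ := by linarith
  calc _ ≤ (x ^ (2 * L + 1))⁻¹ * x ^ (2 * L + 1) := by gcongr
    _ = 1 := inv_mul_cancel₀ (by positivity)

theorem exists_polynomial_approx_step (L : ℕ) : ∃ K : ℝ, 0 < K ∧ ∀ n : ℕ, 0 < n →
    ∃ S : Polynomial ℝ, S.natDegree ≤ 2 * n ∧ ∀ x ∈ Set.Icc (-1 : ℝ) 1,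
      S.eval x ∈ Set.Icc (0 : ℝ) 1 ∧
      (0 < x → (1 - S.eval x) * (n * x) ^ (2 * L + 1) ≤ K) ∧
      (x < 0 → S.eval x * (n * -x) ^ (2 * L + 1) ≤ K) := by
  refine ⟨2 ^ (2 * L + 2) * (4 * (L + 1)) ^ (2 * L + 1), by positivity, fun n hn => ?_⟩
  set m := n / (4 * (L + 1)) with hm
  have hmn : 4 * (L + 1) * m ≤ n := Nat.mul_div_le n _
  have hnm : n < 4 * (L + 1) * (m + 1) := Nat.lt_mul_div_succ n (by positivity)
  obtain ⟨Q, hQd, hQ1, hQ2⟩ := exists_polynomial_peaked_at_zero m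
  obtain ⟨A, hAd, hA⟩ := exists_polynomial_derivative_eq (Q ^ (2 * L + 2))
  set N : ℝ := 2 * m + 1 with hN
  have hm0 : (0 : ℝ) ≤ m := Nat.cast_nonneg m
  have hN1 : 1 ≤ N := by linarith
  have hnN : (n : ℝ) ≤ 4 * (L + 1) * N := by
    have h : (n : ℝ) ≤ 4 * (L + 1) * (m + 1) := by exact_mod_cast hnm.le
    refine h.trans ?_
    gcongr
    linarith
  have hAe : ∀ y, A.derivative.eval y = Q.eval y ^ (2 * L + 2) := by simp [hA]
  have heven : Even (2 * L + 2) := ⟨L + 1, by ring⟩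
  have hmono : Monotone fun y => A.eval y := by
    refine monotone_of_deriv_nonneg A.differentiable fun y => ?_
    rw [Polynomial.deriv, hAe]
    exact heven.pow_nonneg _
  have hbound : ∀ y ∈ Set.Icc (-1 : ℝ) 1, A.derivative.eval y * y ^ (2 * L + 2) ≤ 1 := by
    intro y hy
    rw [hAe, ← mul_pow, mul_comm, ← heven.pow_abs]
    exact pow_le_one₀ (abs_nonneg _) (hQ1 y hy)
  have hM : N ^ (2 * L + 1) / 2 ^ (2 * L + 2) ≤ A.eval 1 - A.eval (-1) := by
    have h := (convex_Icc (0 : ℝ) (1 / N)).mul_sub_le_image_sub_of_le_deriv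
      (f := fun y => A.eval y) (C := (N / 2) ^ (2 * L + 2))
      A.continuousOn A.differentiable.differentiableOn (fun y hy => by
        rw [interior_Icc] at hy
        rw [Polynomial.deriv, hAe]
        have h1 := hQ2 y hy.1 (by
          have := hy.2.le
          rwa [le_div_iff₀ (by linarith)] at this)
        gcongr)
      0 (Set.left_mem_Icc.2 (by positivity)) (1 / N) (Set.right_mem_Icc.2 (by positivity))
      (by positivity)
    have h1 : A.eval (1 / N) ≤ A.eval 1 := hmono (by rw [div_le_one (by linarith)]; exact hN1)
    have h0 : A.eval (-1) ≤ A.eval 0 := hmono (by norm_num)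
    have he : (N / 2) ^ (2 * L + 2) * (1 / N - 0) = N ^ (2 * L + 1) / 2 ^ (2 * L + 2) := by
      rw [div_pow, sub_zero]
      field_simp
      ring
    rw [he] at h
    linarith
  set M := A.eval 1 - A.eval (-1) with hMdef
  have hM0 : 0 < M := lt_of_lt_of_le (by positivity) hM
  have hnM : (n : ℝ) ^ (2 * L + 1) ≤
      2 ^ (2 * L + 2) * (4 * (L + 1)) ^ (2 * L + 1) * M := by
    calc (n : ℝ) ^ (2 * L + 1) ≤ (4 * (L + 1) * N) ^ (2 * L + 1) := by gcongr
      _ = 2 ^ (2 * L + 2) * (4 * (L + 1)) ^ (2 * L + 1) *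
          (N ^ (2 * L + 1) / 2 ^ (2 * L + 2)) := by
        rw [mul_pow _ N]
        field_simp
      _ ≤ _ := by gcongr
  have htail : ∀ a y : ℝ, a * y ^ (2 * L + 1) ≤ 1 →
      a / M * (n * y) ^ (2 * L + 1) ≤ 2 ^ (2 * L + 2) * (4 * (L + 1)) ^ (2 * L + 1) := by
    intro a y hay
    have h : a / M * (n * y) ^ (2 * L + 1) =
        (a * y ^ (2 * L + 1)) * (n : ℝ) ^ (2 * L + 1) / M := by
      rw [mul_pow]
      ring
    rw [h, div_le_iff₀ hM0]
    exact (mul_le_of_le_one_left (by positivity) hay).trans hnM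
  have hS : ∀ x, (Polynomial.C M⁻¹ * (A - Polynomial.C (A.eval (-1)))).eval x =
      (A.eval x - A.eval (-1)) / M := fun x => by
    simp [div_eq_inv_mul]
  refine ⟨Polynomial.C M⁻¹ * (A - Polynomial.C (A.eval (-1))), ?_, fun x hx => ?_⟩
  · refine (Polynomial.natDegree_C_mul_le _ _).trans ?_
    rw [Polynomial.natDegree_sub_C]
    have h := (Polynomial.natDegree_pow_le (p := Q) (n := 2 * L + 2)).trans
      (Nat.mul_le_mul_left _ hQd)
    have h2 : (2 * L + 2) * (2 * m) = 4 * (L + 1) * m := by ring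
    omega
  · have hlo : A.eval (-1) ≤ A.eval x := hmono hx.1
    have hhi : A.eval x ≤ A.eval 1 := hmono hx.2
    rw [hS]
    refine ⟨⟨div_nonneg (by linarith) hM0.le, ?_⟩, fun h0 => ?_, fun h0 => ?_⟩
    · rw [div_le_one hM0]
      linarith
    · have h1 : 1 - (A.eval x - A.eval (-1)) / M = (A.eval 1 - A.eval x) / M := by
        field_simp
        rw [hMdef]
        ring
      rw [h1]
      exact htail _ _ (eval_one_sub_eval_mul_pow_le_one
        (fun y hy hy1 => hbound y ⟨by linarith, hy1⟩) h0 hx.2)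
    · have h1 := eval_one_sub_eval_mul_pow_le_one (F := -A.comp (-Polynomial.X)) (L := L)
        (fun y hy hy1 => by
          have h := hbound (-y) ⟨by linarith, by linarith⟩
          rw [heven.neg_pow] at h
          simpa [Polynomial.derivative_comp] using h) (neg_pos.2 h0) (by linarith [hx.1])
      simp only [Polynomial.eval_neg, Polynomial.eval_comp, Polynomial.eval_X, neg_neg] at h1
      exact htail _ _ (by linarith)

theorem gridPt_zero (b : ℝ) (n : ℕ) : gridPt b n 0 = -b := by simp [gridPt]

theorem gridPt_self (b : ℝ) {n : ℕ} (hn : 0 < n) : gridPt b n n = b := by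
  have : (n : ℝ) ≠ 0 := by positivity
  rw [gridPt]
  field_simp
  ring

theorem gridPt_mono {b : ℝ} (hb : 0 < b) (n : ℕ) : Monotone (gridPt b n) := by
  intro i j hij
  unfold gridPt
  gcongr

theorem mul_gridPt_succ_sub (b : ℝ) {n : ℕ} (hn : 0 < n) (i : ℕ) :
    n * (gridPt b n (i + 1) - gridPt b n i) = 2 * b := by
  have : (n : ℝ) ≠ 0 := by positivity
  rw [gridPt, gridPt]
  push_cast
  field_simp
  ring

theorem exists_polynomial_approx_grid_steps {b : ℝ} (hb : 0 < b) (L : ℕ) :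
    ∃ K : ℝ, 0 < K ∧ ∀ n : ℕ, 0 < n → ∃ G : ℕ → Polynomial ℝ,
      G 0 = 1 ∧ G n = 0 ∧ (∀ i, (G i).natDegree ≤ 2 * n) ∧
      ∀ i ≤ n, ∀ t ∈ Set.Icc (-b) b, (G i).eval t ∈ Set.Icc (0 : ℝ) 1 ∧
        (gridPt b n i < t →
          (1 - (G i).eval t) * (n * (t - gridPt b n i) / (2 * b)) ^ (2 * L + 1) ≤ K) ∧
        (t < gridPt b n i →
          (G i).eval t * (n * (gridPt b n i - t) / (2 * b)) ^ (2 * L + 1) ≤ K) := by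
  obtain ⟨K, hK, hstep⟩ := exists_polynomial_approx_step L
  refine ⟨K, hK, fun n hn => ?_⟩
  obtain ⟨S, hSd, hS⟩ := hstep n hn
  refine ⟨fun i => if i = 0 then 1 else if i = n then 0 else
    S.comp (Polynomial.C (2 * b)⁻¹ * (Polynomial.X - Polynomial.C (gridPt b n i))),
    by simp, by simp [hn.ne'], fun i => ?_, fun i hi t ht => ?_⟩
  · dsimp only
    split_ifs
    · simp
    · simp
    · refine Polynomial.natDegree_comp_le.trans ?_
      have h : (Polynomial.C (2 * b)⁻¹ *
          (Polynomial.X - Polynomial.C (gridPt b n i))).natDegree ≤ 1 :=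
        (Polynomial.natDegree_C_mul_le _ _).trans (Polynomial.natDegree_X_sub_C_le _)
      exact (Nat.mul_le_mul hSd h).trans (by omega)
  · dsimp only
    split_ifs with h0 h1
    · subst h0
      simp only [gridPt_zero, Polynomial.eval_one]
      exact ⟨by simp, fun _ => by simpa using hK.le, fun h => absurd ht.1 (not_le.2 h)⟩
    · subst h1
      simp only [gridPt_self b hn, Polynomial.eval_zero]
      exact ⟨by simp, fun h => absurd ht.2 (not_le.2 h), fun _ => by simpa using hK.le⟩
    · have hlo := gridPt_mono hb n (Nat.zero_le i)
      have hhi := gridPt_mono hb n hi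
      rw [gridPt_zero] at hlo
      rw [gridPt_self b hn] at hhi
      have he : ∀ P : Polynomial ℝ, (P.comp (Polynomial.C (2 * b)⁻¹ *
          (Polynomial.X - Polynomial.C (gridPt b n i)))).eval t =
          P.eval ((t - gridPt b n i) / (2 * b)) := fun P => by
        simp [Polynomial.eval_comp, div_eq_inv_mul]
      rw [he]
      have hb2 : 0 < 2 * b := by positivity
      obtain ⟨h2, h3, h4⟩ := hS ((t - gridPt b n i) / (2 * b)) ⟨by
        rw [le_div_iff₀ hb2]; linarith [ht.1], by
        rw [div_le_iff₀ hb2]; linarith [ht.2]⟩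
      refine ⟨h2, fun h => ?_, fun h => ?_⟩
      · have := h3 (div_pos (by linarith) hb2)
        rwa [mul_div_assoc]
      · have := h4 (div_neg_of_neg_of_pos (by linarith) hb2)
        rwa [← neg_div, neg_sub, ← mul_div_assoc] at this

theorem mul_pow_le_of_le_one_add {a w r c K : ℝ} {p : ℕ} (ha0 : 0 ≤ a) (ha1 : a ≤ 1)
    (hw : 0 ≤ w) (hc : 0 ≤ c) (hK : a * w ^ p ≤ K) (hr0 : 0 ≤ r) (hr : r ≤ c * (1 + w)) :
    a * r ^ p ≤ (c * 2) ^ p * (1 + K) := by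
  have h1 : (1 + w) ^ p ≤ 2 ^ p * (1 + w ^ p) := by
    rcases le_total w 1 with h | h
    · calc (1 + w) ^ p ≤ 2 ^ p := by gcongr; linarith
        _ ≤ _ := le_mul_of_one_le_right (by positivity) (by linarith [pow_nonneg hw p])
    · calc (1 + w) ^ p ≤ (2 * w) ^ p := by gcongr; linarith
        _ = 2 ^ p * w ^ p := mul_pow _ _ _
        _ ≤ _ := by gcongr; linarith
  calc a * r ^ p ≤ a * (c * (1 + w)) ^ p := by gcongr
    _ = a * (c ^ p * (1 + w) ^ p) := by rw [mul_pow]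
    _ ≤ a * (c ^ p * (2 ^ p * (1 + w ^ p))) := by gcongr
    _ = (c * 2) ^ p * (a + a * w ^ p) := by rw [mul_pow]; ring
    _ ≤ _ := by gcongr

theorem exists_univariate_partition {b : ℝ} (hb : 0 < b) (L : ℕ) :
    ∃ K : ℝ, 0 < K ∧ ∀ n : ℕ, 0 < n → ∃ u : Fin n → Polynomial ℝ,
      (∀ i, (u i).natDegree ≤ 2 * n) ∧ ∑ i, u i = 1 ∧
      ∀ i : Fin n, ∀ t ∈ Set.Icc (-b) b, ∀ y ∈ Set.Icc (gridPt b n i) (gridPt b n (i + 1)),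
        |(u i).eval t| * (1 + n * |t - y|) ^ (2 * L + 1) ≤ K := by
  obtain ⟨K, hK, hgrid⟩ := exists_polynomial_approx_grid_steps hb L
  refine ⟨((1 + 2 * b) * 2) ^ (2 * L + 1) * (1 + K), by positivity, fun n hn => ?_⟩
  obtain ⟨G, hG0, hGn, hGd, hG⟩ := hgrid n hn
  refine ⟨fun i => G i - G (i + 1), fun i => ?_, ?_, fun i t ht y hy => ?_⟩
  · exact (Polynomial.natDegree_sub_le _ _).trans (max_le (hGd _) (hGd _))
  · rw [Fin.sum_univ_eq_sum_range (fun i => G i - G (i + 1)) n, Finset.sum_range_sub', hG0, hGn,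
      sub_zero]
  · obtain ⟨⟨h1, h2⟩, h3, h4⟩ := hG i i.2.le t ht
    obtain ⟨⟨h5, h6⟩, h7, h8⟩ := hG (i + 1) i.2 t ht
    have hlen := mul_gridPt_succ_sub b hn i
    have hn0 : (0 : ℝ) < n := by positivity
    have hb2 : 0 < 2 * b := by positivity
    have hmono := gridPt_mono hb n (Nat.le_succ i)
    rw [Polynomial.eval_sub]
    set g := (G i).eval t
    set g' := (G (i + 1)).eval t
    set s := gridPt b n i
    set s' := gridPt b n (i + 1)
    have hodd : 2 * L + 1 ≠ 0 := by omega
    have hone : |g - g'| ≤ 1 := by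
      rw [abs_le]
      constructor <;> linarith
    suffices h : ∃ w : ℝ, 0 ≤ w ∧ |g - g'| * w ^ (2 * L + 1) ≤ K ∧
        n * |t - y| ≤ 2 * b + 2 * b * w by
      obtain ⟨w, hw, hwK, hle⟩ := h
      exact mul_pow_le_of_le_one_add (abs_nonneg _) hone hw (by positivity) hwK
        (by positivity) (by nlinarith)
    rcases lt_or_ge s' t with ht1 | ht1
    · have hst : s < t := hmono.trans_lt ht1
      have hw : 0 ≤ n * (t - s') / (2 * b) := by
        have := sub_pos.2 ht1
        positivity
      refine ⟨n * (t - s') / (2 * b), hw, ?_, ?_⟩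
      · have ha : (1 - g) * (n * (t - s') / (2 * b)) ^ (2 * L + 1) ≤ K := by
          refine le_trans ?_ (h3 hst)
          have : 0 ≤ 1 - g := by linarith
          gcongr
        have hp := pow_nonneg hw (2 * L + 1)
        rcases abs_cases (g - g') with ⟨he, _⟩ | ⟨he, _⟩
        · rw [he]
          exact le_trans (by gcongr) (h7 ht1)
        · rw [he]
          exact le_trans (by gcongr; linarith) ha
      · rw [mul_div_cancel₀ _ hb2.ne', abs_of_nonneg (by linarith [hy.2]), ← hlen, ← mul_add]
        exact mul_le_mul_of_nonneg_left (by linarith [hy.1]) hn0.le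
    · rcases lt_or_ge t s with ht2 | ht2
      · have hst : t < s' := ht2.trans_le hmono
        have hw : 0 ≤ n * (s - t) / (2 * b) := by
          have := sub_pos.2 ht2
          positivity
        refine ⟨n * (s - t) / (2 * b), hw, ?_, ?_⟩
        · have ha : g' * (n * (s - t) / (2 * b)) ^ (2 * L + 1) ≤ K := by
            refine le_trans ?_ (h8 hst)
            gcongr
          have hp := pow_nonneg hw (2 * L + 1)
          rcases abs_cases (g - g') with ⟨he, _⟩ | ⟨he, _⟩
          · rw [he]
            exact le_trans (by gcongr; linarith) (h4 ht2)
          · rw [he]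
            exact le_trans (by gcongr; linarith) ha
        · rw [mul_div_cancel₀ _ hb2.ne', abs_of_nonpos (by linarith [hy.1]), ← hlen, ← mul_add]
          exact mul_le_mul_of_nonneg_left (by linarith [hy.2]) hn0.le
      · refine ⟨0, le_rfl, by simpa [hodd] using hK.le, ?_⟩
        rw [← hlen, mul_zero, add_zero]
        refine mul_le_mul_of_nonneg_left ?_ hn0.le
        rw [abs_le]
        constructor <;> linarith [hy.1, hy.2]

theorem totalDegree_aeval_X_le {σ : Type*} (p : Polynomial ℝ) (i : σ) :
    (Polynomial.aeval (MvPolynomial.X i : MvPolynomial σ ℝ) p).totalDegree ≤ p.natDegree := by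
  rw [Polynomial.aeval_eq_sum_range]
  refine MvPolynomial.totalDegree_finsetSum_le fun k hk => ?_
  refine (MvPolynomial.totalDegree_smul_le _ _).trans ?_
  rw [MvPolynomial.totalDegree_X_pow]
  exact Nat.lt_succ_iff.1 (Finset.mem_range.1 hk)

theorem EuclideanSpace.norm_le_sum_abs {ι : Type*} [Fintype ι] (z : EuclideanSpace ℝ ι) :
    ‖z‖ ≤ ∑ i, |z i| := by
  rw [EuclideanSpace.norm_eq, Real.sqrt_le_left (Finset.sum_nonneg fun i _ => abs_nonneg _)]
  exact Finset.sum_sq_le_sq_sum_of_nonneg fun i _ => abs_nonneg _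

theorem one_add_sum_le_prod_one_add {ι : Type*} (s : Finset ι) {a : ι → ℝ}
    (ha : ∀ i, 0 ≤ a i) : 1 + ∑ i ∈ s, a i ≤ ∏ i ∈ s, (1 + a i) := by
  classical
  induction s using Finset.induction_on with
  | empty => simp
  | insert i s hi ih =>
    rw [Finset.sum_insert hi, Finset.prod_insert hi]
    have h := Finset.sum_nonneg fun j (_ : j ∈ s) => ha j
    nlinarith [ha i]

/-- Lemma `uniform`, Dai–Prymak.
A polynomial partition of unity on `[-b,b]^d` subordinate to the partition into `n^d` congruent
subcubes, with polynomials of degree `≤ 2dn` decaying like `(1 + n‖x - x_j‖)^{-ℓ}`. -/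
theorem statement8 (d : ℕ) (b : ℝ) (hb : 0 < b) (ℓ : ℝ) (hℓ : 1 < ℓ) :
    ∃ C : ℝ≥0, 0 < C ∧
      ∀ n : ℕ, 0 < n →
      ∀ x : (Fin d → Fin n) → EuclideanSpace ℝ (Fin d),
        (∀ j m, x j m ∈ Set.Icc (gridPt b n (j m)) (gridPt b n (j m + 1))) →
      ∃ v : (Fin d → Fin n) → MvPolynomial (Fin d) ℝ,
        (∀ j, (v j).totalDegree ≤ 2 * d * n) ∧
        (∀ ξ : EuclideanSpace ℝ (Fin d), (∀ i, ξ i ∈ Set.Icc (-b) b) →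
          (∑ j : Fin d → Fin n, MvPolynomial.eval (fun i => ξ i) (v j)) = 1) ∧
        (∀ ξ : EuclideanSpace ℝ (Fin d), (∀ i, ξ i ∈ Set.Icc (-b) b) →
          ∀ j, |MvPolynomial.eval (fun i => ξ i) (v j)| ≤
            (C : ℝ) * (1 + n * ‖ξ - x j‖) ^ (-ℓ)) := by

  obtain ⟨L, hL⟩ := exists_nat_ge ℓ
  obtain ⟨K, hK, hpart⟩ := exists_univariate_partition hb L
  refine ⟨K.toNNReal ^ d, pow_pos (Real.toNNReal_pos.2 hK) d, fun n hn x hx => ?_⟩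
  rw [NNReal.coe_pow, Real.coe_toNNReal K hK.le]
  obtain ⟨u, hud, husum, hu⟩ := hpart n hn
  have heval : ∀ (ξ : EuclideanSpace ℝ (Fin d)) (j : Fin d → Fin n),
      MvPolynomial.eval (fun i => ξ i)
        (∏ m, Polynomial.aeval (MvPolynomial.X m : MvPolynomial (Fin d) ℝ) (u (j m))) =
      ∏ m, (u (j m)).eval (ξ m) := by
    intro ξ j
    rw [map_prod]
    refine Finset.prod_congr rfl fun m _ => ?_
    rw [Polynomial.aeval_def, Polynomial.hom_eval₂]
    simp only [MvPolynomial.eval_X]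
    rw [Polynomial.eval, Subsingleton.elim
      ((MvPolynomial.eval fun i => ξ i).comp (algebraMap ℝ (MvPolynomial (Fin d) ℝ)))
      (RingHom.id ℝ)]
  refine ⟨fun j => ∏ m, Polynomial.aeval (MvPolynomial.X m) (u (j m)),
    fun j => ?_, fun ξ _ => ?_, fun ξ hξ j => ?_⟩
  · refine (MvPolynomial.totalDegree_finsetProd _ _).trans ?_
    refine (Finset.sum_le_card_nsmul _ _ (2 * n) fun m _ =>
      (totalDegree_aeval_X_le _ _).trans (hud _)).trans_eq ?_
    simp
    ring
  · simp only [heval]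
    rw [← Fintype.prod_sum fun m i => (u i).eval (ξ m)]
    refine Finset.prod_eq_one fun m _ => ?_
    rw [← Polynomial.eval_finsetSum, husum, Polynomial.eval_one]
  · rw [heval, Finset.abs_prod]
    have hr : 0 < 1 + n * ‖ξ - x j‖ := by positivity
    have hle : 1 + n * ‖ξ - x j‖ ≤ ∏ m, (1 + n * |ξ m - x j m|) := by
      refine le_trans ?_ (one_add_sum_le_prod_one_add _ fun m => by positivity)
      rw [← Finset.mul_sum]
      gcongr
      exact EuclideanSpace.norm_le_sum_abs (ξ - x j)
    have hprod : (∏ m, |(u (j m)).eval (ξ m)|) * (1 + n * ‖ξ - x j‖) ^ (2 * L + 1) ≤ K ^ d := by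
      calc _ ≤ (∏ m, |(u (j m)).eval (ξ m)|) *
            (∏ m, (1 + n * |ξ m - x j m|)) ^ (2 * L + 1) := by
            gcongr
        _ = ∏ m, (|(u (j m)).eval (ξ m)| * (1 + n * |ξ m - x j m|) ^ (2 * L + 1)) := by
            rw [Finset.prod_mul_distrib, Finset.prod_pow]
        _ ≤ ∏ _m : Fin d, K := by
            gcongr with m
            exact hu (j m) (ξ m) (hξ m) (x j m) (hx j m)
        _ = K ^ d := by simp
    have hexp : ℓ ≤ ((2 * L + 1 : ℕ) : ℝ) := by
      push_cast
      linarith [(Nat.cast_nonneg L : (0 : ℝ) ≤ L)]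
    have hpow : (1 + n * ‖ξ - x j‖) ^ ℓ ≤ (1 + n * ‖ξ - x j‖) ^ (2 * L + 1) := by
      rw [← Real.rpow_natCast]
      exact Real.rpow_le_rpow_of_exponent_le (le_add_of_nonneg_right (by positivity)) hexp
    rw [Real.rpow_neg hr.le, ← div_eq_mul_inv, le_div_iff₀ (Real.rpow_pos_of_pos hr ℓ)]
    exact (mul_le_mul_of_nonneg_left hpow (Finset.prod_nonneg fun m _ => abs_nonneg _)).trans hprod
end
end

section
/- Let a ≥ 1 and let g ∈ C²([−2a, 2a]) satisfy g(x) ≥ 4a for all x ∈ [−2a, 2a]; let M > 10 satisfy ‖g''‖_{L^∞([−2a,2a])} ≤ M and |g'(0)| ≤ M. Let G := {(x,y) : x ∈ (−a,a), g(x) − a < y ≤ g(x)} and, for λ ∈ (1,2), G(λ) := {(x,y) : x ∈ (−λa, λa), g(x) − λa < y ≤ g(x)}. Set φ_n(x,y) := √(g(x) − y) + 1/n, and for an integer ℓ ≥ 0 define the tangential derivative D^ℓ f(x,y) := ((∂₁ + g'(x₀)∂₂)^ℓ f)(x,y) evaluated at x₀ = x (i.e., the operator (∂₁ + g'(x₀)∂₂)^ℓ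 with x₀ frozen, applied to f and then evaluated at (x, y) with x₀ = x). Then for every 0 < p ≤ ∞, every λ ∈ (1,2), all integers r, i, j ≥ 0, and every polynomial f ∈ Π_n² of two variables of total degree ≤ n: ‖φ_n^i · D^r ∂₂^{i+j} f‖_{L^p(G)} ≤ c · n^{r+i+2j} · ‖f‖_{L^p(G(λ))}, where c depends only on M, λ, r, i, j and p. -/
open MeasureTheory ENNReal NNReal

noncomputable section

/-- the operator `(∂₁ + c ∂₂)^r` on polynomials in two variables (slope `c` frozen) -/
def tanOp2 (c : ℝ) (r : ℕ) (P : MvPolynomial (Fin 2) ℝ) : MvPolynomial (Fin 2) ℝ :=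
  (fun Q => MvPolynomial.pderiv (0 : Fin 2) Q + c • MvPolynomial.pderiv (1 : Fin 2) Q)^[r] P

namespace TangentialBernstein

/-- Half of the angle of the `k`-th zero of the Chebyshev polynomial `T_L`. -/
def halfAngle (L k : ℕ) : ℝ := (2 * k + 1) * Real.pi / (4 * L)

lemma halfAngle_pos {L k : ℕ} (hk : k < L) : 0 < halfAngle L k := by
  have : (0 : ℝ) < L := by exact_mod_cast (by omega : 0 < L)
  unfold halfAngle
  positivity

lemma halfAngle_lt {L k : ℕ} (hk : k < L) : halfAngle L k < Real.pi / 2 := by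
  have h0 : (0 : ℝ) < L := by exact_mod_cast (by omega : 0 < L)
  have h1 : (k : ℝ) + 1 ≤ L := by exact_mod_cast hk
  unfold halfAngle
  rw [div_lt_div_iff₀ (by positivity) (by norm_num)]
  nlinarith [Real.pi_pos]

lemma le_sin_halfAngle {L k : ℕ} (hk : k < L) :
    (2 * k + 1) / (2 * L) ≤ Real.sin (halfAngle L k) := by
  have h0 : (0 : ℝ) < L := by exact_mod_cast (by omega : 0 < L)
  have h := Real.mul_le_sin (halfAngle_pos hk).le (halfAngle_lt hk).le
  refine le_trans (le_of_eq ?_) h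
  unfold halfAngle
  have := Real.pi_pos.ne'
  field_simp
  norm_num

lemma sin_halfAngle_pos {L k : ℕ} (hk : k < L) : 0 < Real.sin (halfAngle L k) :=
  Real.sin_pos_of_pos_of_lt_pi (halfAngle_pos hk)
    (by linarith [halfAngle_lt hk, Real.pi_pos])

open Polynomial in
/-- Lagrange interpolation at the Chebyshev nodes, evaluated at the end point `1`. -/
lemma exists_eval_one_formula (L : ℕ) (hL : 0 < L) :
    ∃ A : ℕ → ℝ, (∀ k < L, |A k| ≤ 1 / (L * Real.sin (halfAngle L k))) ∧
      ∀ P : ℝ[X], P.degree < L →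
        P.eval 1 = ∑ k ∈ Finset.range L, A k * P.eval (Real.cos (2 * halfAngle L k)) := by
  have hL0 : (0 : ℝ) < L := by exact_mod_cast hL
  set x : ℕ → ℝ := fun k => Real.cos (2 * halfAngle L k) with hx
  have hinj : Set.InjOn x (Finset.range L : Finset ℕ) := by
    intro k hk l hl h
    simp only [Finset.coe_range, Set.mem_Iio] at hk hl
    have := Real.injOn_cos ⟨by linarith [halfAngle_pos hk], by linarith [halfAngle_lt hk]⟩
      ⟨by linarith [halfAngle_pos hl], by linarith [halfAngle_lt hl]⟩ h
    have h2 : halfAngle L k = halfAngle L l := by linarith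
    unfold halfAngle at h2
    have hp := Real.pi_pos.ne'
    field_simp at h2
    have : (k : ℝ) = l := by linarith
    exact_mod_cast this
  have hangle : ∀ k, (L : ℝ) * (2 * halfAngle L k) = k * Real.pi + Real.pi / 2 := by
    intro k
    unfold halfAngle
    field_simp
    ring
  have hroot : ∀ k, (Chebyshev.T ℝ L).IsRoot (x k) := by
    intro k
    rw [IsRoot.def, hx, Chebyshev.T_real_cos]
    push_cast
    rw [hangle, Real.cos_add_pi_div_two, Real.sin_nat_mul_pi, neg_zero]
  choose Q hQ using fun k => dvd_iff_isRoot.2 (hroot k)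
  have hQx : ∀ k, (Q k).eval (x k) = L * (Chebyshev.U ℝ (L - 1)).eval (x k) := by
    intro k
    have h := congrArg (fun p => (derivative p).eval (x k)) (hQ k)
    simp only [Chebyshev.T_derivative_eq_U] at h
    simp at h
    exact h.symm
  have hU : ∀ k, |(Chebyshev.U ℝ (L - 1)).eval (x k)| * |Real.sin (2 * halfAngle L k)| = 1 := by
    intro k
    rw [← abs_mul, hx, Chebyshev.U_real_cos]
    push_cast
    rw [sub_add_cancel, hangle, Real.sin_add_pi_div_two, show (k : ℝ) = ((k : ℤ) : ℝ) by simp,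
      Real.abs_cos_int_mul_pi]
  have hQne : ∀ k, (Q k).eval (x k) ≠ 0 := by
    intro k h
    rw [hQx] at h
    have h1 := hU k
    rcases mul_eq_zero.1 h with h | h
    · exact hL0.ne' h
    · rw [h] at h1; simp at h1
  have hx1 : ∀ k < L, 1 - x k = 2 * Real.sin (halfAngle L k) ^ 2 := by
    intro k _
    simp only [hx]
    rw [Real.cos_two_mul, ← Real.sin_sq_add_cos_sq (halfAngle L k)]
    nlinarith [Real.sin_sq_add_cos_sq (halfAngle L k)]
  have hQ1 : ∀ k < L, (Q k).eval 1 * (1 - x k) = 1 := by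
    intro k _
    have h := congrArg (fun p => p.eval 1) (hQ k)
    simp only [Chebyshev.T_eval_one] at h
    simp at h
    linarith
  refine ⟨fun k => (Q k).eval 1 / (Q k).eval (x k), ?_, ?_⟩
  · intro k hk
    have hs := sin_halfAngle_pos hk
    have hc : 0 < Real.cos (halfAngle L k) := Real.cos_pos_of_mem_Ioo
      ⟨by linarith [halfAngle_pos hk, Real.pi_pos], halfAngle_lt hk⟩
    have h1 := hQ1 k hk
    rw [hx1 k hk] at h1
    have h2 := hU k
    rw [Real.sin_two_mul, abs_of_pos (a := 2 * _ * _) (by positivity)] at h2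
    have e1 : (Q k).eval 1 = 1 / (2 * Real.sin (halfAngle L k) ^ 2) := by
      field_simp
      linarith
    have e2 : |(Q k).eval (x k)| = L / (2 * Real.sin (halfAngle L k) * Real.cos (halfAngle L k)) := by
      rw [hQx, abs_mul, abs_of_pos hL0]
      field_simp
      linarith
    dsimp only
    rw [abs_div, e2, e1, abs_of_pos (by positivity), div_div,
      div_le_div_iff₀ (by positivity) (by positivity)]
    have : Real.cos (halfAngle L k) ≤ 1 := Real.cos_le_one _
    have e3 : 2 * Real.sin (halfAngle L k) ^ 2 * (↑L / (2 * Real.sin (halfAngle L k) * Real.cos (halfAngle L k))) = L * Real.sin (halfAngle L k) / Real.cos (halfAngle L k) := by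
      field_simp
    rw [e3, one_mul, one_mul, le_div_iff₀ hc]
    nlinarith [mul_pos hL0 hs]
  · intro P hP
    have hdegQ : ∀ k, (Q k).degree < L := by
      intro k
      have h := congrArg degree (hQ k)
      rw [degree_mul, degree_X_sub_C, Chebyshev.degree_T] at h
      simp only [Int.natAbs_natCast] at h
      have hne : Q k ≠ 0 := by
        intro h0; exact hQne k (by rw [h0]; simp)
      rw [degree_eq_natDegree hne] at h ⊢
      norm_cast at h ⊢
      omega
    have key : P = ∑ k ∈ Finset.range L, C (P.eval (x k) / (Q k).eval (x k)) * Q k := by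
      refine eq_of_degrees_lt_of_eval_index_eq (Finset.range L) hinj (by simpa using hP) ?_ ?_
      · rw [Finset.card_range]
        refine (degree_sum_le _ _).trans_lt ?_
        rw [Finset.sup_lt_iff (by exact_mod_cast WithBot.bot_lt_coe L)]
        intro k _
        rw [← smul_eq_C_mul]
        exact (degree_smul_le _ _).trans_lt (hdegQ k)
      · intro l hl
        rw [eval_finsetSum, Finset.sum_eq_single l]
        · simp [hQne l]
        · intro k hk hkl
          have h := hroot l
          rw [hQ k, IsRoot.def, eval_mul] at h
          rcases mul_eq_zero.1 h with h | h
          · exfalso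
            simp only [eval_sub, eval_X, eval_C] at h
            exact hkl (hinj hk hl (by linarith))
          · simp [h]
        · intro h; exact absurd hl h
    conv_lhs => rw [key]
    rw [eval_finsetSum]
    refine Finset.sum_congr rfl fun k _ => ?_
    rw [eval_mul, eval_C]
    ring

open Polynomial in
/-- The normalised Dirichlet kernel, as a polynomial in the cosine. -/
def dirichletPoly (N : ℕ) : ℝ[X] :=
  C (1 / (2 * N + 1) : ℝ) * (1 + (2 : ℝ[X]) * ∑ j ∈ Finset.range N, Chebyshev.T ℝ ((j : ℤ) + 1))

open Polynomial in
lemma natDegree_dirichletPoly_le (N : ℕ) : (dirichletPoly N).natDegree ≤ N := by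
  unfold dirichletPoly
  refine (natDegree_C_mul_le _ _).trans ?_
  refine (natDegree_add_le _ _).trans (max_le (by simp) ?_)
  refine natDegree_mul_le.trans ?_
  rw [show (2 : ℝ[X]).natDegree = 0 from natDegree_ofNat 2, zero_add]
  refine natDegree_sum_le_of_forall_le _ _ fun j hj => ?_
  rw [Chebyshev.natDegree_T]
  have := Finset.mem_range.1 hj
  omega

open Polynomial in
lemma eval_one_dirichletPoly (N : ℕ) : (dirichletPoly N).eval 1 = 1 := by
  unfold dirichletPoly
  simp only [eval_mul, eval_C, eval_add, eval_one, eval_ofNat, eval_finsetSum,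
    Chebyshev.T_eval_one, Finset.sum_const, Finset.card_range, nsmul_eq_mul, mul_one]
  have : (2 * N + 1 : ℝ) ≠ 0 := by positivity
  field_simp
  ring

lemma sin_mul_dirichlet (N : ℕ) (h : ℝ) :
    Real.sin h * (1 + 2 * ∑ j ∈ Finset.range N, Real.cos (((j : ℝ) + 1) * (2 * h))) =
      Real.sin ((2 * N + 1) * h) := by
  induction N with
  | zero => simp
  | succ N ih =>
    rw [Finset.sum_range_succ]
    have e1 : (2 * ((N + 1 : ℕ) : ℝ) + 1) * h = ((N : ℝ) + 1) * (2 * h) + h := by push_cast; ring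
    have e2 : (2 * (N : ℝ) + 1) * h = ((N : ℝ) + 1) * (2 * h) - h := by ring
    rw [e1, Real.sin_add]
    rw [e2, Real.sin_sub] at ih
    linarith

open Polynomial in
lemma abs_eval_dirichletPoly_le (N : ℕ) {h : ℝ} (hs : 0 < Real.sin h) :
    |(dirichletPoly N).eval (Real.cos (2 * h))| ≤ 1 / ((2 * N + 1) * Real.sin h) := by
  have e : (dirichletPoly N).eval (Real.cos (2 * h)) * ((2 * N + 1) * Real.sin h) =
      Real.sin ((2 * N + 1) * h) := by
    rw [← sin_mul_dirichlet]
    unfold dirichletPoly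
    simp only [eval_mul, eval_C, eval_add, eval_one, eval_ofNat, eval_finsetSum,
      Chebyshev.T_real_cos]
    push_cast
    generalize ∑ j ∈ Finset.range N, Real.cos (((j : ℝ) + 1) * (2 * h)) = S
    have : (2 * N + 1 : ℝ) ≠ 0 := by positivity
    field_simp
  have hpos : 0 < (2 * N + 1 : ℝ) * Real.sin h := by positivity
  rw [le_div_iff₀ hpos]
  nth_rewrite 1 [← abs_of_pos hpos]
  rw [← abs_mul, e]
  exact Real.abs_sin_le_one _

open Polynomial in
/-- A finite formula `F ↦ ∑ c k * F (s k)` that reproduces the `r`-th coefficient of every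
polynomial of degree at most `m`, with nodes in `[-δ, δ]` and weights of `ℓ^p` mass at most `B`. -/
def HasCoeffFormula (p δ B : ℝ) (m r : ℕ) : Prop :=
  ∃ (ι : Type) (_ : Fintype ι) (c s : ι → ℝ), (∀ k, |s k| ≤ δ) ∧ ∑ k, |c k| ^ p ≤ B ∧
    ∀ F : ℝ[X], F.natDegree ≤ m → F.coeff r = ∑ k, c k * F.eval (s k)

open Polynomial in
lemma exists_hasCoeffFormula_one_unit {p : ℝ} (hp : 0 < p) :
    ∃ K : ℝ, 0 ≤ K ∧ ∀ m : ℕ, 0 < m → HasCoeffFormula p 1 (K * (m : ℝ) ^ p) m 1 := by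
  obtain ⟨b, hb⟩ := exists_nat_ge (2 / p)
  have hb2 : 2 ≤ ((b + 2 : ℕ) : ℝ) * p := by
    rw [div_le_iff₀ hp] at hb
    push_cast
    nlinarith
  have hsum : Summable fun k : ℕ => 1 / ((k : ℝ) + 1) ^ 2 := by
    have := (_root_.summable_nat_add_iff 1).2 (Real.summable_one_div_nat_pow.2 (one_lt_two : 1 < 2))
    simpa using this
  set W : ℝ := 2 * ((b : ℝ) + 1) ^ (b + 1) with hW
  have hW0 : 0 ≤ W := by positivity
  refine ⟨2 * (W ^ p * ∑' k : ℕ, 1 / ((k : ℝ) + 1) ^ 2), by positivity, fun m hm => ?_⟩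
  set L : ℕ := m * (b + 1) with hLdef
  have hL : 0 < L := by positivity
  obtain ⟨A, hA, hform⟩ := exists_eval_one_formula L hL
  set D := dirichletPoly m with hD
  set x : ℕ → ℝ := fun k => Real.cos (2 * halfAngle L k) with hx
  set σ : ℕ → ℝ := fun k => Real.sin (halfAngle L k) with hσ
  set d : ℕ → ℝ := fun k => A k * (D.eval (x k)) ^ b / (2 * σ k) with hd
  have hσ0 : ∀ k < L, 0 < σ k := fun k hk => sin_halfAngle_pos hk
  have hdbound : ∀ k < L, |d k| ≤ W * m / ((k : ℝ) + 1) ^ (b + 2) := by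
    intro k hk
    have hs := hσ0 k hk
    have hm0 : (0 : ℝ) < m := by exact_mod_cast hm
    have hL0 : (0 : ℝ) < L := by exact_mod_cast hL
    have hinv : 1 / σ k ≤ 2 * L / (k + 1) := by
      have h1 := le_sin_halfAngle hk
      rw [div_le_iff₀ (by positivity)] at h1
      rw [div_le_div_iff₀ hs (by positivity)]
      have : (0 : ℝ) ≤ k := by positivity
      change _ ≤ σ k * _ at h1
      linarith
    have hDk : |D.eval (x k)| ≤ (b + 1) / (k + 1) := by
      refine (abs_eval_dirichletPoly_le m hs).trans ?_
      have : 1 / ((2 * m + 1) * σ k) = 1 / (2 * m + 1) * (1 / σ k) := by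
        field_simp
      change 1 / ((2 * m + 1) * σ k) ≤ _
      rw [this]
      refine (mul_le_mul_of_nonneg_left hinv (by positivity)).trans ?_
      rw [div_mul_div_comm, div_le_div_iff₀ (by positivity) (by positivity), hLdef]
      push_cast
      have : (0 : ℝ) ≤ (b + 1) * ((k : ℝ) + 1) := by positivity
      nlinarith
    have hAk : |A k| ≤ 1 / L * (1 / σ k) := by
      refine (hA k hk).trans (le_of_eq ?_)
      change 1 / (L * σ k) = _
      field_simp
    have e : |d k| = |A k| * |D.eval (x k)| ^ b * (1 / 2 * (1 / σ k)) := by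
      simp only [hd]
      rw [abs_div, abs_mul, abs_pow, abs_of_pos (a := 2 * σ k) (by positivity)]
      field_simp
    rw [e]
    calc |A k| * |D.eval (x k)| ^ b * (1 / 2 * (1 / σ k))
        ≤ (1 / L * (2 * L / (k + 1))) * ((b + 1) / (k + 1)) ^ b
            * (1 / 2 * (2 * L / (k + 1))) := by
          have hA2 : |A k| ≤ 1 / L * (2 * L / (k + 1)) :=
            hAk.trans (mul_le_mul_of_nonneg_left hinv (by positivity))
          gcongr
      _ = W * m / ((k : ℝ) + 1) ^ (b + 2) := by
          rw [hW, hLdef]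
          push_cast
          rw [div_pow]
          have : ((k : ℝ) + 1) ≠ 0 := by positivity
          field_simp
          ring
  refine ⟨Fin L ⊕ Fin L, inferInstance, Sum.elim (fun k => d k) (fun k => - d k),
    Sum.elim (fun k => σ k) (fun k => - σ k), ?_, ?_, ?_⟩
  · rintro (k | k)
    · simpa using Real.abs_sin_le_one _
    · simpa using Real.abs_sin_le_one _
  · rw [Fintype.sum_sum_type]
    simp only [Sum.elim_inl, Sum.elim_inr, abs_neg]
    rw [← two_mul, mul_assoc]
    refine mul_le_mul_of_nonneg_left ?_ (by norm_num)
    rw [Fin.sum_univ_eq_sum_range (fun k => |d k| ^ p) L]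
    calc ∑ k ∈ Finset.range L, |d k| ^ p
        ≤ ∑ k ∈ Finset.range L, (W ^ p * (m : ℝ) ^ p) * (1 / ((k : ℝ) + 1) ^ 2) := by
          refine Finset.sum_le_sum fun k hk => ?_
          have hk := Finset.mem_range.1 hk
          refine (Real.rpow_le_rpow (abs_nonneg _) (hdbound k hk) hp.le).trans ?_
          rw [Real.div_rpow (by positivity) (by positivity), Real.mul_rpow hW0 (by positivity),
            div_eq_mul_one_div]
          refine mul_le_mul_of_nonneg_left ?_ (by positivity)
          refine one_div_le_one_div_of_le (by positivity) ?_
          rw [← Real.rpow_natCast, ← Real.rpow_natCast, ← Real.rpow_mul (by positivity)]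
          refine Real.rpow_le_rpow_of_exponent_le ?_ (by exact_mod_cast hb2)
          have : (0 : ℝ) ≤ k := by positivity
          linarith
      _ ≤ _ := by
          rw [← Finset.mul_sum]
          have := hsum.sum_le_tsum (Finset.range L) (fun _ _ => by positivity)
          calc _ ≤ W ^ p * (m : ℝ) ^ p * ∑' k : ℕ, 1 / ((k : ℝ) + 1) ^ 2 :=
                mul_le_mul_of_nonneg_left this (by positivity)
            _ = _ := by ring
  · intro F hF
    rw [Fintype.sum_sum_type]
    simp only [Sum.elim_inl, Sum.elim_inr]
    rw [← Finset.sum_add_distrib,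
      Fin.sum_univ_eq_sum_range (fun k => d k * F.eval (σ k) + -d k * F.eval (-σ k)) L]
    have hmono : ∀ e ≤ m, ∑ k ∈ Finset.range L, (d k * σ k ^ e + -d k * (-σ k) ^ e) =
        if e = 1 then 1 else 0 := by
      intro e he
      rcases Nat.even_or_odd' e with ⟨j, rfl | rfl⟩
      · rw [if_neg (by omega)]
        refine Finset.sum_eq_zero fun k _ => ?_
        rw [Even.neg_pow (by simp)]
        ring
      · have h := hform ((C (1 / 2) * (1 - X)) ^ j * D ^ b) (by
          refine degree_le_natDegree.trans_lt ?_
          have h1 : ((C (1 / 2 : ℝ) * (1 - X)) ^ j).natDegree ≤ j := by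
            refine natDegree_pow_le.trans ?_
            have : (C (1 / 2 : ℝ) * (1 - X)).natDegree ≤ 1 :=
              (natDegree_C_mul_le _ _).trans ((natDegree_sub_le _ _).trans (by simp))
            nlinarith
          have h2 : (D ^ b).natDegree ≤ b * m := by
            refine natDegree_pow_le.trans ?_
            exact Nat.mul_le_mul_left _ (natDegree_dirichletPoly_le m)
          have h3 := natDegree_mul_le (p := (C (1 / 2 : ℝ) * (1 - X)) ^ j) (q := D ^ b)
          have : ((C (1 / 2 : ℝ) * (1 - X)) ^ j * D ^ b).natDegree < L := by
            rw [hLdef]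
            nlinarith
          exact_mod_cast this)
        simp only [eval_mul, eval_pow, eval_C, eval_sub, eval_one, eval_X, sub_self, mul_zero,
          hD, eval_one_dirichletPoly, one_pow, mul_one] at h
        have hj : (if 2 * j + 1 = 1 then (1 : ℝ) else 0) = 0 ^ j := by
          rcases Nat.eq_zero_or_pos j with rfl | hj
          · simp
          · rw [if_neg (by omega), zero_pow hj.ne']
        rw [hj, h]
        refine Finset.sum_congr rfl fun k hk => ?_
        have hs := hσ0 k (Finset.mem_range.1 hk)
        have e1 : 1 / 2 * (1 - Real.cos (2 * halfAngle L k)) = σ k ^ 2 := by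
          rw [Real.cos_two_mul]
          simp only [hσ]
          nlinarith [Real.sin_sq_add_cos_sq (halfAngle L k)]
        rw [e1, Odd.neg_pow (by simp), ← pow_mul]
        simp only [hd, hD, hx]
        have := hs.ne'
        field_simp
        ring
    have hexp : ∀ y, F.eval y = ∑ e ∈ Finset.range (m + 1), F.coeff e * y ^ e := fun y =>
      eval_eq_sum_range' (by omega) y
    simp only [hexp, Finset.mul_sum, ← Finset.sum_add_distrib]
    rw [Finset.sum_comm]
    calc F.coeff 1 = ∑ e ∈ Finset.range (m + 1), F.coeff e * (if e = 1 then 1 else 0) := by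
          rw [Finset.sum_eq_single 1]
          · simp
          · intro e _ he; simp [he]
          · intro h; exact absurd (Finset.mem_range.2 (by omega)) h
      _ = _ := by
          refine Finset.sum_congr rfl fun e he => ?_
          rw [← hmono e (by have := Finset.mem_range.1 he; omega), Finset.mul_sum]
          refine Finset.sum_congr rfl fun k _ => by ring

open Polynomial in
lemma HasCoeffFormula.scale {p B : ℝ} {m r : ℕ} (h : HasCoeffFormula p 1 B m r)
    {δ : ℝ} (hδ : 0 < δ) : HasCoeffFormula p δ ((1 / δ ^ r) ^ p * B) m r := by
  obtain ⟨ι, _, c, s, hs, hc, hF⟩ := h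
  refine ⟨ι, inferInstance, fun k => 1 / δ ^ r * c k, fun k => δ * s k, fun k => ?_, ?_, ?_⟩
  · rw [abs_mul, abs_of_pos hδ]
    exact mul_le_of_le_one_right hδ.le (hs k)
  · have : ∀ k, |1 / δ ^ r * c k| ^ p = (1 / δ ^ r) ^ p * |c k| ^ p := fun k => by
      rw [abs_mul, abs_of_pos (by positivity), Real.mul_rpow (by positivity) (abs_nonneg _)]
    simp only [this, ← Finset.mul_sum]
    exact mul_le_mul_of_nonneg_left hc (by positivity)
  · intro F hdeg
    have h1 := hF (F.comp (C δ * X)) (by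
      rw [natDegree_comp, natDegree_C_mul_X _ hδ.ne', mul_one]
      exact hdeg)
    rw [comp_C_mul_X_coeff] at h1
    simp only [eval_comp, eval_mul, eval_C, eval_X] at h1
    have : F.coeff r = 1 / δ ^ r * (F.coeff r * δ ^ r) := by
      have := hδ.ne'
      field_simp
    rw [this, h1, Finset.mul_sum]
    exact Finset.sum_congr rfl fun k _ => by ring

open Polynomial in
lemma HasCoeffFormula.succ {p δ ε B B' : ℝ} {m r : ℕ} (hp : 0 < p)
    (h : HasCoeffFormula p δ B m r) (h' : HasCoeffFormula p ε B' m 1) :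
    HasCoeffFormula p (δ + ε) (B * B') m (r + 1) := by
  obtain ⟨ι, _, c, s, hs, hc, hF⟩ := h
  obtain ⟨ι', _, c', s', hs', hc', hF'⟩ := h'
  refine ⟨ι × ι', inferInstance, fun k => 1 / (r + 1) * (c k.1 * c' k.2),
    fun k => s k.1 + s' k.2, fun k => (abs_add_le _ _).trans (add_le_add (hs _) (hs' _)), ?_, ?_⟩
  · calc ∑ k : ι × ι', |1 / ((r : ℝ) + 1) * (c k.1 * c' k.2)| ^ p
        ≤ ∑ k : ι × ι', |c k.1| ^ p * |c' k.2| ^ p := by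
          refine Finset.sum_le_sum fun k _ => ?_
          rw [← Real.mul_rpow (abs_nonneg _) (abs_nonneg _), ← abs_mul]
          refine Real.rpow_le_rpow (abs_nonneg _) ?_ hp.le
          rw [abs_mul]
          refine mul_le_of_le_one_left (abs_nonneg _) ?_
          rw [abs_of_pos (by positivity), div_le_one (by positivity)]
          have : (0 : ℝ) ≤ r := by positivity
          linarith
      _ = (∑ k, |c k| ^ p) * ∑ k, |c' k| ^ p := by
          rw [Fintype.sum_prod_type, Finset.sum_mul_sum]
      _ ≤ B * B' := mul_le_mul hc hc' (Finset.sum_nonneg fun _ _ => by positivity)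
          ((Finset.sum_nonneg fun _ _ => by positivity).trans hc)
  · intro F hdeg
    have h1 := hF' (hasseDeriv r F) ((natDegree_hasseDeriv_le F r).trans (by omega))
    have h2 : ∀ y, (hasseDeriv r F).eval y = ∑ k, c k * F.eval (s k + y) := by
      intro y
      rw [← taylor_coeff, hF (taylor y F) (by rwa [natDegree_taylor])]
      simp only [taylor_eval]
    rw [hasseDeriv_coeff] at h1
    simp only [h2] at h1
    have h3 : ((1 + r).choose r : ℝ) = r + 1 := by
      rw [add_comm, Nat.choose_succ_self_right]
      push_cast; ring
    rw [h3] at h1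
    have h4 : F.coeff (r + 1) = 1 / ((r : ℝ) + 1) * ((r + 1) * F.coeff (1 + r)) := by
      rw [add_comm 1 r]
      field_simp
    rw [h4, h1, Fintype.sum_prod_type, Finset.sum_comm, Finset.mul_sum]
    refine Finset.sum_congr rfl fun k _ => ?_
    rw [Finset.mul_sum, Finset.mul_sum]
    exact Finset.sum_congr rfl fun l _ => by ring

open Polynomial in
/-- Bernstein's inequality at an interior point, in the form of a quadrature formula. -/
lemma exists_hasCoeffFormula {p : ℝ} (hp : 0 < p) (r : ℕ) {δ : ℝ} (hδ : 0 < δ) :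
    ∃ K : ℝ, 0 ≤ K ∧ ∀ m : ℕ, 0 < m → HasCoeffFormula p δ (K * ((m : ℝ) ^ r) ^ p) m r := by
  induction r generalizing δ with
  | zero =>
    refine ⟨1, zero_le_one, fun m _ => ⟨Unit, inferInstance, fun _ => 1, fun _ => 0, ?_, ?_, ?_⟩⟩
    · intro _; simpa using hδ.le
    · simp
    · intro F _; simp [coeff_zero_eq_eval_zero]
  | succ r ih =>
    obtain ⟨K, hK0, hK⟩ := ih (half_pos hδ)
    obtain ⟨K', hK0', hK'⟩ := exists_hasCoeffFormula_one_unit hp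
    refine ⟨K * ((1 / (δ / 2) ^ 1) ^ p * K'), by positivity, fun m hm => ?_⟩
    have h := (hK m hm).succ hp ((hK' m hm).scale (half_pos hδ))
    rw [add_halves] at h
    convert h using 1
    rw [pow_succ (m : ℝ), Real.mul_rpow (by positivity) (by positivity)]
    ring

/-- The exponent for which `f ↦ ‖f‖_p ^ q` is subadditive. -/
def subaddExponent (p : ℝ≥0∞) : ℝ := (min p 1).toReal

lemma subaddExponent_pos {p : ℝ≥0∞} (hp : 0 < p) : 0 < subaddExponent p :=
  ENNReal.toReal_pos (lt_min hp one_pos).ne' (ne_top_of_le_ne_top one_ne_top (min_le_right _ _))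

section Lp

variable {α : Type*} [MeasurableSpace α] {μ : Measure α} {p : ℝ≥0∞}

lemma eLpNorm_add_rpow_le {f g : α → ℝ} (hp : 0 < p)
    (hf : AEStronglyMeasurable f μ) (hg : AEStronglyMeasurable g μ) :
    eLpNorm (f + g) p μ ^ subaddExponent p ≤
      eLpNorm f p μ ^ subaddExponent p + eLpNorm g p μ ^ subaddExponent p := by
  rcases le_or_gt 1 p with h1 | h1
  · simp only [subaddExponent, min_eq_right h1, toReal_one, ENNReal.rpow_one]
    exact eLpNorm_add_le hf hg h1
  · have hpt : p ≠ ∞ := (h1.trans one_lt_top).ne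
    have hq : 0 < p.toReal := toReal_pos hp.ne' hpt
    have hq1 : p.toReal ≤ 1 := by
      simpa using toReal_mono one_ne_top h1.le
    have key : ∀ u : α → ℝ, eLpNorm u p μ ^ p.toReal = ∫⁻ x, ‖u x‖ₑ ^ p.toReal ∂μ := by
      intro u
      rw [eLpNorm_eq_lintegral_rpow_enorm_toReal hp.ne' hpt, ← ENNReal.rpow_mul,
        one_div, inv_mul_cancel₀ hq.ne', ENNReal.rpow_one]
    simp only [subaddExponent, min_eq_left h1.le]
    rw [key, key, key, ← lintegral_add_left' (hf.enorm.pow_const _)]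
    refine lintegral_mono fun x => ?_
    refine (ENNReal.rpow_le_rpow (enorm_add_le _ _) hq.le).trans ?_
    exact ENNReal.rpow_add_le_add_rpow _ _ hq.le hq1

lemma eLpNorm_sum_rpow_le {ι : Type*} {s : Finset ι} {f : ι → α → ℝ} (hp : 0 < p)
    (hf : ∀ i ∈ s, AEStronglyMeasurable (f i) μ) :
    eLpNorm (∑ i ∈ s, f i) p μ ^ subaddExponent p ≤
      ∑ i ∈ s, eLpNorm (f i) p μ ^ subaddExponent p :=
  Finset.le_sum_of_subadditive_on_pred (fun f : α → ℝ => eLpNorm f p μ ^ subaddExponent p)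
    (fun f => AEStronglyMeasurable f μ)
    (by simp [subaddExponent_pos hp]) (fun _f _g hf hg => eLpNorm_add_rpow_le hp hf hg)
    (fun _f _g hf hg => hf.add hg) _ hf

/-- The quasi-triangle inequality for a function dominated by a finite sum. -/
lemma eLpNorm_le_of_abs_le_sum {ι : Type*} {s : Finset ι} {f : ι → α → ℝ} {H : α → ℝ}
    (hp : 0 < p) (hf : ∀ i ∈ s, AEStronglyMeasurable (f i) μ) (c : ι → ℝ≥0) (E : ℝ≥0∞)
    (hE : ∀ i ∈ s, eLpNorm (f i) p μ ≤ c i * E)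
    (hH : ∀ᵐ x ∂μ, |H x| ≤ ∑ i ∈ s, |f i x|) :
    eLpNorm H p μ ≤
      ((∑ i ∈ s, c i ^ subaddExponent p) ^ (1 / subaddExponent p) : ℝ≥0) * E := by
  have hq := subaddExponent_pos hp
  set q := subaddExponent p
  have h1 : eLpNorm H p μ ≤ eLpNorm (∑ i ∈ s, fun x => |f i x|) p μ := by
    refine eLpNorm_mono_ae_real (hH.mono fun x hx => ?_)
    simpa [Finset.sum_apply] using hx
  have h2 : eLpNorm H p μ ^ q ≤ (∑ i ∈ s, (c i : ℝ≥0∞) ^ q) * E ^ q := by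
    refine (ENNReal.rpow_le_rpow h1 hq.le).trans ((eLpNorm_sum_rpow_le hp ?_).trans ?_)
    · intro i hi
      simpa [Real.norm_eq_abs] using (hf i hi).norm
    · rw [Finset.sum_mul]
      refine Finset.sum_le_sum fun i hi => ?_
      rw [← ENNReal.mul_rpow_of_nonneg _ _ hq.le]
      refine ENNReal.rpow_le_rpow ?_ hq.le
      refine le_trans (le_of_eq ?_) (hE i hi)
      simpa [Real.norm_eq_abs] using eLpNorm_norm (p := p) (μ := μ) (f i)
  have h3 := ENNReal.rpow_le_rpow h2 (one_div_pos.2 hq).le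
  rw [← ENNReal.rpow_mul, mul_one_div_cancel hq.ne', ENNReal.rpow_one,
    ENNReal.mul_rpow_of_nonneg _ _ (one_div_pos.2 hq).le, ← ENNReal.rpow_mul,
    mul_one_div_cancel hq.ne', ENNReal.rpow_one] at h3
  refine h3.trans (le_of_eq ?_)
  rw [ENNReal.coe_rpow_of_nonneg _ (one_div_pos.2 hq).le]
  push_cast
  congr 2
  exact Finset.sum_congr rfl fun i _ => (ENNReal.coe_rpow_of_nonneg _ hq.le).symm

open Polynomial in
/-- An `L^p` bound for the `r`-th Taylor coefficients of a family of polynomials whose values are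
controlled by a family of functions with uniformly bounded `L^p` norms. -/
lemma exists_eLpNorm_coeff_le (hp : 0 < p) (r : ℕ) {δ : ℝ} (hδ : 0 < δ) :
    ∃ C : ℝ≥0, ∀ m : ℕ, 0 < m → ∀ {α : Type} [MeasurableSpace α] (μ : Measure α) (H : α → ℝ)
      (h : ℝ → α → ℝ) (E : ℝ≥0∞),
      (∀ᵐ x ∂μ, ∃ F : ℝ[X], F.natDegree ≤ m ∧ |H x| ≤ |F.coeff r| ∧
        ∀ t, |t| ≤ δ → |F.eval t| ≤ |h t x|) →
      (∀ t, |t| ≤ δ → AEStronglyMeasurable (h t) μ) →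
      (∀ t, |t| ≤ δ → eLpNorm (h t) p μ ≤ E) →
      eLpNorm H p μ ≤ C * (m : ℝ≥0∞) ^ r * E := by
  have hq := subaddExponent_pos hp
  set q := subaddExponent p with hqdef
  obtain ⟨K, hK0, hK⟩ := exists_hasCoeffFormula hq r hδ
  refine ⟨K.toNNReal ^ (1 / q), fun m hm α _ μ H h E hH hmeas hE => ?_⟩
  obtain ⟨ι, _, c, s, hs, hc, hF⟩ := hK m hm
  refine (eLpNorm_le_of_abs_le_sum (s := Finset.univ) (f := fun k x => c k * h (s k) x) hp
    (fun k _ => (hmeas _ (hs k)).const_mul _) (fun k => ‖c k‖₊) E (fun k _ => ?_) ?_).trans ?_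
  · refine (eLpNorm_const_smul (c k) (h (s k)) p μ).le.trans ?_
    exact mul_le_mul_right (hE _ (hs k)) _
  · filter_upwards [hH] with x ⟨F, hdeg, hle, hval⟩
    rw [hF F hdeg] at hle
    refine hle.trans ((Finset.abs_sum_le_sum_abs _ _).trans (Finset.sum_le_sum fun k _ => ?_))
    rw [abs_mul, abs_mul]
    exact mul_le_mul_of_nonneg_left (hval _ (hs k)) (abs_nonneg _)
  · refine mul_le_mul_left ?_ E
    rw [← ENNReal.coe_natCast, ← ENNReal.coe_pow, ← ENNReal.coe_mul, ENNReal.coe_le_coe]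
    have h1 : ∑ k, ‖c k‖₊ ^ q ≤ K.toNNReal * ((m : ℝ≥0) ^ r) ^ q := by
      rw [← NNReal.coe_le_coe]
      push_cast
      rw [Real.coe_toNNReal _ hK0]
      simpa [Real.norm_eq_abs] using hc
    refine (NNReal.rpow_le_rpow h1 (one_div_pos.2 hq).le).trans (le_of_eq ?_)
    rw [NNReal.mul_rpow, ← NNReal.rpow_mul, mul_one_div_cancel hq.ne', NNReal.rpow_one]

end Lp

section Curve

open Polynomial

/-- The derivative in the direction `(u, v)`. -/
def dirDeriv (u v : ℝ) :
    Derivation ℝ (MvPolynomial (Fin 2) ℝ) (MvPolynomial (Fin 2) ℝ) :=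
  u • MvPolynomial.pderiv 0 + v • MvPolynomial.pderiv 1

/-- The restriction of a bivariate polynomial to the parabola
`t ↦ (x + u t, y + v t - κ t ^ 2)`. -/
def curve (κ x y u v : ℝ) : MvPolynomial (Fin 2) ℝ →ₐ[ℝ] ℝ[X] :=
  MvPolynomial.aeval ![C x + C u * X, C y + C v * X - C κ * X ^ 2]

lemma dirDeriv_apply (u v : ℝ) (f : MvPolynomial (Fin 2) ℝ) :
    dirDeriv u v f = u • MvPolynomial.pderiv 0 f + v • MvPolynomial.pderiv 1 f := rfl

lemma eval_curve (κ x y u v t : ℝ) (f : MvPolynomial (Fin 2) ℝ) :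
    (curve κ x y u v f).eval t =
      MvPolynomial.eval ![x + u * t, y + v * t - κ * t ^ 2] f := by
  have h : (Polynomial.evalRingHom t).comp (curve κ x y u v).toRingHom =
      MvPolynomial.eval ![x + u * t, y + v * t - κ * t ^ 2] := by
    refine MvPolynomial.ringHom_ext (fun r => by simp) fun i => ?_
    fin_cases i <;> simp [curve]
  exact congrArg (fun φ : MvPolynomial (Fin 2) ℝ →+* ℝ => φ f) h

lemma coeff_zero_curve (κ x y u v : ℝ) (f : MvPolynomial (Fin 2) ℝ) :
    (curve κ x y u v f).coeff 0 = MvPolynomial.eval ![x, y] f := by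
  rw [coeff_zero_eq_eval_zero, eval_curve]
  simp

lemma natDegree_curve_le (κ x y u v : ℝ) (f : MvPolynomial (Fin 2) ℝ) :
    (curve κ x y u v f).natDegree ≤ 2 * f.totalDegree := by
  rw [curve, MvPolynomial.aeval_def, MvPolynomial.eval₂_eq']
  refine natDegree_sum_le_of_forall_le _ _ fun d hd => ?_
  have hd' : d 0 + d 1 ≤ f.totalDegree := by
    refine le_trans (le_of_eq ?_) (MvPolynomial.le_totalDegree hd)
    rw [Finsupp.sum_fintype _ _ (fun _ => rfl), Fin.sum_univ_two]
  rw [Fin.prod_univ_two]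
  have h0 : (C x + C u * X : ℝ[X]).natDegree ≤ 1 := by compute_degree
  have h1 : (C y + C v * X - C κ * X ^ 2 : ℝ[X]).natDegree ≤ 2 := by compute_degree
  have h2 := natDegree_pow_le_of_le (d 0) h0
  have h3 := natDegree_pow_le_of_le (d 1) h1
  refine (natDegree_C_mul_le _ _).trans ((natDegree_mul_le_of_le h2 h3).trans ?_)
  omega

lemma derivative_curve (κ x y u v : ℝ) (f : MvPolynomial (Fin 2) ℝ) :
    derivative (curve κ x y u v f) =
      curve κ x y u v (dirDeriv u v f) -
        C (2 * κ) * (X * curve κ x y u v (MvPolynomial.pderiv 1 f)) := by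
  induction f using MvPolynomial.induction_on with
  | C a => simp [curve]
  | add f g hf hg => simp only [map_add, hf, hg]; ring
  | mul_X f i hf =>
    have h2 : (C (2 * κ) : ℝ[X]) = 2 * C κ := by rw [C_mul]; rfl
    rw [map_mul, derivative_mul, hf, Derivation.leibniz, Derivation.leibniz, h2]
    simp only [smul_eq_mul, map_add, map_mul]
    fin_cases i <;> simp [curve, dirDeriv_apply, MvPolynomial.smul_eq_C_mul] <;> ring

lemma coeff_curve_dirDeriv_zero (κ x y u v : ℝ) (f : MvPolynomial (Fin 2) ℝ) :
    (curve κ x y u v (dirDeriv u v f)).coeff 0 = (curve κ x y u v f).coeff 1 := by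
  have h := congrArg (fun F : ℝ[X] => F.coeff 0) (derivative_curve κ x y u v f)
  simpa [coeff_derivative] using h.symm

lemma coeff_curve_dirDeriv_succ (κ x y u v : ℝ) (f : MvPolynomial (Fin 2) ℝ) (a : ℕ) :
    (curve κ x y u v (dirDeriv u v f)).coeff (a + 1) =
      (a + 2) * (curve κ x y u v f).coeff (a + 2) +
        2 * κ * (curve κ x y u v (MvPolynomial.pderiv 1 f)).coeff a := by
  have h := congrArg (fun F : ℝ[X] => F.coeff (a + 1)) (derivative_curve κ x y u v f)
  simp only [coeff_derivative, coeff_sub, coeff_C_mul, coeff_X_mul] at h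
  push_cast at h
  linarith

lemma dirDeriv_pderiv_comm (u v : ℝ) (f : MvPolynomial (Fin 2) ℝ) :
    dirDeriv u v (MvPolynomial.pderiv 1 f) = MvPolynomial.pderiv 1 (dirDeriv u v f) := by
  have h : ⁅dirDeriv u v, (MvPolynomial.pderiv 1 : Derivation ℝ (MvPolynomial (Fin 2) ℝ) _)⁆ =
      0 := by
    refine MvPolynomial.derivation_ext fun i => ?_
    fin_cases i <;> simp [Derivation.commutator_apply, dirDeriv_apply, MvPolynomial.smul_eq_C_mul]
  have h' := DFunLike.congr_fun h f
  rwa [Derivation.commutator_apply, Derivation.coe_zero, Pi.zero_apply, sub_eq_zero] at h'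

lemma exists_coeff_curve_dirDeriv_iterate (κ : ℝ) (r : ℕ) : ∀ a : ℕ,
    ∃ B : ℕ → ℝ, ∀ (x y u v : ℝ) (f : MvPolynomial (Fin 2) ℝ),
      (curve κ x y u v ((dirDeriv u v)^[r] f)).coeff a =
        ∑ l ∈ Finset.range ((a + r) / 2 + 1),
          B l * (curve κ x y u v ((MvPolynomial.pderiv 1)^[l] f)).coeff (a + r - 2 * l) := by
  induction r with
  | zero =>
    refine fun a => ⟨fun l => if l = 0 then 1 else 0, fun x y u v f => ?_⟩
    rw [Finset.sum_eq_single 0] <;> simp +contextual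
  | succ r ih =>
    have hcomm (u v : ℝ) : Function.Commute (dirDeriv u v) (MvPolynomial.pderiv 1) :=
      fun f => dirDeriv_pderiv_comm u v f
    rintro (_ | a)
    · obtain ⟨B, hB⟩ := ih 1
      refine ⟨B, fun x y u v f => ?_⟩
      rw [Function.iterate_succ_apply', coeff_curve_dirDeriv_zero, hB, add_comm 1 r, zero_add]
    · obtain ⟨B₁, hB₁⟩ := ih (a + 2)
      obtain ⟨B₂, hB₂⟩ := ih a
      refine ⟨fun l => (a + 2) * B₁ l + (if l = 0 then 0 else 2 * κ * B₂ (l - 1)),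
        fun x y u v f => ?_⟩
      rw [Function.iterate_succ_apply', coeff_curve_dirDeriv_succ, hB₁,
        ← ((hcomm u v).iterate_left r) f, hB₂]
      have e : a + 2 + r = a + 1 + (r + 1) := by ring
      simp only [e]
      simp_rw [add_mul _ (ite _ _ _), Finset.sum_add_distrib]
      congr 1
      · rw [Finset.mul_sum]
        exact Finset.sum_congr rfl fun l _ => by ring
      · rw [Finset.sum_range_succ' _ ((a + 1 + (r + 1)) / 2), Finset.mul_sum]
        have e2 : (a + 1 + (r + 1)) / 2 = (a + r) / 2 + 1 := by omega
        rw [e2]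
        simp only [if_true, zero_mul, add_zero]
        refine Finset.sum_congr rfl fun l _ => ?_
        have e3 : a + 1 + (r + 1) - 2 * (l + 1) = a + r - 2 * l := by omega
        rw [e3, Function.iterate_succ_apply]
        simp
        ring

/-- Iterated directional derivatives in terms of Taylor coefficients along a parabola. -/
lemma exists_eval_dirDeriv_iterate (κ : ℝ) (r : ℕ) :
    ∃ B : ℕ → ℝ, ∀ (x y u v : ℝ) (f : MvPolynomial (Fin 2) ℝ),
      MvPolynomial.eval ![x, y] ((dirDeriv u v)^[r] f) =
        ∑ l ∈ Finset.range (r / 2 + 1),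
          B l * (curve κ x y u v ((MvPolynomial.pderiv 1)^[l] f)).coeff (r - 2 * l) := by
  obtain ⟨B, hB⟩ := exists_coeff_curve_dirDeriv_iterate κ r 0
  refine ⟨B, fun x y u v f => ?_⟩
  rw [← coeff_zero_curve κ x y u v, hB, zero_add]

lemma exists_coeff_curve_pderiv_iterate (j : ℕ) : ∀ k : ℕ,
    ∃ B : ℝ, ∀ (x y : ℝ) (f : MvPolynomial (Fin 2) ℝ),
      (curve 1 x y 0 0 ((MvPolynomial.pderiv 1)^[j] f)).coeff (2 * k) =
        B * (curve 1 x y 0 0 f).coeff (2 * (k + j)) := by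
  induction j with
  | zero => exact fun k => ⟨1, fun x y f => by simp⟩
  | succ j ih =>
    intro k
    obtain ⟨B, hB⟩ := ih (k + 1)
    refine ⟨-(k + 1) * B, fun x y f => ?_⟩
    have h := coeff_curve_dirDeriv_succ 1 x y 0 0 ((MvPolynomial.pderiv 1)^[j] f) (2 * k)
    have h0 : dirDeriv 0 0 ((MvPolynomial.pderiv 1)^[j] f) = 0 := by simp [dirDeriv_apply]
    have e : k + 1 + j = k + (j + 1) := by ring
    have e2 : 2 * k + 2 = 2 * (k + 1) := by ring
    rw [h0, e2, hB, e] at h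
    rw [Function.iterate_succ_apply']
    simp only [map_zero, coeff_zero] at h
    push_cast at h
    linarith

/-- Iterated vertical derivatives in terms of Taylor coefficients along a vertical fold. -/
lemma exists_eval_pderiv_iterate (j : ℕ) :
    ∃ B : ℝ, ∀ (x y : ℝ) (f : MvPolynomial (Fin 2) ℝ),
      MvPolynomial.eval ![x, y] ((MvPolynomial.pderiv 1)^[j] f) =
        B * (curve 1 x y 0 0 f).coeff (2 * j) := by
  obtain ⟨B, hB⟩ := exists_coeff_curve_pderiv_iterate j 0
  refine ⟨B, fun x y f => ?_⟩
  rw [← coeff_zero_curve 1 x y 0 0]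
  simpa using hB x y f

lemma eval_dirDeriv_zero_iterate (v : ℝ) (q : Fin 2 → ℝ) (f : MvPolynomial (Fin 2) ℝ) (r : ℕ) :
    MvPolynomial.eval q ((dirDeriv 0 v)^[r] f) =
      v ^ r * MvPolynomial.eval q ((MvPolynomial.pderiv 1)^[r] f) := by
  induction r generalizing f with
  | zero => simp
  | succ r ih =>
    have h (c : ℝ) (k : ℕ) (f : MvPolynomial (Fin 2) ℝ) :
        (MvPolynomial.pderiv (1 : Fin 2))^[k] (c • f) = c • (MvPolynomial.pderiv (1 : Fin 2))^[k] f := by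
      induction k generalizing f with
      | zero => rfl
      | succ k ihk => rw [Function.iterate_succ_apply, Derivation.map_smul, ihk,
          Function.iterate_succ_apply]
    rw [Function.iterate_succ_apply, ih, Function.iterate_succ_apply, dirDeriv_apply, zero_smul,
      zero_add, h, MvPolynomial.smul_eval]
    ring

lemma totalDegree_pderiv_le (k : Fin 2) (f : MvPolynomial (Fin 2) ℝ) :
    (MvPolynomial.pderiv k f).totalDegree ≤ f.totalDegree := by
  conv_lhs => rw [f.as_sum, map_sum]
  refine MvPolynomial.totalDegree_finsetSum_le fun d hd => ?_
  rw [MvPolynomial.pderiv_monomial]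
  refine (MvPolynomial.totalDegree_monomial_le _ _).trans ?_
  refine le_trans ?_ (MvPolynomial.le_totalDegree hd)
  rw [Finsupp.sum_fintype _ _ (fun _ => rfl), Finsupp.sum_fintype _ _ (fun _ => rfl)]
  exact Finset.sum_le_sum fun _ _ => Nat.sub_le _ _

lemma totalDegree_pderiv_iterate_le (k : Fin 2) (l : ℕ) (f : MvPolynomial (Fin 2) ℝ) :
    ((MvPolynomial.pderiv k)^[l] f).totalDegree ≤ f.totalDegree := by
  induction l with
  | zero => exact le_rfl
  | succ l ih =>
    rw [Function.iterate_succ_apply']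
    exact (totalDegree_pderiv_le k _).trans ih

end Curve

section Shift

open Polynomial Set

variable {p : ℝ≥0∞}

lemma eLpNorm_comp_restrict_le {α : Type*} [MeasurableSpace α] {μ : Measure α} {T : α → α}
    (hT : MeasurePreserving T μ μ) {S S' : Set α} (hS' : MeasurableSet S') (hTS : MapsTo T S S')
    {h : α → ℝ} (hh : Measurable h) :
    eLpNorm (h ∘ T) p (μ.restrict S) ≤ eLpNorm h p (μ.restrict S') :=
  (eLpNorm_mono_measure _ (Measure.restrict_mono hTS le_rfl)).trans
    (eLpNorm_comp_measurePreserving hh.aestronglyMeasurable (hT.restrict_preimage hS')).le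

/-- Bernstein-type estimate for Taylor coefficients along a measure-preserving family of shifts. -/
lemma exists_eLpNorm_coeff_le_of_shift (hp : 0 < p) (r : ℕ) {δ : ℝ} (hδ : 0 < δ) :
    ∃ C : ℝ≥0, ∀ m : ℕ, 0 < m → ∀ {α : Type} [MeasurableSpace α] {μ : Measure α} {S S' : Set α}
      {T : ℝ → α → α} {H h : α → ℝ}, MeasurableSet S → MeasurableSet S' → Measurable h →
      (∀ t, |t| ≤ δ → MeasurePreserving (T t) μ μ) →
      (∀ t, |t| ≤ δ → MapsTo (T t) S S') →
      (∀ x ∈ S, ∃ F : ℝ[X], F.natDegree ≤ 2 * m ∧ |H x| ≤ |F.coeff r| ∧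
        ∀ t, |t| ≤ δ → |F.eval t| ≤ |h (T t x)|) →
      eLpNorm H p (μ.restrict S) ≤ C * (m : ℝ≥0∞) ^ r * eLpNorm h p (μ.restrict S') := by
  obtain ⟨C, hC⟩ := exists_eLpNorm_coeff_le hp r hδ
  refine ⟨C * 2 ^ r, fun m hm α _ μ S S' T H h hS hS' hh hT hTS hF => ?_⟩
  refine (hC (2 * m) (by omega) (μ.restrict S) H (fun t => h ∘ T t) _
    ((ae_restrict_iff' hS).2 (ae_of_all _ hF))
    (fun t ht => (hh.comp (hT t ht).measurable).aestronglyMeasurable)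
    (fun t ht => eLpNorm_comp_restrict_le (hT t ht) hS' (hTS t ht) hh)).trans (le_of_eq ?_)
  push_cast
  rw [mul_pow]
  ring

/-- The shift of the plane along the parabolas `t ↦ (x + u t, y + v x t - κ t ^ 2)`. -/
def shift (κ u : ℝ) (v : ℝ → ℝ) (t : ℝ) (q : ℝ × ℝ) : ℝ × ℝ :=
  (q.1 + u * t, q.2 + v q.1 * t - κ * t ^ 2)

lemma measurePreserving_shift (κ u : ℝ) {v : ℝ → ℝ} (hv : Measurable v) (t : ℝ) :
    MeasurePreserving (shift κ u v t) := by
  have h1 : MeasurePreserving (fun x : ℝ => x + u * t) := measurePreserving_add_right _ _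
  refine h1.skew_product (g := fun x y => y + v x * t - κ * t ^ 2) (by fun_prop) ?_
  refine ae_of_all _ fun x => ?_
  have := (measurePreserving_add_right (volume : Measure ℝ) (v x * t - κ * t ^ 2)).map_eq
  simpa only [add_sub_assoc] using this

lemma measurable_eval_pair {α : Type*} [MeasurableSpace α] {a b : α → ℝ} (ha : Measurable a)
    (hb : Measurable b) (f : MvPolynomial (Fin 2) ℝ) :
    Measurable fun q => MvPolynomial.eval ![a q, b q] f := by
  refine (MvPolynomial.continuous_eval f).measurable.comp (measurable_pi_lambda _ fun i => ?_)
  fin_cases i <;> simpa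

lemma measurable_coeff_curve {α : Type*} [MeasurableSpace α] {a b v : α → ℝ} (ha : Measurable a)
    (hb : Measurable b) (hv : Measurable v) (κ u : ℝ) (f : MvPolynomial (Fin 2) ℝ) (k : ℕ) :
    Measurable fun q => (curve κ (a q) (b q) u (v q) f).coeff k := by
  obtain ⟨K, -, hK⟩ := exists_hasCoeffFormula _root_.one_pos k _root_.one_pos
  obtain ⟨ι, _, c, s, -, -, hF⟩ := hK (2 * f.totalDegree + 1) (by omega)
  have h q := hF (curve κ (a q) (b q) u (v q) f)
    ((natDegree_curve_le _ _ _ _ _ f).trans (Nat.le_succ _))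
  simp_rw [h, eval_curve]
  exact Finset.measurable_sum _ fun i _ =>
    (measurable_eval_pair (by fun_prop) (by fun_prop) f).const_mul _

/-- Weighted Bernstein-type estimate for Taylor coefficients along parabolas in the plane. -/
lemma exists_eLpNorm_coeff_curve_le (hp : 0 < p) (k : ℕ) {δ : ℝ} (hδ : 0 < δ) :
    ∃ K : ℝ≥0, ∀ {κ u : ℝ} {v : ℝ → ℝ} {S S' : Set (ℝ × ℝ)} {w : ℝ × ℝ → ℝ},
      Measurable v → MeasurableSet S → MeasurableSet S' → Measurable w →
      (∀ t, |t| ≤ δ → MapsTo (shift κ u v t) S S') →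
      (∀ t, |t| ≤ δ → ∀ q ∈ S, |w q| ≤ |w (shift κ u v t q)|) →
      ∀ n : ℕ, 0 < n → ∀ f : MvPolynomial (Fin 2) ℝ, f.totalDegree ≤ n →
      eLpNorm (fun q => w q * (curve κ q.1 q.2 u (v q.1) f).coeff k) p (volume.restrict S) ≤
        K * (n : ℝ≥0∞) ^ k *
          eLpNorm (fun q => w q * MvPolynomial.eval ![q.1, q.2] f) p (volume.restrict S') := by
  obtain ⟨K, hK⟩ := exists_eLpNorm_coeff_le_of_shift hp k hδ
  refine ⟨K, fun {κ u v S S' w} hv hS hS' hw hTS hwT n hn f hf => ?_⟩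
  refine hK n hn (T := shift κ u v) hS hS'
    (hw.mul (measurable_eval_pair measurable_fst measurable_snd f))
    (fun t _ => measurePreserving_shift κ u hv t) hTS fun q hq => ?_
  refine ⟨C (w q) * curve κ q.1 q.2 u (v q.1) f, ?_, ?_, fun t ht => ?_⟩
  · refine (natDegree_C_mul_le _ _).trans ((natDegree_curve_le _ _ _ _ _ f).trans ?_)
    omega
  · rw [coeff_C_mul]
  · rw [eval_mul, eval_C, eval_curve, abs_mul, abs_mul]
    exact mul_le_mul_of_nonneg_right (hwT t ht q hq) (abs_nonneg _)

end Shift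

section Planar

open Set

variable {p : ℝ≥0∞}

/-- The planar domain of depth and half-width `b` below the graph of `g`. -/
def graphDomain (g : ℝ → ℝ) (b : ℝ) : Set (ℝ × ℝ) :=
  {q | q.1 ∈ Ioo (-b) b ∧ g q.1 - b < q.2 ∧ q.2 ≤ g q.1}

/-- The `i`-th power of the weight `√(g x - y) + 1 / n`. -/
def depthWeight (g : ℝ → ℝ) (n i : ℕ) (q : ℝ × ℝ) : ℝ :=
  (√(g q.1 - q.2) + 1 / n) ^ i

lemma measurableSet_graphDomain {g : ℝ → ℝ} (hg : Measurable g) (b : ℝ) :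
    MeasurableSet (graphDomain g b) := by
  refine (measurableSet_Ioo.preimage measurable_fst).inter (MeasurableSet.inter ?_ ?_)
  · exact measurableSet_lt (by fun_prop) measurable_snd
  · exact measurableSet_le measurable_snd (by fun_prop)

lemma measurable_depthWeight {g : ℝ → ℝ} (hg : Measurable g) (n i : ℕ) :
    Measurable (depthWeight g n i) := by
  unfold depthWeight
  fun_prop

lemma abs_depthWeight_le {g : ℝ → ℝ} {q q' : ℝ × ℝ} (h : g q.1 - q.2 ≤ g q'.1 - q'.2) (n i : ℕ) :
    |depthWeight g n i q| ≤ |depthWeight g n i q'| := by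
  unfold depthWeight
  rw [abs_of_nonneg (by positivity), abs_of_nonneg (by positivity)]
  gcongr

/-- Weighted Markov inequality for vertical derivatives. -/
lemma exists_eLpNorm_vertical_le (hp : 0 < p) (i j : ℕ) {l₁ l₂ : ℝ} (hl : l₁ < l₂) :
    ∃ C : ℝ≥0, ∀ a : ℝ, 1 ≤ a → ∀ g : ℝ → ℝ, Measurable g → ∀ n : ℕ, 0 < n →
      ∀ f : MvPolynomial (Fin 2) ℝ, f.totalDegree ≤ n →
      eLpNorm (fun q => depthWeight g n i q *
          MvPolynomial.eval ![q.1, q.2] ((MvPolynomial.pderiv 1)^[j] f))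
        p (volume.restrict (graphDomain g (l₁ * a))) ≤
      C * (n : ℝ≥0∞) ^ (2 * j) *
        eLpNorm (fun q => depthWeight g n i q * MvPolynomial.eval ![q.1, q.2] f)
          p (volume.restrict (graphDomain g (l₂ * a))) := by
  obtain ⟨B, hB⟩ := exists_eval_pderiv_iterate j
  obtain ⟨C, hC⟩ := exists_eLpNorm_coeff_curve_le (δ := min 1 (l₂ - l₁)) hp (2 * j)
    (lt_min _root_.one_pos (sub_pos.2 hl))
  refine ⟨‖B‖₊ * C, fun a ha g hg n hn f hf => ?_⟩
  have hs (t : ℝ) (ht : |t| ≤ min 1 (l₂ - l₁)) : t ^ 2 ≤ l₂ * a - l₁ * a := by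
    obtain ⟨h1, h2⟩ := le_min_iff.1 ht
    rw [← sq_abs]
    nlinarith [abs_nonneg t]
  have key := hC (κ := 1) (u := 0) (v := 0) (w := depthWeight g n i) measurable_zero
    (measurableSet_graphDomain hg (l₁ * a)) (measurableSet_graphDomain hg (l₂ * a))
    (measurable_depthWeight hg n i) (fun t ht q hq => ?_) (fun t ht q hq => ?_) n hn f hf
  · simp_rw [hB, mul_left_comm _ B]
    refine (eLpNorm_const_smul B _ p _).le.trans ((mul_le_mul_right key _).trans (le_of_eq ?_))
    rw [ENNReal.coe_mul, mul_assoc, mul_assoc, mul_assoc]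
    rfl
  · have := hs t ht
    obtain ⟨⟨h1, h2⟩, h3, h4⟩ := hq
    refine ⟨⟨?_, ?_⟩, ?_, ?_⟩ <;> simp [shift] <;> nlinarith [sq_nonneg t]
  · refine abs_depthWeight_le ?_ n i
    simp [shift]
    nlinarith [sq_nonneg t]

/-- Weighted Bernstein inequality for tangential derivatives. -/
lemma exists_eLpNorm_tangential_le (hp : 0 < p) (i r : ℕ) {M l₁ l₂ : ℝ} (hM : 1 ≤ M)
    (hl : l₁ < l₂) (hl₂ : l₂ ≤ 2) :
    ∃ C : ℝ≥0, ∀ a : ℝ, 1 ≤ a → ∀ g g₁ : ℝ → ℝ, Measurable g → Measurable g₁ →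
      (∀ x s, |x| ≤ 2 * a → |x + s| ≤ 2 * a → |g (x + s) - g x - s * g₁ x| ≤ M * s ^ 2) →
      ∀ n : ℕ, 0 < n → ∀ f : MvPolynomial (Fin 2) ℝ, f.totalDegree ≤ n →
      eLpNorm (fun q => depthWeight g n i q *
          MvPolynomial.eval ![q.1, q.2] ((dirDeriv 1 (g₁ q.1))^[r] f))
        p (volume.restrict (graphDomain g (l₁ * a))) ≤
      C * (n : ℝ≥0∞) ^ r *
        eLpNorm (fun q => depthWeight g n i q * MvPolynomial.eval ![q.1, q.2] f)
          p (volume.restrict (graphDomain g (l₂ * a))) := by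
  obtain ⟨l, hl1, hl2⟩ := exists_between hl
  set δ := min 1 ((l - l₁) / (2 * M)) with hδ
  have hδ0 : 0 < δ := lt_min _root_.one_pos (div_pos (sub_pos.2 hl1) (by positivity))
  obtain ⟨B, hB⟩ := exists_eval_dirDeriv_iterate M r
  choose C hC using fun k : ℕ => exists_eLpNorm_coeff_curve_le hp (r - 2 * k) hδ0
  choose A hA using fun k : ℕ => exists_eLpNorm_vertical_le hp i k hl2
  refine ⟨(∑ k ∈ Finset.range (r / 2 + 1), (‖B k‖₊ * C k * A k) ^ subaddExponent p) ^
    (1 / subaddExponent p), fun a ha g g₁ hg hg₁ hT n hn f hf => ?_⟩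
  have hs (t : ℝ) (ht : |t| ≤ δ) : |t| ≤ l * a - l₁ * a ∧ 2 * M * t ^ 2 ≤ l * a - l₁ * a := by
    obtain ⟨h1, h2⟩ := le_min_iff.1 ht
    rw [le_div_iff₀ (by positivity)] at h2
    have h3 : l - l₁ ≤ l * a - l₁ * a := by nlinarith
    rw [← sq_abs]
    constructor <;> nlinarith [abs_nonneg t, mul_nonneg (abs_nonneg t) (sub_nonneg.2 hM)]
  have htaylor (t : ℝ) (ht : |t| ≤ δ) (q : ℝ × ℝ) (hq : q ∈ graphDomain g (l₁ * a)) :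
      |g (q.1 + t) - g q.1 - t * g₁ q.1| ≤ M * t ^ 2 := by
    obtain ⟨h1, h2⟩ := abs_le.1 (hs t ht).1
    obtain ⟨⟨h3, h4⟩, -⟩ := hq
    refine hT _ _ (abs_le.2 ?_) (abs_le.2 ?_) <;> constructor <;> nlinarith
  rw [mul_assoc]
  refine eLpNorm_le_of_abs_le_sum hp (s := Finset.range (r / 2 + 1))
    (f := fun k q => B k * (depthWeight g n i q *
      (curve M q.1 q.2 1 (g₁ q.1) ((MvPolynomial.pderiv 1)^[k] f)).coeff (r - 2 * k)))
    (fun k _ => ?_) (fun k => ‖B k‖₊ * C k * A k) _ (fun k hk => ?_) (ae_of_all _ fun q => ?_)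
  · refine ((measurable_depthWeight hg n i).mul ?_).const_mul _ |>.aestronglyMeasurable
    exact measurable_coeff_curve measurable_fst measurable_snd (by fun_prop) _ _ _ _
  · have h1 := hC k (κ := M) (u := 1) (v := g₁) (w := depthWeight g n i) hg₁
      (measurableSet_graphDomain hg (l₁ * a)) (measurableSet_graphDomain hg (l * a))
      (measurable_depthWeight hg n i) (fun t ht q hq => ?_) (fun t ht q hq => ?_) n hn
      ((MvPolynomial.pderiv 1)^[k] f) ((totalDegree_pderiv_iterate_le 1 k f).trans hf)
    · have h2 := hA k a ha g hg n hn f hf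
      have hk' : 2 * k ≤ r := by have := Finset.mem_range.1 hk; omega
      refine (eLpNorm_const_smul (B k) _ p _).le.trans ?_
      refine (mul_le_mul_right (h1.trans (mul_le_mul_right h2 _)) _).trans (le_of_eq ?_)
      rw [← Nat.sub_add_cancel hk', pow_add, Nat.sub_add_cancel hk', ENNReal.coe_mul,
        ENNReal.coe_mul]
      change (‖B k‖₊ : ℝ≥0∞) * _ = _
      ring
    · have h1 := htaylor t ht q hq
      obtain ⟨h2, h3⟩ := hs t ht
      obtain ⟨⟨h4, h5⟩, h6, h7⟩ := hq
      rw [abs_le] at h1 h2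
      refine ⟨⟨?_, ?_⟩, ?_, ?_⟩ <;> simp [shift] <;> linarith
    · have h1 := htaylor t ht q hq
      refine abs_depthWeight_le ?_ n i
      rw [abs_le] at h1
      simp [shift]
      linarith
  · rw [hB, Finset.mul_sum]
    refine (Finset.abs_sum_le_sum_abs _ _).trans (le_of_eq (Finset.sum_congr rfl fun k _ => ?_))
    rw [mul_left_comm]

end Planar

section Lift

open Set Polynomial

variable {p : ℝ≥0∞}

lemma map_normSq_volume :
    Measure.map (fun z : ℂ => ‖z‖ ^ 2) volume =
      ENNReal.ofReal Real.pi • (volume : Measure ℝ).restrict (Ici 0) := by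
  have hm : Measurable (fun z : ℂ => ‖z‖ ^ 2) := by fun_prop
  have : IsLocallyFiniteMeasure (ENNReal.ofReal Real.pi • (volume : Measure ℝ).restrict (Ici 0)) :=
    inferInstanceAs (IsLocallyFiniteMeasure (Real.pi.toNNReal • volume.restrict (Ici 0)))
  symm
  refine Measure.ext_of_Ico _ _ fun a b hab => ?_
  have hpre : (fun z : ℂ => ‖z‖ ^ 2) ⁻¹' Ico a b =
      Metric.ball 0 √b \ Metric.ball 0 √a := by
    ext z
    simp only [mem_preimage, mem_Ico, mem_sdiff, Metric.mem_ball, dist_zero_right, not_lt,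
      Real.lt_sqrt (norm_nonneg z)]
    tauto
  rw [Measure.map_apply hm measurableSet_Ico, hpre,
    measure_sdiff (Metric.ball_subset_ball (Real.sqrt_le_sqrt hab.le))
      measurableSet_ball.nullMeasurableSet measure_ball_lt_top.ne,
    Complex.volume_ball, Complex.volume_ball, Measure.smul_apply,
    Measure.restrict_apply measurableSet_Ico]
  have h : Ico a b ∩ Ici 0 = Ico (max a 0) (max b 0) := by
    ext x
    simp only [mem_inter_iff, mem_Ico, mem_Ici, max_le_iff, lt_max_iff]
    constructor
    · rintro ⟨⟨h1, h2⟩, h3⟩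
      exact ⟨⟨h1, h3⟩, Or.inl h2⟩
    · rintro ⟨⟨h1, h3⟩, h2⟩
      exact ⟨⟨h1, h2.resolve_right h3.not_gt⟩, h3⟩
  rw [h, Real.volume_Ico, smul_eq_mul, ENNReal.ofReal_sub _ (le_max_right _ _),
    ← ENNReal.ofReal_pow (Real.sqrt_nonneg _), ← ENNReal.ofReal_pow (Real.sqrt_nonneg _),
    Real.sq_sqrt', Real.sq_sqrt', ← ENNReal.sub_mul (by simp), mul_comm]
  exact congrArg (_ * ·) (ENNReal.ofReal_coe_nnreal (p := NNReal.pi))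

/-- The lift of the plane to `ℝ × ℂ` that straightens the depth below the graph of `g`. -/
def lift (g : ℝ → ℝ) (q : ℝ × ℂ) : ℝ × ℝ := (q.1, g q.1 - ‖q.2‖ ^ 2)

lemma measurable_lift {g : ℝ → ℝ} (hg : Measurable g) : Measurable (lift g) := by
  unfold lift
  fun_prop

lemma map_lift {g : ℝ → ℝ} (hg : Measurable g) :
    Measure.map (lift g) volume =
      ENNReal.ofReal Real.pi • (volume : Measure (ℝ × ℝ)).restrict {q | q.2 ≤ g q.1} := by
  have h1 : MeasurePreserving (fun q : ℝ × ℝ => (q.1, g q.1 - q.2)) :=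
    (MeasurePreserving.id volume).skew_product (g := fun x y => g x - y) (by fun_prop)
      (ae_of_all _ fun x => (volume.measurePreserving_sub_left (g x)).map_eq)
  have h2 : Measure.map (Prod.map id fun z : ℂ => ‖z‖ ^ 2) (volume : Measure (ℝ × ℂ)) =
      ENNReal.ofReal Real.pi • (volume : Measure (ℝ × ℝ)).restrict {q | 0 ≤ q.2} := by
    rw [Measure.volume_eq_prod ℝ ℂ, Measure.volume_eq_prod ℝ ℝ, ← Measure.map_prod_map _ _ measurable_id (by fun_prop),
      Measure.map_id, map_normSq_volume, Measure.prod_smul_right]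
    congr 1
    conv_lhs => rw [← Measure.restrict_univ (μ := (volume : Measure ℝ))]
    have h3 : univ ×ˢ Ici 0 = {q : ℝ × ℝ | 0 ≤ q.2} := by
      ext q
      simp
    rw [Measure.prod_restrict, h3, Measure.restrict_univ]
  have h4 : lift g = (fun q : ℝ × ℝ => (q.1, g q.1 - q.2)) ∘ Prod.map id fun z : ℂ => ‖z‖ ^ 2 := rfl
  rw [h4, ← Measure.map_map h1.measurable (by fun_prop), h2, Measure.map_smul]
  congr 1
  have h5 : MeasurableSet {q : ℝ × ℝ | q.2 ≤ g q.1} :=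
    measurableSet_le measurable_snd (by fun_prop)
  rw [← (h1.restrict_preimage h5).map_eq]
  congr 2
  ext q
  simp

lemma eLpNorm_comp_lift {g : ℝ → ℝ} (hg : Measurable g) (b : ℝ) {h : ℝ × ℝ → ℝ}
    (hh : Measurable h) :
    eLpNorm (h ∘ lift g) p (volume.restrict (lift g ⁻¹' graphDomain g b)) =
      ENNReal.ofReal Real.pi ^ (1 / p).toReal * eLpNorm h p (volume.restrict (graphDomain g b)) := by
  have hS := measurableSet_graphDomain hg b
  have hpi : ENNReal.ofReal Real.pi ≠ 0 := by simpa using Real.pi_pos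
  rw [← eLpNorm_map_measure hh.aestronglyMeasurable (measurable_lift hg).aemeasurable,
    ← Measure.restrict_map (measurable_lift hg) hS, map_lift hg, Measure.restrict_smul,
    Measure.restrict_restrict hS, inter_eq_left.2 fun q hq => hq.2.2,
    eLpNorm_smul_measure_of_ne_zero hpi, smul_eq_mul]

/-- Bernstein inequality along a real direction `ω` in the lifted domain. -/
lemma exists_eLpNorm_lift_direction_le (hp : 0 < p) (i : ℕ) {l₁ l₂ : ℝ} (hl₁ : 1 ≤ l₁)
    (hl : l₁ < l₂) {ω : ℂ} (hω : ‖ω‖ = 1) :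
    ∃ C : ℝ≥0, ∀ a : ℝ, 1 ≤ a → ∀ g : ℝ → ℝ, Measurable g → ∀ n : ℕ, 0 < n →
      ∀ f : MvPolynomial (Fin 2) ℝ, f.totalDegree ≤ n →
      eLpNorm (fun q : ℝ × ℂ => inner ℝ q.2 ω ^ i *
          MvPolynomial.eval ![(lift g q).1, (lift g q).2] ((MvPolynomial.pderiv 1)^[i] f))
        p (volume.restrict (lift g ⁻¹' graphDomain g (l₁ * a))) ≤
      C * (n : ℝ≥0∞) ^ i *
        eLpNorm (fun q => MvPolynomial.eval ![q.1, q.2] f)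
          p (volume.restrict (graphDomain g (l₂ * a))) := by
  obtain ⟨l, hl1, hl2⟩ := exists_between hl
  set δ := min 1 ((l - l₁) / (l₁ + 2)) with hδ
  have hδ0 : 0 < δ := lt_min _root_.one_pos (div_pos (sub_pos.2 hl1) (by positivity))
  obtain ⟨B, hB⟩ := exists_eval_dirDeriv_iterate 1 i
  choose C hC using fun k : ℕ => exists_eLpNorm_coeff_le_of_shift hp (i - 2 * k) hδ0
  choose A hA using fun k : ℕ => exists_eLpNorm_vertical_le hp 0 k hl2
  set P : ℝ≥0 := Real.pi.toNNReal ^ (1 / p).toReal with hP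
  refine ⟨(∑ k ∈ Finset.range (i / 2 + 1),
    (‖(2⁻¹ : ℝ) ^ i * B k‖₊ * C k * P * A k) ^ subaddExponent p) ^ (1 / subaddExponent p), fun a ha g hg n hn f hf => ?_⟩
  rw [mul_assoc]
  have hm (b : ℝ) := (measurableSet_graphDomain hg b).preimage (measurable_lift hg)
  have hlift (t : ℝ) (q : ℝ × ℂ) : lift g (q.1, q.2 + t • ω) =
      ((lift g q).1 + 0 * t, (lift g q).2 + (-2 * inner ℝ q.2 ω) * t - 1 * t ^ 2) := by
    simp only [lift, norm_add_sq_real, inner_smul_right, norm_smul, hω]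
    ext
    · simp
    · simp
      ring
  refine eLpNorm_le_of_abs_le_sum hp (s := Finset.range (i / 2 + 1))
    (f := fun k q => ((2⁻¹ : ℝ) ^ i * B k) *
      (curve 1 (lift g q).1 (lift g q).2 0 (-2 * inner ℝ q.2 ω)
        ((MvPolynomial.pderiv 1)^[k] f)).coeff (i - 2 * k))
    (fun k _ => ?_) (fun k => ‖(2⁻¹ : ℝ) ^ i * B k‖₊ * C k * P * A k) _ (fun k hk => ?_)
    (ae_of_all _ fun q => ?_)
  · refine Measurable.const_mul ?_ _ |>.aestronglyMeasurable
    have := measurable_lift hg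
    exact measurable_coeff_curve (by fun_prop) (by fun_prop) (by fun_prop) _ _ _ _
  · set f' := (MvPolynomial.pderiv 1)^[k] f with hf'
    have hf'n : f'.totalDegree ≤ n := (totalDegree_pderiv_iterate_le 1 k f).trans hf
    have hmeas : Measurable fun q : ℝ × ℝ => MvPolynomial.eval ![q.1, q.2] f' :=
      measurable_eval_pair measurable_fst measurable_snd f'
    have h1 := hC k n hn (μ := (volume : Measure (ℝ × ℂ)))
      (T := fun t q => (q.1, q.2 + t • ω))
      (H := fun q => (curve 1 (lift g q).1 (lift g q).2 0 (-2 * inner ℝ q.2 ω) f').coeff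
        (i - 2 * k))
      (h := (fun q : ℝ × ℝ => MvPolynomial.eval ![q.1, q.2] f') ∘ lift g)
      (hm (l₁ * a)) (hm (l * a)) (hmeas.comp (measurable_lift hg)) (fun t ht => ?_)
      (fun t ht q hq => ?_) (fun q hq => ⟨_, ?_, le_rfl, fun t ht => ?_⟩)
    · rw [eLpNorm_comp_lift hg _ hmeas] at h1
      have h2 := hA k a ha g hg n hn f hf
      simp only [depthWeight, pow_zero, one_mul] at h2
      have hk' : 2 * k ≤ i := by have := Finset.mem_range.1 hk; omega
      refine (eLpNorm_const_smul ((2⁻¹ : ℝ) ^ i * B k) _ p _).le.trans ?_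
      refine (mul_le_mul_right (h1.trans (mul_le_mul_right (mul_le_mul_right h2 _) _)) _).trans
        (le_of_eq ?_)
      have hP' : ENNReal.ofReal Real.pi ^ (1 / p).toReal = (P : ℝ≥0∞) := by
        rw [hP, ENNReal.coe_rpow_of_nonneg _ toReal_nonneg]
        rfl
      have hpow : (n : ℝ≥0∞) ^ i = (n : ℝ≥0∞) ^ (i - 2 * k) * (n : ℝ≥0∞) ^ (2 * k) := by
        rw [← pow_add, Nat.sub_add_cancel hk']
      rw [hpow, hP']
      simp only [ENNReal.coe_mul]
      change (‖(2⁻¹ : ℝ) ^ i * B k‖₊ : ℝ≥0∞) * _ = _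
      rw [nnnorm_mul, ENNReal.coe_mul]
      ring
    · exact (MeasurePreserving.id volume).prod (measurePreserving_add_right volume (t • ω))
    · obtain ⟨h1, h2⟩ := le_min_iff.1 ht
      rw [le_div_iff₀ (by positivity)] at h2
      obtain ⟨⟨h3, h4⟩, h5, h6⟩ := hq
      have h7 : ‖q.2 + t • ω‖ ≤ ‖q.2‖ + |t| := by
        simpa [norm_smul, hω] using norm_add_le q.2 (t • ω)
      have h8 : ‖q.2‖ ^ 2 < l₁ * a := by simp only [lift] at h5; linarith
      have h9 : ‖q.2 + t • ω‖ ^ 2 < l * a := by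
        have e1 := pow_le_pow_left₀ (norm_nonneg _) h7 2
        have e2 : 2 * ‖q.2‖ ≤ ‖q.2‖ ^ 2 + 1 := by nlinarith [sq_nonneg (‖q.2‖ - 1)]
        have e3 : |t| * (2 * ‖q.2‖) ≤ |t| * (l₁ * a + 1) :=
          mul_le_mul_of_nonneg_left (by linarith) (abs_nonneg t)
        have e4 : |t| * |t| ≤ |t| := by nlinarith [abs_nonneg t]
        have e5 : |t| * (l₁ * a + 2) ≤ |t| * ((l₁ + 2) * a) :=
          mul_le_mul_of_nonneg_left (by linarith) (abs_nonneg t)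
        nlinarith
      refine ⟨⟨?_, ?_⟩, ?_, ?_⟩ <;> simp only [lift] at * <;> nlinarith [sq_nonneg ‖q.2 + t • ω‖]
    · refine (natDegree_curve_le _ _ _ _ _ _).trans ?_
      omega
    · rw [eval_curve, Function.comp_apply, hlift]
  · have h := hB (lift g q).1 (lift g q).2 0 (-2 * inner ℝ q.2 ω) f
    rw [eval_dirDeriv_zero_iterate] at h
    have h2 : inner ℝ q.2 ω ^ i *
        MvPolynomial.eval ![(lift g q).1, (lift g q).2] ((MvPolynomial.pderiv 1)^[i] f) =
        (-1) ^ i * (2⁻¹ : ℝ) ^ i * ((-2 * inner ℝ q.2 ω) ^ i *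
        MvPolynomial.eval ![(lift g q).1, (lift g q).2] ((MvPolynomial.pderiv 1)^[i] f)) := by
      rw [← mul_assoc, ← mul_pow, ← mul_pow]
      congr 2
      ring
    rw [h2, h, mul_assoc, abs_mul, abs_pow, abs_neg, abs_one, one_pow, one_mul, Finset.mul_sum]
    refine (Finset.abs_sum_le_sum_abs _ _).trans (le_of_eq (Finset.sum_congr rfl fun k _ => ?_))
    rw [mul_assoc]

end Lift

section Assembly

open Set

variable {p : ℝ≥0∞}

lemma add_add_pow_le {x y z : ℝ} (hx : 0 ≤ x) (hy : 0 ≤ y) (hz : 0 ≤ z) (i : ℕ) :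
    (x + y + z) ^ i ≤ 3 ^ i * (x ^ i + y ^ i + z ^ i) := by
  have h (m : ℝ) (hm : x + y + z ≤ 3 * m) (h : m ^ i ≤ x ^ i + y ^ i + z ^ i) :
      (x + y + z) ^ i ≤ 3 ^ i * (x ^ i + y ^ i + z ^ i) := by
    refine (pow_le_pow_left₀ (by positivity) hm i).trans ?_
    rw [mul_pow]
    gcongr
  have hx' := pow_nonneg hx i
  have hy' := pow_nonneg hy i
  have hz' := pow_nonneg hz i
  rcases le_total x y with h1 | h1 <;> rcases le_total y z with h2 | h2 <;>
    rcases le_total x z with h3 | h3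
  all_goals first
    | exact h x (by linarith) (by linarith)
    | exact h y (by linarith) (by linarith)
    | exact h z (by linarith) (by linarith)

/-- Weighted Bernstein inequality for vertical derivatives. -/
lemma exists_eLpNorm_depth_le (hp : 0 < p) (i : ℕ) {l₁ l₂ : ℝ} (hl₁ : 1 ≤ l₁) (hl : l₁ < l₂) :
    ∃ C : ℝ≥0, ∀ a : ℝ, 1 ≤ a → ∀ g : ℝ → ℝ, Measurable g → ∀ n : ℕ, 0 < n →
      ∀ f : MvPolynomial (Fin 2) ℝ, f.totalDegree ≤ n →
      eLpNorm (fun q => depthWeight g n i q *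
          MvPolynomial.eval ![q.1, q.2] ((MvPolynomial.pderiv 1)^[i] f))
        p (volume.restrict (graphDomain g (l₁ * a))) ≤
      C * (n : ℝ≥0∞) ^ i *
        eLpNorm (fun q => MvPolynomial.eval ![q.1, q.2] f)
          p (volume.restrict (graphDomain g (l₂ * a))) := by
  obtain ⟨C₁, hC₁⟩ := exists_eLpNorm_lift_direction_le hp i hl₁ hl (ω := 1) (by simp)
  obtain ⟨C₂, hC₂⟩ := exists_eLpNorm_lift_direction_le hp i hl₁ hl (ω := Complex.I) (by simp)
  obtain ⟨A, hA⟩ := exists_eLpNorm_vertical_le hp 0 i hl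
  set P : ℝ≥0 := Real.pi.toNNReal ^ (1 / p).toReal with hP
  have hP0 : P ≠ 0 := (NNReal.rpow_pos (by simpa using Real.pi_pos)).ne'
  have hP' : ENNReal.ofReal Real.pi ^ (1 / p).toReal = (P : ℝ≥0∞) := by
    rw [hP, ENNReal.coe_rpow_of_nonneg _ toReal_nonneg]
    rfl
  let c : Fin 3 → ℝ≥0 := ![3 ^ i * C₁, 3 ^ i * C₂, 3 ^ i * (P * A)]
  refine ⟨P⁻¹ * (∑ k, c k ^ subaddExponent p) ^ (1 / subaddExponent p),
    fun a ha g hg n hn f hf => ?_⟩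
  set E := eLpNorm (fun q : ℝ × ℝ => MvPolynomial.eval ![q.1, q.2] f)
    p (volume.restrict (graphDomain g (l₂ * a))) with hE
  set f' := (MvPolynomial.pderiv 1)^[i] f with hf'
  have hmeas : Measurable fun q : ℝ × ℝ => MvPolynomial.eval ![q.1, q.2] f' :=
    measurable_eval_pair measurable_fst measurable_snd f'
  have hlift := measurable_lift hg
  have hmeas' : Measurable fun q : ℝ × ℂ =>
      MvPolynomial.eval ![(lift g q).1, (lift g q).2] f' := hmeas.comp hlift
  have h3 : ‖(3 : ℝ) ^ i‖ₑ = ((3 ^ i : ℝ≥0) : ℝ≥0∞) := by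
    rw [enorm_eq_nnnorm, nnnorm_pow]
    simp
  have key : eLpNorm ((fun q => depthWeight g n i q * MvPolynomial.eval ![q.1, q.2] f') ∘ lift g)
      p (volume.restrict (lift g ⁻¹' graphDomain g (l₁ * a))) ≤
      ((∑ k, c k ^ subaddExponent p) ^ (1 / subaddExponent p) : ℝ≥0) * ((n : ℝ≥0∞) ^ i * E) := by
    refine eLpNorm_le_of_abs_le_sum hp (s := Finset.univ)
      (f := fun k q => (3 : ℝ) ^ i *
        ((![inner ℝ q.2 (1 : ℂ), inner ℝ q.2 Complex.I, 1 / n] k : ℝ) ^ i *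
          MvPolynomial.eval ![(lift g q).1, (lift g q).2] f'))
      (fun k _ => ?_) c _ (fun k _ => ?_) (ae_of_all _ fun q => ?_)
    · refine (Measurable.const_mul (Measurable.mul ?_ hmeas') _).aestronglyMeasurable
      fin_cases k <;> simp <;> fun_prop
    · refine (eLpNorm_const_smul ((3 : ℝ) ^ i) _ p _).le.trans ?_
      rw [h3]
      fin_cases k
      · refine (mul_le_mul_right (hC₁ a ha g hg n hn f hf) _).trans (le_of_eq ?_)
        simp [c, mul_assoc, hE]
      · refine (mul_le_mul_right (hC₂ a ha g hg n hn f hf) _).trans (le_of_eq ?_)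
        simp [c, mul_assoc, hE]
      · have h1 := hA a ha g hg n hn f hf
        simp only [depthWeight, pow_zero, one_mul] at h1
        have h2 := (eLpNorm_comp_lift (p := p) hg (l₁ * a) hmeas).le
        have hn' : ‖(1 / n : ℝ) ^ i‖ₑ * (n : ℝ≥0∞) ^ i = 1 := by
          have h0 : (n : ℝ≥0∞) = ‖(n : ℝ)‖ₑ := by simp
          rw [h0, ← enorm_pow, ← enorm_mul, ← mul_pow, one_div_mul_cancel (by positivity)]
          simp
        refine (mul_le_mul_right ((eLpNorm_const_smul ((1 / n : ℝ) ^ i) _ p _).le.trans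
          (mul_le_mul_right (h2.trans (mul_le_mul_right h1 _)) _)) _).trans (le_of_eq ?_)
        rw [hP', two_mul, pow_add]
        calc _ = ((3 ^ i : ℝ≥0) : ℝ≥0∞) * (P * A) * (‖(1 / n : ℝ) ^ i‖ₑ * (n : ℝ≥0∞) ^ i) *
              ((n : ℝ≥0∞) ^ i * E) := by ring
          _ = _ := by
            rw [hn', mul_one]
            simp [c]
    · simp only [Fin.sum_univ_three, Function.comp_apply, abs_mul, ← add_mul, ← mul_add,
        ← mul_assoc]
      refine mul_le_mul_of_nonneg_right ?_ (abs_nonneg _)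
      have e0 : √(g (lift g q).1 - (lift g q).2) = ‖q.2‖ := by simp [lift]
      have e1 : inner ℝ q.2 (1 : ℂ) = q.2.re := by simp [Complex.inner]
      have e2 : inner ℝ q.2 Complex.I = q.2.im := by simp [Complex.inner]
      simp only [depthWeight, e0, Matrix.cons_val_zero, Matrix.cons_val_one, Matrix.cons_val, e1,
        e2, abs_pow]
      have e3 : |(1 / n : ℝ)| = 1 / n := abs_of_nonneg (by positivity)
      rw [e3, abs_of_nonneg (by positivity), abs_of_nonneg (by positivity : (0:ℝ) ≤ 3)]
      refine (pow_le_pow_left₀ (by positivity) ?_ i).trans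
        (add_add_pow_le (abs_nonneg q.2.re) (abs_nonneg q.2.im) (by positivity) i)
      gcongr
      exact Complex.norm_le_abs_re_add_abs_im _
  have hw : Measurable fun q => depthWeight g n i q * MvPolynomial.eval ![q.1, q.2] f' :=
    (measurable_depthWeight hg n i).mul hmeas
  rw [eLpNorm_comp_lift hg _ hw, hP'] at key
  rw [ENNReal.coe_mul, ENNReal.coe_inv hP0, mul_assoc, mul_assoc]
  rwa [← ENNReal.mul_le_iff_le_inv (by simpa using hP0) ENNReal.coe_ne_top]

/-- First-order Taylor bound from a bound on the second derivative. -/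
lemma abs_sub_sub_derivWithin_le {g : ℝ → ℝ} {R M : ℝ} (hR : 0 < R)
    (hg : ContDiffOn ℝ 2 g (Icc (-R) R))
    (hM : ∀ x ∈ Icc (-R) R, |derivWithin (derivWithin g (Icc (-R) R)) (Icc (-R) R) x| ≤ M)
    {x s : ℝ} (hx : x ∈ Icc (-R) R) (hxs : x + s ∈ Icc (-R) R) :
    |g (x + s) - g x - s * derivWithin g (Icc (-R) R) x| ≤ M * s ^ 2 := by
  set S := Icc (-R) R with hS
  have hu : UniqueDiffOn ℝ S := uniqueDiffOn_Icc (by linarith)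
  have hM0 : 0 ≤ M := (abs_nonneg _).trans (hM x hx)
  have hd : DifferentiableOn ℝ g S := hg.differentiableOn (by norm_num)
  have hd' : DifferentiableOn ℝ (derivWithin g S) S :=
    (hg.derivWithin hu (m := 1) (by norm_num)).differentiableOn (by norm_num)
  have hsub : uIcc x (x + s) ⊆ S := (convex_Icc _ _).ordConnected.uIcc_subset hx hxs
  have h := (convex_uIcc x (x + s)).norm_image_sub_le_of_norm_hasDerivWithin_le
    (f := fun y => g y - y * derivWithin g S x)
    (f' := fun y => derivWithin g S y - 1 * derivWithin g S x) (C := M * |s|)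
    (fun y hy => ((hd y (hsub hy)).hasDerivWithinAt.mono hsub).sub
      ((hasDerivWithinAt_id y _).mul_const _)) (fun y hy => ?_) left_mem_uIcc right_mem_uIcc
  · simp only [Real.norm_eq_abs, add_sub_cancel_left] at h
    rw [mul_assoc, abs_mul_abs_self, ← sq] at h
    convert h using 2
    ring
  · rw [one_mul]
    refine ((convex_Icc (-R) R).norm_image_sub_le_of_norm_derivWithin_le hd' hM hx
      (hsub hy)).trans ?_
    refine mul_le_mul_of_nonneg_left ?_ hM0
    simpa [Real.norm_eq_abs] using abs_sub_left_of_mem_uIcc hy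

lemma tanOp2_eq (c : ℝ) (r : ℕ) (f : MvPolynomial (Fin 2) ℝ) :
    tanOp2 c r f = (dirDeriv 1 c)^[r] f := by
  have h : (fun Q => MvPolynomial.pderiv (0 : Fin 2) Q + c • MvPolynomial.pderiv (1 : Fin 2) Q) =
      dirDeriv 1 c := by
    funext Q
    rw [dirDeriv_apply, one_smul]
  rw [tanOp2, h]

/-- The tangential Bernstein inequality for measurable data satisfying a Taylor bound. -/
lemma exists_eLpNorm_tangential_vertical_le (hp : 0 < p) {l M : ℝ} (hl : 1 < l) (hl2 : l ≤ 2)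
    (hM : 1 ≤ M) (r i j : ℕ) :
    ∃ C : ℝ≥0, ∀ a : ℝ, 1 ≤ a → ∀ g g₁ : ℝ → ℝ, Measurable g → Measurable g₁ →
      (∀ x s, |x| ≤ 2 * a → |x + s| ≤ 2 * a → |g (x + s) - g x - s * g₁ x| ≤ M * s ^ 2) →
      ∀ n : ℕ, 0 < n → ∀ f : MvPolynomial (Fin 2) ℝ, f.totalDegree ≤ n →
      eLpNorm (fun q => depthWeight g n i q *
          MvPolynomial.eval ![q.1, q.2]
            (tanOp2 (g₁ q.1) r ((MvPolynomial.pderiv 1)^[i + j] f)))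
        p (volume.restrict (graphDomain g a)) ≤
      C * (n : ℝ≥0∞) ^ (r + i + 2 * j) *
        eLpNorm (fun q => MvPolynomial.eval ![q.1, q.2] f)
          p (volume.restrict (graphDomain g (l * a))) := by
  obtain ⟨l₁, h1, hl₁⟩ := exists_between hl
  obtain ⟨l₂, h2, hl₂⟩ := exists_between hl₁
  obtain ⟨C₁, hC₁⟩ := exists_eLpNorm_tangential_le hp i r hM h1 (hl₁.le.trans hl2)
  obtain ⟨C₂, hC₂⟩ := exists_eLpNorm_vertical_le hp i j h2
  obtain ⟨C₃, hC₃⟩ := exists_eLpNorm_depth_le hp i (h1.trans h2).le hl₂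
  refine ⟨C₁ * C₂ * C₃, fun a ha g g₁ hg hg₁ hT n hn f hf => ?_⟩
  have b1 := hC₁ a ha g g₁ hg hg₁ hT n hn ((MvPolynomial.pderiv 1)^[i + j] f)
    ((totalDegree_pderiv_iterate_le 1 _ f).trans hf)
  have b2 := hC₂ a ha g hg n hn ((MvPolynomial.pderiv 1)^[i] f)
    ((totalDegree_pderiv_iterate_le 1 _ f).trans hf)
  have b3 := hC₃ a ha g hg n hn f hf
  rw [← Function.iterate_add_apply, add_comm j i] at b2
  simp_rw [← tanOp2_eq, one_mul] at b1
  refine (b1.trans (mul_le_mul_right (b2.trans (mul_le_mul_right b3 _)) _)).trans (le_of_eq ?_)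
  rw [pow_add, pow_add]
  push_cast
  ring

end Assembly

end TangentialBernstein

/-- Theorem `THM:2D BERN`, Dai–Prymak.
Tangential Bernstein inequality `‖φ_n^i D^r ∂₂^{i+j} f‖_{L^p(G)} ≤ c n^{r+i+2j} ‖f‖_{L^p(G(λ))}`
on a planar domain of special type. -/
theorem statement11 (p : ℝ≥0∞) (hp : 0 < p) (lam M : ℝ) (hlam : 1 < lam ∧ lam < 2)
    (hM : 10 < M) (r i j : ℕ) :
    ∃ c : ℝ≥0, 0 < c ∧
      ∀ a : ℝ, 1 ≤ a →
      ∀ g : ℝ → ℝ, ContDiffOn ℝ 2 g (Set.Icc (-(2 * a)) (2 * a)) →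
        (∀ x ∈ Set.Icc (-(2 * a)) (2 * a), 4 * a ≤ g x) →
        (∀ x ∈ Set.Icc (-(2 * a)) (2 * a),
          |derivWithin (derivWithin g (Set.Icc (-(2 * a)) (2 * a)))
              (Set.Icc (-(2 * a)) (2 * a)) x| ≤ M) →
        |derivWithin g (Set.Icc (-(2 * a)) (2 * a)) 0| ≤ M →
      ∀ n : ℕ, 0 < n →
      ∀ P : MvPolynomial (Fin 2) ℝ, P.totalDegree ≤ n →
        eLpNorm (fun q : ℝ × ℝ =>
            (Real.sqrt (g q.1 - q.2) + 1 / n) ^ i *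
              MvPolynomial.eval ![q.1, q.2]
                (tanOp2 (derivWithin g (Set.Icc (-(2 * a)) (2 * a)) q.1) r
                  ((MvPolynomial.pderiv (1 : Fin 2))^[i + j] P)))
          p (volume.restrict
            {q : ℝ × ℝ | q.1 ∈ Set.Ioo (-a) a ∧ g q.1 - a < q.2 ∧ q.2 ≤ g q.1}) ≤
        (c : ℝ≥0∞) * (n : ℝ≥0∞) ^ (r + i + 2 * j) *
          eLpNorm (fun q : ℝ × ℝ => MvPolynomial.eval ![q.1, q.2] P)
            p (volume.restrict
              {q : ℝ × ℝ | q.1 ∈ Set.Ioo (-(lam * a)) (lam * a) ∧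
                g q.1 - lam * a < q.2 ∧ q.2 ≤ g q.1}) := by
  obtain ⟨C, hC⟩ := TangentialBernstein.exists_eLpNorm_tangential_vertical_le hp hlam.1 hlam.2.le
    (by linarith : 1 ≤ M) r i j
  refine ⟨C + 1, by positivity, fun a ha g hg _ hM' _ n hn P hP => ?_⟩
  set S := Set.Icc (-(2 * a)) (2 * a) with hS
  have hS1 : UniqueDiffOn ℝ S := uniqueDiffOn_Icc (by linarith)
  classical
  have hG {u : ℝ → ℝ} (hu : ContinuousOn u S) : Measurable (S.piecewise u 0) :=
    hu.measurable_piecewise continuousOn_const measurableSet_Icc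
  have hEq (u : ℝ → ℝ) {x : ℝ} (hx : x ∈ S) : S.piecewise u 0 x = u x :=
    Set.piecewise_eq_of_mem _ _ _ hx
  have hdom {b : ℝ} (hb : b ≤ 2 * a) :
      {q : ℝ × ℝ | q.1 ∈ Set.Ioo (-b) b ∧ g q.1 - b < q.2 ∧ q.2 ≤ g q.1} =
        TangentialBernstein.graphDomain (S.piecewise g 0) b := by
    ext q
    refine and_congr_right fun hq => ?_
    rw [hEq g ⟨by linarith [hq.1], by linarith [hq.2]⟩]
  have hmeas := hG hg.continuousOn
  have hmeas' := hG (hg.derivWithin hS1 (m := 1) (by norm_num)).continuousOn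
  have key := hC a ha (S.piecewise g 0) (S.piecewise (derivWithin g S) 0) hmeas hmeas'
    (fun x s hx hxs => ?_) n hn P hP
  · rw [hdom (by nlinarith : lam * a ≤ 2 * a), hdom (by linarith : a ≤ 2 * a)]
    refine (le_of_eq (eLpNorm_congr_ae ?_)).trans (key.trans ?_)
    · refine ae_restrict_of_forall_mem (TangentialBernstein.measurableSet_graphDomain hmeas a)
        fun q hq => ?_
      have hqS : q.1 ∈ S := ⟨by linarith [hq.1.1], by linarith [hq.1.2]⟩
      simp only [TangentialBernstein.depthWeight, hEq _ hqS]
    · gcongr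
      exact le_self_add
  · rw [hEq _ (abs_le.1 hx), hEq _ (abs_le.1 hx), hEq _ (abs_le.1 hxs)]
    exact TangentialBernstein.abs_sub_sub_derivWithin_le (by linarith) hg hM' (abs_le.1 hx)
      (abs_le.1 hxs)
end
end

section
/- Let a ≥ 1, M > 10, and let g ∈ C²([−2a,2a]) satisfy g(x) ≥ 4a on [−2a,2a], ‖g''‖_{L^∞([−2a,2a])} ≤ M and |g'(0)| ≤ M; set λ := 1 + 1/M. Let G := {(x,y) : x ∈ (−a,a), g(x) − a < y ≤ g(x)}. For a parameter A ≥ 10M² + M + 1 define Q_A(z,t) := g(z) + g'(z)t − (A/2)t², a₀ := √(2aλ/(A+M)) and a₁ := √(2a/(A−M)). Then for every (x,y) ∈ G there is exactly one pair (z,t) with z ∈ [−λa, λa], z + t ∈ [−λa, λa] and 0 ≤ t ≤ a₀ such that x = z + t and y = Q_A(z,t). Moreover this pair satisfies t ≤ a₁ (and a₁ < a₀), and the quantity u := g'(z+t) − g'(z) + At satisfies (√2 (A−M)/√(A+M)) · √(g(x) − y) ≤ u ≤ (√2 (A+M)/√(A−M)) · √(g(x) − y). -/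
open MeasureTheory ENNReal NNReal

noncomputable section

/-- the derivative of `g` on `[-2a, 2a]` -/
def gd (a : ℝ) (g : ℝ → ℝ) : ℝ → ℝ := derivWithin g (Set.Icc (-(2 * a)) (2 * a))

/-- the property that `(z,t)` represents the point `(x,y)` via `x = z + t`,
`y = Q_A(z,t) = g(z) + g'(z)t - (A/2)t²`, with `z, z+t ∈ [-λa, λa]`, `0 ≤ t ≤ a₀`,
where `λ = 1 + 1/M` and `a₀ = √(2aλ/(A+M))`. -/
def repProp (a M A : ℝ) (g : ℝ → ℝ) (x y z t : ℝ) : Prop :=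
  z ∈ Set.Icc (-((1 + 1 / M) * a)) ((1 + 1 / M) * a) ∧
  z + t ∈ Set.Icc (-((1 + 1 / M) * a)) ((1 + 1 / M) * a) ∧
  t ∈ Set.Icc 0 (Real.sqrt (2 * a * (1 + 1 / M) / (A + M))) ∧
  x = z + t ∧ y = g z + gd a g z * t - A / 2 * t ^ 2

/-- The gap between `g x` and the downward parabola of curvature `A` that is tangent to the graph
of `g` at `x - s`, evaluated at `x`; here `D` plays the role of the derivative of `g`. -/
def parabolaGap (g D : ℝ → ℝ) (A x s : ℝ) : ℝ :=
  g x - (g (x - s) + D (x - s) * s - A / 2 * s ^ 2)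

theorem hasDerivAt_parabolaGap {g D : ℝ → ℝ} {A x s d : ℝ}
    (hg : HasDerivAt g (D (x - s)) (x - s)) (hD : HasDerivAt D d (x - s)) :
    HasDerivAt (parabolaGap g D A x) ((A + d) * s) s := by
  have hsub : HasDerivAt (fun r : ℝ => x - r) (-1) s := by
    simpa using (hasDerivAt_id s).const_sub x
  have h1 : HasDerivAt (fun r => g (x - r)) (D (x - s) * (-1)) s := hg.comp s hsub
  have h2 : HasDerivAt (fun r => D (x - r)) (d * (-1)) s := hD.comp s hsub
  have h3 := h2.mul (hasDerivAt_id s)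
  have h4 := ((hasDerivAt_id s).pow 2).const_mul (A / 2)
  have h5 := ((h1.add h3).sub h4).const_sub (g x)
  refine h5.congr_deriv ?_
  simp
  ring

/-- A function whose derivative at `s ∈ [0, T]` is at least `c * s` grows at least as fast as
`c / 2 * s ^ 2` there. -/
theorem monotoneOn_sub_sq {f f' : ℝ → ℝ} {T c : ℝ}
    (hf : ∀ s ∈ Set.Icc 0 T, HasDerivAt f (f' s) s)
    (hc : ∀ s ∈ Set.Icc 0 T, c * s ≤ f' s) :
    MonotoneOn (fun s => f s - c / 2 * s ^ 2) (Set.Icc 0 T) := by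
  have hd : ∀ s ∈ Set.Icc 0 T, HasDerivAt (fun s => f s - c / 2 * s ^ 2) (f' s - c * s) s := by
    intro s hs
    refine ((hf s hs).sub (((hasDerivAt_id s).pow 2).const_mul (c / 2))).congr_deriv ?_
    simp
    ring
  refine monotoneOn_of_deriv_nonneg (convex_Icc 0 T)
    (fun s hs => (hd s hs).continuousAt.continuousWithinAt)
    (fun s hs => (hd s (interior_subset hs)).differentiableAt.differentiableWithinAt) ?_
  intro s hs
  rw [(hd s (interior_subset hs)).deriv]
  linarith [hc s (interior_subset hs)]

theorem parabolaGap_zero (g D : ℝ → ℝ) (A x : ℝ) : parabolaGap g D A x 0 = 0 := by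
  simp [parabolaGap]

section

variable {g D D2 : ℝ → ℝ} {A M x T : ℝ}

theorem monotoneOn_parabolaGap_sub
    (hg : ∀ s ∈ Set.Icc 0 T, HasDerivAt g (D (x - s)) (x - s))
    (hD : ∀ s ∈ Set.Icc 0 T, HasDerivAt D (D2 (x - s)) (x - s))
    (hM : ∀ s ∈ Set.Icc 0 T, |D2 (x - s)| ≤ M) :
    MonotoneOn (fun s => parabolaGap g D A x s - (A - M) / 2 * s ^ 2) (Set.Icc 0 T) :=
  monotoneOn_sub_sq (fun s hs => hasDerivAt_parabolaGap (hg s hs) (hD s hs)) fun s hs =>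
    mul_le_mul_of_nonneg_right (by linarith [(abs_le.1 (hM s hs)).1]) hs.1

theorem strictMonoOn_parabolaGap (hAM : M < A)
    (hg : ∀ s ∈ Set.Icc 0 T, HasDerivAt g (D (x - s)) (x - s))
    (hD : ∀ s ∈ Set.Icc 0 T, HasDerivAt D (D2 (x - s)) (x - s))
    (hM : ∀ s ∈ Set.Icc 0 T, |D2 (x - s)| ≤ M) :
    StrictMonoOn (parabolaGap g D A x) (Set.Icc 0 T) := by
  intro s hs t ht hst
  have h := monotoneOn_parabolaGap_sub (A := A) hg hD hM hs ht hst.le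
  have hsq : s ^ 2 < t ^ 2 := pow_lt_pow_left₀ hst hs.1 two_ne_zero
  have := mul_lt_mul_of_pos_left hsq (show 0 < (A - M) / 2 by linarith)
  simp only at h
  linarith

theorem le_parabolaGap
    (hg : ∀ s ∈ Set.Icc 0 T, HasDerivAt g (D (x - s)) (x - s))
    (hD : ∀ s ∈ Set.Icc 0 T, HasDerivAt D (D2 (x - s)) (x - s))
    (hM : ∀ s ∈ Set.Icc 0 T, |D2 (x - s)| ≤ M) {s : ℝ} (hs : s ∈ Set.Icc 0 T) :
    (A - M) / 2 * s ^ 2 ≤ parabolaGap g D A x s := by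
  have h := monotoneOn_parabolaGap_sub (A := A) hg hD hM
    (Set.left_mem_Icc.2 (hs.1.trans hs.2)) hs hs.1
  simp only [parabolaGap_zero] at h
  linarith

theorem parabolaGap_le
    (hg : ∀ s ∈ Set.Icc 0 T, HasDerivAt g (D (x - s)) (x - s))
    (hD : ∀ s ∈ Set.Icc 0 T, HasDerivAt D (D2 (x - s)) (x - s))
    (hM : ∀ s ∈ Set.Icc 0 T, |D2 (x - s)| ≤ M) {s : ℝ} (hs : s ∈ Set.Icc 0 T) :
    parabolaGap g D A x s ≤ (A + M) / 2 * s ^ 2 := by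
  have hmono := monotoneOn_sub_sq (c := -(A + M)) (T := T)
    (fun s hs => (hasDerivAt_parabolaGap (A := A) (hg s hs) (hD s hs)).fun_neg) fun s hs => by
      have := mul_le_mul_of_nonneg_right (le_of_abs_le (hM s hs)) hs.1
      linarith
  have h := hmono (Set.left_mem_Icc.2 (hs.1.trans hs.2)) hs hs.1
  simp only [parabolaGap_zero] at h
  linarith

theorem abs_sub_le_mul_of_hasDerivAt
    (hD : ∀ s ∈ Set.Icc 0 T, HasDerivAt D (D2 (x - s)) (x - s))
    (hM : ∀ s ∈ Set.Icc 0 T, |D2 (x - s)| ≤ M) {s : ℝ} (hs : s ∈ Set.Icc 0 T) :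
    |D x - D (x - s)| ≤ M * s := by
  have hsub : ∀ y ∈ Set.Icc (x - T) x, x - y ∈ Set.Icc 0 T := fun y hy =>
    ⟨by linarith [hy.2], by linarith [hy.1]⟩
  have h := (convex_Icc (x - T) x).norm_image_sub_le_of_norm_hasDerivWithin_le
    (f := D) (f' := D2) (C := M) (x := x - s) (y := x)
    (fun y hy => by simpa using (hD _ (hsub y hy)).hasDerivWithinAt)
    (fun y hy => by simpa using hM _ (hsub y hy))
    ⟨by linarith [hs.2], by linarith [hs.1]⟩ ⟨by linarith [hs.1, hs.2], le_rfl⟩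
  simpa [abs_of_nonneg hs.1] using h

end

theorem le_sqrt_div_of_mul_sq_le {c t r : ℝ} (hc : 0 < c) (h : c / 2 * t ^ 2 ≤ r) :
    t ≤ √(2 * r / c) := by
  refine Real.le_sqrt_of_sq_le ?_
  rw [le_div_iff₀ hc]
  linarith

theorem sqrt_div_le_of_le_mul_sq {c t r : ℝ} (hc : 0 < c) (ht : 0 ≤ t)
    (h : r ≤ c / 2 * t ^ 2) : √(2 * r / c) ≤ t := by
  refine Real.sqrt_le_iff.2 ⟨ht, ?_⟩
  rw [div_le_iff₀ hc]
  linarith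

theorem sqrt_two_mul_div_mul_sqrt {c : ℝ} (r : ℝ) (hc : 0 < c) (b : ℝ) :
    √2 * b / √c * √r = b * √(2 * r / c) := by
  rw [Real.sqrt_div' _ hc.le, Real.sqrt_mul zero_le_two]
  ring

theorem hasDerivAt_gd {a : ℝ} {g : ℝ → ℝ}
    (hg : ContDiffOn ℝ 2 g (Set.Icc (-(2 * a)) (2 * a))) {z : ℝ}
    (hz : z ∈ Set.Ioo (-(2 * a)) (2 * a)) : HasDerivAt g (gd a g z) z :=
  ((hg.differentiableOn two_ne_zero) z (Set.Ioo_subset_Icc_self hz)).hasDerivWithinAt.hasDerivAt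
    (Icc_mem_nhds hz.1 hz.2)

theorem hasDerivAt_derivWithin_gd {a : ℝ} {g : ℝ → ℝ}
    (hg : ContDiffOn ℝ 2 g (Set.Icc (-(2 * a)) (2 * a))) {z : ℝ}
    (hz : z ∈ Set.Ioo (-(2 * a)) (2 * a)) :
    HasDerivAt (gd a g) (derivWithin (gd a g) (Set.Icc (-(2 * a)) (2 * a)) z) z := by
  have h : ContDiffOn ℝ 1 (gd a g) (Set.Icc (-(2 * a)) (2 * a)) :=
    hg.derivWithin (uniqueDiffOn_Icc (hz.1.trans hz.2)) (by norm_num)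
  exact ((h.differentiableOn one_ne_zero) z
    (Set.Ioo_subset_Icc_self hz)).hasDerivWithinAt.hasDerivAt (Icc_mem_nhds hz.1 hz.2)

/-- Lemma `lem-1-1:Berns` (iii)&(iv), Dai–Prymak.
Every point of the special planar domain `G` has a unique representation
`(x,y) = (z+t, Q_A(z,t))` with `0 ≤ t ≤ a₀`; moreover `t ≤ a₁ < a₀` and
`u = g'(z+t) - g'(z) + At` is comparable to `√(g(x)-y)`. -/
theorem statement12 (a M A : ℝ) (ha : 1 ≤ a) (hM : 10 < M)
    (g : ℝ → ℝ) (hg : ContDiffOn ℝ 2 g (Set.Icc (-(2 * a)) (2 * a)))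
    (hg4 : ∀ x ∈ Set.Icc (-(2 * a)) (2 * a), 4 * a ≤ g x)
    (hg'' : ∀ x ∈ Set.Icc (-(2 * a)) (2 * a),
      |derivWithin (gd a g) (Set.Icc (-(2 * a)) (2 * a)) x| ≤ M)
    (hg'0 : |gd a g 0| ≤ M)
    (hA : 10 * M ^ 2 + M + 1 ≤ A) :
    Real.sqrt (2 * a / (A - M)) < Real.sqrt (2 * a * (1 + 1 / M) / (A + M)) ∧
    ∀ x y : ℝ, x ∈ Set.Ioo (-a) a → g x - a < y → y ≤ g x →
      ∃ z t : ℝ, repProp a M A g x y z t ∧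
        (∀ z' t' : ℝ, repProp a M A g x y z' t' → z' = z ∧ t' = t) ∧
        t ≤ Real.sqrt (2 * a / (A - M)) ∧
        Real.sqrt 2 * (A - M) / Real.sqrt (A + M) * Real.sqrt (g x - y) ≤
          gd a g (z + t) - gd a g z + A * t ∧
        gd a g (z + t) - gd a g z + A * t ≤
          Real.sqrt 2 * (A + M) / Real.sqrt (A - M) * Real.sqrt (g x - y) := by
  have hM0 : 0 < M := by linarith
  have hAM : 0 < A - M := by nlinarith
  have hAM' : 0 < A + M := by linarith
  have hlt : √(2 * a / (A - M)) < √(2 * a * (1 + 1 / M) / (A + M)) := by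
    refine Real.sqrt_lt_sqrt (by positivity) ?_
    have hfrac : 1 + 1 / M = (M + 1) / M := by field_simp
    rw [hfrac, mul_div_assoc', div_div, div_lt_div_iff₀ hAM (by positivity)]
    have hlt' : M * (A + M) < (M + 1) * (A - M) := by nlinarith
    linarith [mul_lt_mul_of_pos_left hlt' (show 0 < 2 * a by linarith)]
  refine ⟨hlt, fun x y hx hy hyx => ?_⟩
  set T := x + (1 + 1 / M) * a with hT
  have hMa : (1 + 1 / M) * a = a + a / M := by ring
  have haM : a / M < a := div_lt_self (by linarith) (by linarith)
  have haM0 : 0 < a / M := by positivity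
  have hmem : ∀ s ∈ Set.Icc 0 T, x - s ∈ Set.Ioo (-(2 * a)) (2 * a) := fun s hs =>
    ⟨by linarith [hs.2], by linarith [hs.1, hx.2]⟩
  have hg1 : ∀ s ∈ Set.Icc 0 T, HasDerivAt g (gd a g (x - s)) (x - s) := fun s hs =>
    hasDerivAt_gd hg (hmem s hs)
  have hg2 := fun s (hs : s ∈ Set.Icc 0 T) => hasDerivAt_derivWithin_gd hg (hmem s hs)
  have hgM := fun s (hs : s ∈ Set.Icc 0 T) => hg'' _ (Set.Ioo_subset_Icc_self (hmem s hs))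
  have ha₁ : √(2 * a / (A - M)) ≤ a / M := by
    refine Real.sqrt_le_iff.2 ⟨haM0.le, ?_⟩
    rw [div_pow, div_le_div_iff₀ hAM (by positivity)]
    nlinarith [mul_nonneg (sub_nonneg.2 ha) hAM.le, mul_nonneg (by linarith : (0:ℝ) ≤ a)
      (mul_nonneg (sub_nonneg.2 ha) hAM.le), sq_nonneg M, mul_nonneg (by linarith : (0:ℝ) ≤ a)
      (by nlinarith : 0 ≤ A - M - 2 * M ^ 2)]
  have ha₁T : √(2 * a / (A - M)) ∈ Set.Icc 0 T :=
    ⟨Real.sqrt_nonneg _, by linarith [hx.1]⟩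
  have htop : a ≤ parabolaGap g (gd a g) A x √(2 * a / (A - M)) := by
    have h := le_parabolaGap (A := A) hg1 hg2 hgM ha₁T
    rw [Real.sq_sqrt (by positivity)] at h
    convert h using 1
    field_simp
  obtain ⟨t, ht, hty⟩ := intermediate_value_Icc ha₁T.1
    (fun s hs => (hasDerivAt_parabolaGap (A := A) (hg1 s ⟨hs.1, hs.2.trans ha₁T.2⟩)
      (hg2 s ⟨hs.1, hs.2.trans ha₁T.2⟩)).continuousAt.continuousWithinAt)
    (show g x - y ∈ Set.Icc _ _ from
      ⟨by rw [parabolaGap_zero]; linarith, by linarith⟩)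
  have htT : t ∈ Set.Icc 0 T := ⟨ht.1, ht.2.trans ha₁T.2⟩
  have hgap : y = g (x - t) + gd a g (x - t) * t - A / 2 * t ^ 2 := by
    unfold parabolaGap at hty
    linarith
  have hu := abs_le.1 (abs_sub_le_mul_of_hasDerivAt hg2 hgM htT)
  have hlow := le_parabolaGap (A := A) hg1 hg2 hgM htT
  have hupp := parabolaGap_le (A := A) hg1 hg2 hgM htT
  rw [hty] at hlow hupp
  refine ⟨x - t, t, ⟨⟨by linarith [htT.2], by linarith [ht.1, hx.2]⟩, ?_,
    ⟨ht.1, ht.2.trans hlt.le⟩, by ring, hgap⟩, ?_, ht.2, ?_, ?_⟩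
  · rw [sub_add_cancel]
    exact ⟨by linarith [hx.1], by linarith [hx.2]⟩
  · rintro z' t' ⟨hz', -, ht', hx', hy'⟩
    obtain rfl : z' = x - t' := by linarith
    have heq : t' = t := by
      refine (strictMonoOn_parabolaGap (A := A) (sub_pos.1 hAM) hg1 hg2 hgM).injOn
        ⟨ht'.1, by linarith [hz'.1]⟩ htT ?_
      rw [hty, parabolaGap, ← hy']
    exact ⟨by rw [heq], heq⟩
  · rw [sqrt_two_mul_div_mul_sqrt _ hAM', sub_add_cancel]
    have := mul_le_mul_of_nonneg_left (sqrt_div_le_of_le_mul_sq hAM' ht.1 hupp) hAM.le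
    linarith [hu.1]
  · rw [sqrt_two_mul_div_mul_sqrt _ hAM, sub_add_cancel]
    have := mul_le_mul_of_nonneg_left (le_sqrt_div_of_mul_sq_le hAM hlow) hAM'.le
    linarith [hu.2]
end
end

section
/- Given 0 < p ≤ ∞ and r ∈ ℕ, there exist constants C(p, r) > 0 and s₁ = s₁(p, r) > 0 depending only on p and r with the following property: for every α > 0 and every positive integer N, setting α_j := 2α sin²(jπ/(2N)) for 0 ≤ j ≤ N, for all integers 0 ≤ j, k ≤ N/2 and every univariate algebraic polynomial P of degree ≤ r, ‖P‖_{L^p([α_j, α_{j+1}])} ≤ C(p, r) · (1 + |j − k|)^{s₁} · ‖P‖_{L^p([α_k, α_{k+1}])}. -/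
open MeasureTheory ENNReal NNReal

noncomputable section

/-- Chebyshev partition points `α_j = 2α sin²(jπ/(2N))` -/
def chebPt (α : ℝ) (N j : ℕ) : ℝ := 2 * α * Real.sin (j * Real.pi / (2 * N)) ^ 2

/-- The coefficients of a polynomial of degree at most `r` are controlled by its largest value
at `r + 1` given distinct points. -/
theorem exists_coeff_le_abs_sum_node (r : ℕ) (x : Fin (r + 1) → ℝ) (hx : Function.Injective x) :
    ∃ K : ℝ, 0 < K ∧ ∀ v : Fin (r + 1) → ℝ,
      ∃ i, ∀ m, |v m| ≤ K * |∑ n, v n * x i ^ (n : ℕ)| := by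
  set L : (Fin (r + 1) → ℝ) →ₗ[ℝ] (Fin (r + 1) → ℝ) := (Matrix.vandermonde x).mulVecLin
  have hL : LinearMap.ker L = ⊥ := by
    rw [LinearMap.ker_eq_bot]
    apply Matrix.mulVec_injective_of_isUnit
    rw [Matrix.isUnit_iff_isUnit_det, isUnit_iff_ne_zero]
    exact Matrix.det_vandermonde_ne_zero_iff.2 hx
  obtain ⟨K, hK, hanti⟩ := L.exists_antilipschitzWith hL
  refine ⟨K, by exact_mod_cast hK, fun v => ?_⟩
  obtain ⟨i, hi⟩ := exists_eq_ciSup_of_finite (f := fun i => ‖L v i‖)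
  have hnorm : ‖L v‖ ≤ ‖L v i‖ :=
    (pi_norm_le_iff_of_nonneg (norm_nonneg _)).2 fun m => by
      rw [hi]
      exact le_ciSup (f := fun i => ‖L v i‖) (Set.finite_range _).bddAbove m
  have hsum : L v i = ∑ n, v n * x i ^ (n : ℕ) := by
    simp [L, Matrix.mulVec, dotProduct, Matrix.vandermonde_apply, mul_comm]
  refine ⟨i, fun m => ?_⟩
  have hv : ‖v‖ ≤ K * ‖L v‖ := by simpa using hanti.le_mul_dist v 0
  calc |v m| = ‖v m‖ := rfl
    _ ≤ ‖v‖ := norm_le_pi_norm v m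
    _ ≤ K * ‖L v‖ := hv
    _ ≤ K * ‖L v i‖ := by gcongr
    _ = _ := by rw [hsum, Real.norm_eq_abs]

/-- On a fixed proportion of the unit interval, a polynomial of degree at most `r` is comparable
to the bound for its growth away from that interval. -/
theorem Polynomial.exists_large_on_subinterval_unit (r : ℕ) :
    ∃ K : ℝ, 1 ≤ K ∧ ∀ Q : Polynomial ℝ, Q.natDegree ≤ r →
      ∃ S x : ℝ, 0 ≤ S ∧ 0 ≤ x ∧ x + 1 / K ≤ 1 ∧
        (∀ u ∈ Set.Icc x (x + 1 / K), S ≤ |Q.eval u|) ∧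
        ∀ M u : ℝ, 1 ≤ M → |u| ≤ M → |Q.eval u| ≤ K * M ^ r * S := by
  set node : Fin (r + 1) → ℝ := fun i => (i : ℕ) / (2 * ((r : ℝ) + 1))
  have hnode_inj : Function.Injective node := by
    intro i j hij
    have : ((i : ℕ) : ℝ) = (j : ℕ) := by
      simp only [node] at hij
      field_simp at hij
      exact hij
    exact Fin.ext (by exact_mod_cast this)
  obtain ⟨K, hK, hcoeff⟩ := exists_coeff_le_abs_sum_node r node hnode_inj
  set K' : ℝ := 2 * ((r : ℝ) + 1) ^ 2 * (K + 1)
  have hr : (0 : ℝ) ≤ r := Nat.cast_nonneg r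
  have hK2 : 2 ≤ K' := by
    have : 1 ≤ ((r : ℝ) + 1) ^ 2 := by nlinarith
    simp only [K']
    nlinarith
  refine ⟨K', by linarith, fun Q hQ => ?_⟩
  have heval (u : ℝ) : Q.eval u = ∑ n : Fin (r + 1), Q.coeff n * u ^ (n : ℕ) := by
    rw [Polynomial.eval_eq_sum_range' (Nat.lt_succ_of_le hQ), Finset.sum_range]
  obtain ⟨i, hi⟩ := hcoeff fun n => Q.coeff n
  simp only [← heval] at hi
  set x := node i
  set T := |Q.eval x|
  have hT : 0 ≤ T := abs_nonneg _
  have hx0 : 0 ≤ x := by simp only [x, node]; positivity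
  have hx2 : x ≤ 1 / 2 := by
    have : ((i : ℕ) : ℝ) ≤ r := by exact_mod_cast Nat.lt_succ_iff.1 i.2
    simp only [x, node]
    rw [div_le_div_iff₀ (by positivity) (by norm_num)]
    linarith
  have hKinv : 1 / K' ≤ 1 / 2 := one_div_le_one_div_of_le (by norm_num) hK2
  refine ⟨T / 2, x, by positivity, hx0, by linarith, fun u hu => ?_, fun M u hM hu => ?_⟩
  · have hu0 : 0 ≤ u := hx0.trans hu.1
    have hu1 : u ≤ 1 := by linarith [hu.2]
    have hux : |u - x| ≤ 1 / K' := by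
      rw [abs_of_nonneg (by linarith [hu.1])]; linarith [hu.2]
    have hdiff : |Q.eval u - Q.eval x| ≤ T / 2 := by
      have hpow (n : Fin (r + 1)) : |u ^ (n : ℕ) - x ^ (n : ℕ)| ≤ (1 / K') * (r + 1) := by
        refine (abs_pow_sub_pow_le u x n).trans ?_
        have h1 : ((n : ℕ) : ℝ) ≤ r + 1 := by exact_mod_cast n.2.le
        have h2 : max |u| |x| ^ ((n : ℕ) - 1) ≤ 1 := by
          apply pow_le_one₀ (le_max_of_le_left (abs_nonneg u))
          rw [abs_of_nonneg hu0, abs_of_nonneg hx0]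
          exact max_le hu1 (by linarith)
        calc _ ≤ (1 / K') * (r + 1) * 1 := by gcongr
          _ = _ := mul_one _
      calc |Q.eval u - Q.eval x|
          = |∑ n : Fin (r + 1), Q.coeff n * (u ^ (n : ℕ) - x ^ (n : ℕ))| := by
            simp only [heval, mul_sub, Finset.sum_sub_distrib]
        _ ≤ ∑ n : Fin (r + 1), |Q.coeff n * (u ^ (n : ℕ) - x ^ (n : ℕ))| :=
            Finset.abs_sum_le_sum_abs _ _
        _ ≤ ∑ _n : Fin (r + 1), K * T * ((1 / K') * (r + 1)) := by
            gcongr with n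
            rw [abs_mul]
            gcongr
            · exact hi n
            · exact hpow n
        _ = (K / (K + 1)) * (T / 2) := by
            simp only [Finset.sum_const, Finset.card_univ, Fintype.card_fin, nsmul_eq_mul, K']
            push_cast
            field_simp
        _ ≤ 1 * (T / 2) := by
            gcongr
            rw [div_le_one (by positivity)]
            linarith
        _ = T / 2 := one_mul _
    have := abs_sub_abs_le_abs_sub (Q.eval x) (Q.eval u)
    rw [abs_sub_comm] at this
    linarith
  · calc |Q.eval u| ≤ ∑ n : Fin (r + 1), |Q.coeff n * u ^ (n : ℕ)| := by
          rw [heval]; exact Finset.abs_sum_le_sum_abs _ _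
      _ ≤ ∑ _n : Fin (r + 1), K * T * M ^ r := by
          gcongr with n
          rw [abs_mul, abs_pow]
          gcongr
          · exact hi n
          · exact (pow_le_pow_left₀ (abs_nonneg u) hu n).trans
              (pow_le_pow_right₀ hM (Nat.lt_succ_iff.1 n.2))
      _ = ((r + 1) * K) * M ^ r * T := by
          simp only [Finset.sum_const, Finset.card_univ, Fintype.card_fin, nsmul_eq_mul]
          push_cast
          ring
      _ ≤ (K' / 2) * M ^ r * T := by
          gcongr
          simp only [K']
          nlinarith [mul_nonneg hr hK.le, mul_nonneg (mul_nonneg hr hr) hK.le]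
      _ = K' * M ^ r * (T / 2) := by ring

/-- Rescaled form of `Polynomial.exists_large_on_subinterval_unit`. -/
theorem Polynomial.exists_large_on_subinterval (r : ℕ) :
    ∃ K : ℝ, 1 ≤ K ∧ ∀ a h : ℝ, 0 < h → ∀ P : Polynomial ℝ, P.natDegree ≤ r →
      ∃ S b : ℝ, 0 ≤ S ∧ a ≤ b ∧ b + h / K ≤ a + h ∧
        (∀ t ∈ Set.Icc b (b + h / K), S ≤ |P.eval t|) ∧
        ∀ M t : ℝ, 1 ≤ M → |t - a| ≤ M * h → |P.eval t| ≤ K * M ^ r * S := by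
  obtain ⟨K, hK, H⟩ := Polynomial.exists_large_on_subinterval_unit r
  refine ⟨K, hK, fun a h hh P hP => ?_⟩
  set Q : Polynomial ℝ := P.comp (Polynomial.C a + Polynomial.C h * Polynomial.X)
  have hdeg : Q.natDegree ≤ r := by
    refine Polynomial.natDegree_comp_le.trans ?_
    have : (Polynomial.C a + Polynomial.C h * Polynomial.X).natDegree ≤ 1 := by compute_degree
    calc _ ≤ P.natDegree * 1 := Nat.mul_le_mul_left _ this
      _ ≤ r := by omega
  have hQ (t : ℝ) : Q.eval ((t - a) / h) = P.eval t := by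
    simp only [Q, Polynomial.eval_comp, Polynomial.eval_add, Polynomial.eval_mul,
      Polynomial.eval_C, Polynomial.eval_X]
    congr 1
    field_simp
    ring
  obtain ⟨S, x, hS, hx, hx1, hlow, hup⟩ := H Q hdeg
  refine ⟨S, a + h * x, hS, ?_, ?_, fun t ht => ?_, fun M t hM ht => ?_⟩
  · nlinarith
  · have := mul_le_mul_of_nonneg_left hx1 hh.le
    rw [mul_add, mul_one_div] at this
    linarith
  · rw [← hQ]
    apply hlow
    constructor
    · rw [le_div_iff₀ hh]; linarith [ht.1]
    · rw [div_le_iff₀ hh, add_mul, one_div_mul_eq_div]; linarith [ht.2]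
  · rw [← hQ]
    apply hup M _ hM
    rwa [abs_div, abs_of_pos hh, div_le_iff₀ hh]

theorem ofReal_mul_le_eLpNorm_of_le_on {p : ℝ≥0∞} (hp : p ≠ 0) {f : ℝ → ℝ} {a c b ℓ S : ℝ}
    (hℓ : 0 < ℓ) (hS : 0 ≤ S) (hab : a ≤ b) (hbc : b + ℓ ≤ c)
    (hf : ∀ t ∈ Set.Icc b (b + ℓ), S ≤ |f t|) :
    ENNReal.ofReal (S * ℓ ^ (1 / p.toReal)) ≤ eLpNorm f p (volume.restrict (Set.Icc a c)) := by
  have hvol : volume.restrict (Set.Icc a c) (Set.Icc b (b + ℓ)) = ENNReal.ofReal ℓ := by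
    rw [Measure.restrict_apply measurableSet_Icc,
      Set.inter_eq_self_of_subset_left (Set.Icc_subset_Icc hab hbc), Real.volume_Icc]
    simp
  calc ENNReal.ofReal (S * ℓ ^ (1 / p.toReal))
      = eLpNorm ((Set.Icc b (b + ℓ)).indicator fun _ => S) p
          (volume.restrict (Set.Icc a c)) := by
        rw [eLpNorm_indicator_const' measurableSet_Icc (by rw [hvol]; simpa using hℓ) hp, hvol,
          ENNReal.ofReal_mul hS, ENNReal.ofReal_rpow_of_pos hℓ, Real.enorm_of_nonneg hS]
    _ ≤ _ := by
        apply eLpNorm_mono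
        intro t
        by_cases ht : t ∈ Set.Icc b (b + ℓ)
        · simpa [ht, abs_of_nonneg hS] using hf t ht
        · simp [ht]

theorem eLpNorm_le_ofReal_of_abs_le_on {p : ℝ≥0∞} {f : ℝ → ℝ} {a c S : ℝ} (hac : a ≤ c)
    (hS : 0 ≤ S) (hf : ∀ t ∈ Set.Icc a c, |f t| ≤ S) :
    eLpNorm f p (volume.restrict (Set.Icc a c)) ≤
      ENNReal.ofReal (S * (c - a) ^ (1 / p.toReal)) := by
  refine (eLpNorm_le_of_ae_bound (C := S)
    ((ae_restrict_iff' measurableSet_Icc).2 (Filter.Eventually.of_forall hf))).trans ?_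
  rw [Measure.restrict_apply_univ, Real.volume_Icc, mul_comm, ENNReal.ofReal_mul hS, one_div,
    ENNReal.ofReal_rpow_of_nonneg (sub_nonneg.2 hac) (by positivity)]

theorem chebPt_sub (α : ℝ) (N m k : ℕ) :
    chebPt α N m - chebPt α N k =
      2 * α * (Real.sin ((m + k) * (Real.pi / (2 * N))) *
        Real.sin ((m - k) * (Real.pi / (2 * N)))) := by
  have key (x y : ℝ) :
      Real.sin x ^ 2 - Real.sin y ^ 2 = Real.sin (x + y) * Real.sin (x - y) := by
    rw [Real.sin_add, Real.sin_sub]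
    nlinarith [Real.sin_sq_add_cos_sq x, Real.sin_sq_add_cos_sq y]
  rw [chebPt, chebPt, ← mul_sub, key, add_mul, sub_mul, mul_div_assoc, mul_div_assoc]

theorem abs_chebPt_sub_le {α : ℝ} (hα : 0 < α) (N m k : ℕ) :
    |chebPt α N m - chebPt α N k| ≤
      2 * α * (Real.pi / (2 * N)) ^ 2 * ((m + k) * |(m : ℝ) - k|) := by
  have hδ : 0 ≤ Real.pi / (2 * N) := by positivity
  rw [chebPt_sub, abs_mul (2 * α), abs_mul (Real.sin _), abs_of_pos (by positivity : 0 < 2 * α)]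
  have h1 : |Real.sin ((m + k) * (Real.pi / (2 * N)))| ≤ (m + k) * (Real.pi / (2 * N)) := by
    refine Real.abs_sin_le_abs.trans_eq (abs_of_nonneg (by positivity))
  have h2 : |Real.sin ((m - k) * (Real.pi / (2 * N)))| ≤ |(m : ℝ) - k| * (Real.pi / (2 * N)) := by
    refine Real.abs_sin_le_abs.trans_eq ?_
    rw [abs_mul, abs_of_nonneg hδ]
  calc _ ≤ 2 * α * (((m + k) * (Real.pi / (2 * N))) * (|(m : ℝ) - k| * (Real.pi / (2 * N)))) := by
        gcongr
    _ = _ := by ring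

theorem chebPt_succ_sub_ge {α : ℝ} (hα : 0 < α) {N k : ℕ} (hN : 0 < N) (hk : 2 * k ≤ N) :
    2 * α * (Real.pi / (2 * N)) ^ 2 * (2 * k + 1) ≤
      8 * (chebPt α N (k + 1) - chebPt α N k) := by
  have hπ := Real.pi_pos
  have hN' : (0 : ℝ) < N := by exact_mod_cast hN
  set δ := Real.pi / (2 * N)
  have hδ : 0 < δ := by positivity
  have hδN : δ * (2 * N) = Real.pi := by simp only [δ]; field_simp
  have hδ1 : δ ≤ Real.pi / 2 := by
    have : (1 : ℝ) ≤ N := by exact_mod_cast hN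
    nlinarith
  have hx : ((2 * k + 1 : ℝ)) * δ ≤ 3 * Real.pi / 4 := by
    have : (4 * k + 2 : ℝ) ≤ 3 * N := by
      have : 4 * k + 2 ≤ 3 * N := by omega
      exact_mod_cast this
    nlinarith
  have hs1 : 2 / Real.pi * δ ≤ Real.sin δ := Real.mul_le_sin hδ.le hδ1
  have hs2 : 2 / Real.pi * (((2 * k + 1 : ℝ)) * δ / 3) ≤ Real.sin ((2 * k + 1 : ℝ) * δ) := by
    rcases le_total ((2 * k + 1 : ℝ) * δ) (Real.pi / 2) with h | h
    · refine le_trans ?_ (Real.mul_le_sin (by positivity) h)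
      have : 0 ≤ (2 * k + 1 : ℝ) * δ := by positivity
      gcongr
      linarith
    · rw [← Real.sin_pi_sub]
      refine le_trans ?_ (Real.mul_le_sin (by linarith) (by linarith))
      gcongr
      linarith
  have hsub : chebPt α N (k + 1) - chebPt α N k =
      2 * α * (Real.sin ((2 * k + 1 : ℝ) * δ) * Real.sin δ) := by
    have hsum : ((k + 1 : ℕ) + k : ℝ) = 2 * k + 1 := by push_cast; ring
    have hdiff : ((k + 1 : ℕ) - k : ℝ) = 1 := by push_cast; ring
    rw [chebPt_sub, hsum, hdiff, one_mul]
  rw [hsub]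
  have hπ2 : Real.pi ^ 2 ≤ 32 / 3 := by nlinarith [Real.pi_lt_d2]
  calc 2 * α * δ ^ 2 * (2 * k + 1)
      ≤ 2 * α * δ ^ 2 * (2 * k + 1) * (32 / 3 / Real.pi ^ 2) := by
        apply le_mul_of_one_le_right (by positivity)
        rwa [one_le_div (by positivity)]
    _ = 8 * (2 * α * ((2 / Real.pi * (((2 * k + 1 : ℝ)) * δ / 3)) * (2 / Real.pi * δ))) := by
        field_simp
        norm_num
    _ ≤ _ := by
        have : 0 ≤ Real.sin ((2 * k + 1 : ℝ) * δ) := le_trans (by positivity) hs2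
        gcongr

/-- The distance between partition points grows at most quadratically in the index, measured in
units of a nearby cell. -/
theorem abs_chebPt_sub_le_mul_cell {α : ℝ} (hα : 0 < α) {N k : ℕ} (hN : 0 < N) (hk : 2 * k ≤ N)
    (m : ℕ) :
    |chebPt α N m - chebPt α N k| ≤
      8 * ((1 + |(m : ℝ) - k|) * |(m : ℝ) - k|) * (chebPt α N (k + 1) - chebPt α N k) := by
  have hd := abs_nonneg ((m : ℝ) - k)
  have hmk : (m + k : ℝ) ≤ (1 + |(m : ℝ) - k|) * (2 * k + 1) := by
    have hkd : 0 ≤ (k : ℝ) * |(m : ℝ) - k| := by positivity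
    nlinarith [le_abs_self ((m : ℝ) - k)]
  calc _ ≤ 2 * α * (Real.pi / (2 * N)) ^ 2 * ((m + k) * |(m : ℝ) - k|) :=
        abs_chebPt_sub_le hα N m k
    _ ≤ 2 * α * (Real.pi / (2 * N)) ^ 2 *
          ((1 + |(m : ℝ) - k|) * (2 * k + 1) * |(m : ℝ) - k|) := by gcongr
    _ = (2 * α * (Real.pi / (2 * N)) ^ 2 * (2 * k + 1)) *
          ((1 + |(m : ℝ) - k|) * |(m : ℝ) - k|) := by ring
    _ ≤ 8 * (chebPt α N (k + 1) - chebPt α N k) * ((1 + |(m : ℝ) - k|) * |(m : ℝ) - k|) :=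
        mul_le_mul_of_nonneg_right (chebPt_succ_sub_ge hα hN hk) (by positivity)
    _ = _ := by ring

theorem chebPt_lt_succ {α : ℝ} (hα : 0 < α) {N k : ℕ} (hN : 0 < N) (hk : 2 * k ≤ N) :
    chebPt α N k < chebPt α N (k + 1) := by
  have hN' : (0 : ℝ) < N := by exact_mod_cast hN
  have hpos : 0 < 2 * α * (Real.pi / (2 * N)) ^ 2 * (2 * k + 1) := by positivity
  linarith [chebPt_succ_sub_ge hα hN hk]

/-- Every point of the `j`-th cell is close to the `k`-th one. -/
theorem abs_sub_chebPt_le_of_mem_cell {α : ℝ} (hα : 0 < α) {N j k : ℕ} (hN : 0 < N)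
    (hk : 2 * k ≤ N) {t : ℝ}
    (ht : t ∈ Set.Icc (chebPt α N j) (chebPt α N (j + 1))) :
    |t - chebPt α N k| ≤
      16 * (1 + |(j : ℝ) - k|) ^ 2 * (chebPt α N (k + 1) - chebPt α N k) := by
  have hcell := sub_pos.2 (chebPt_lt_succ hα hN hk)
  have hd := abs_nonneg ((j : ℝ) - k)
  have hend {m : ℕ} (hm : |(m : ℝ) - k| ≤ 1 + |(j : ℝ) - k|) : |chebPt α N m - chebPt α N k| ≤
      16 * (1 + |(j : ℝ) - k|) ^ 2 * (chebPt α N (k + 1) - chebPt α N k) := by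
    refine (abs_chebPt_sub_le_mul_cell hα hN hk m).trans ?_
    refine mul_le_mul_of_nonneg_right ?_ hcell.le
    have hm0 := abs_nonneg ((m : ℝ) - k)
    nlinarith
  have h0 := abs_le.1 (hend (m := j) (by linarith))
  have h1 := abs_le.1 (hend (m := j + 1) (by
    push_cast
    calc |(j : ℝ) + 1 - k| = |1 + ((j : ℝ) - k)| := by ring_nf
      _ ≤ |(1 : ℝ)| + |(j : ℝ) - k| := abs_add_le _ _
      _ = _ := by rw [abs_one]))
  exact abs_le.2 ⟨by linarith [ht.1], by linarith [ht.2]⟩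

/-- Lemma `lem-5-1`, Dai–Prymak.
Doubling-type comparison of `L^p` norms of a fixed low-degree polynomial on different
cells of the Chebyshev partition of `[0, 2α]`. -/
theorem statement13 (p : ℝ≥0∞) (hp : 0 < p) (r : ℕ) :
    ∃ C s₁ : ℝ, 0 < C ∧ 0 < s₁ ∧
      ∀ α : ℝ, 0 < α → ∀ N : ℕ, 0 < N →
      ∀ j k : ℕ, 2 * j ≤ N → 2 * k ≤ N →
      ∀ P : Polynomial ℝ, P.natDegree ≤ r →
        eLpNorm (fun t => P.eval t) p
            (volume.restrict (Set.Icc (chebPt α N j) (chebPt α N (j + 1)))) ≤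
          ENNReal.ofReal (C * (1 + |(j : ℝ) - (k : ℝ)|) ^ s₁) *
            eLpNorm (fun t => P.eval t) p
              (volume.restrict (Set.Icc (chebPt α N k) (chebPt α N (k + 1)))) := by
  obtain ⟨K, hK, H⟩ := Polynomial.exists_large_on_subinterval r
  set q : ℝ := 1 / p.toReal
  have hq : 0 ≤ q := by positivity
  have hK0 : 0 < K := by linarith
  refine ⟨K * 16 ^ r * (32 * K) ^ q, 2 * r + 2 * q + 1, by positivity, by positivity, ?_⟩
  intro α hα N hN j k hj hk P hP
  set D : ℝ := 1 + |(j : ℝ) - (k : ℝ)|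
  have hD : 1 ≤ D := by simp only [D]; linarith [abs_nonneg ((j : ℝ) - (k : ℝ))]
  have hD0 : 0 < D := by linarith
  set h := chebPt α N (k + 1) - chebPt α N k
  have hh : 0 < h := sub_pos.2 (chebPt_lt_succ hα hN hk)
  have hjj := (chebPt_lt_succ hα hN hj).le
  have hdist (t : ℝ) (ht : t ∈ Set.Icc (chebPt α N j) (chebPt α N (j + 1))) :
      |t - chebPt α N k| ≤ 16 * D ^ 2 * h := abs_sub_chebPt_le_of_mem_cell hα hN hk ht
  have hlen : chebPt α N (j + 1) - chebPt α N j ≤ 32 * D ^ 2 * h := by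
    have h0 := abs_le.1 (hdist _ (Set.left_mem_Icc.2 hjj))
    have h1 := abs_le.1 (hdist _ (Set.right_mem_Icc.2 hjj))
    linarith
  obtain ⟨S, b, hS, hab, hb, hlow, hup⟩ := H (chebPt α N k) h hh P hP
  have hlower := ofReal_mul_le_eLpNorm_of_le_on (c := chebPt α N (k + 1)) hp.ne'
    (by positivity) hS hab (by simpa [h] using hb) hlow
  have hupper := eLpNorm_le_ofReal_of_abs_le_on (p := p) hjj (by positivity)
    fun t ht => hup (16 * D ^ 2) t (by nlinarith) (hdist t ht)
  refine hupper.trans (le_trans ?_ (mul_le_mul_right hlower _))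
  rw [← ENNReal.ofReal_mul (by positivity)]
  apply ENNReal.ofReal_le_ofReal
  have hDpow : D ^ (2 * r) * (D ^ 2) ^ q ≤ D ^ (2 * (r : ℝ) + 2 * q + 1) := by
    rw [← Real.rpow_natCast D (2 * r), ← Real.rpow_natCast D 2, ← Real.rpow_mul hD0.le,
      ← Real.rpow_add hD0]
    apply Real.rpow_le_rpow_of_exponent_le hD
    push_cast
    linarith
  calc K * (16 * D ^ 2) ^ r * S * (chebPt α N (j + 1) - chebPt α N j) ^ q
      ≤ K * (16 * D ^ 2) ^ r * S * (32 * D ^ 2 * h) ^ q := by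
        gcongr
    _ = K * (16 * D ^ 2) ^ r * S * ((32 * K) * D ^ 2 * (h / K)) ^ q := by
        congr 2
        field_simp
    _ = K * 16 ^ r * (32 * K) ^ q * (D ^ (2 * r) * (D ^ 2) ^ q) * (S * (h / K) ^ q) := by
        rw [Real.mul_rpow (by positivity) (by positivity),
          Real.mul_rpow (by positivity) (by positivity), mul_pow, ← pow_mul]
        ring
    _ ≤ _ := by gcongr
end
end
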